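/- Let Ω ⊂ ℝ² be a bounded, simply connected domain with smooth boundary, let F be a rotationally invariant function on the space of symmetric 2×2 real matrices that is not identically zero on any nonempty open subset of that space, and let u be real analytic on an open neighborhood of the closure of Ω, not identically zero, satisfying F(D²u) = 0 in Ω, u = 0 on ∂Ω, and |Du| = c on ∂Ω for some constant c. Then Ω is an open disk and u is radial with respect to the center of Ω. -/

import Mathlib

open Set Metric Topology Asymptotics MvPolynomial Matrix

/-- Partial derivative with respect to the first variable. -/
noncomputable def pdx (f : ℝ × ℝ → ℝ) (p : ℝ × ℝ) : ℝ :=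
  deriv (fun x => f (x, p.2)) p.1

/-- Partial derivative with respect to the second variable. -/
noncomputable def pdy (f : ℝ × ℝ → ℝ) (p : ℝ × ℝ) : ℝ :=
  deriv (fun y => f (p.1, y)) p.2

/-- The Laplacian `Δu = u_xx + u_yy`. -/
noncomputable def lap (f : ℝ × ℝ → ℝ) (p : ℝ × ℝ) : ℝ :=
  pdx (pdx f) p + pdy (pdy f) p

/-- The Hessian determinant `det D²u = u_xx u_yy - u_xy²`. -/
noncomputable def hessDet (f : ℝ × ℝ → ℝ) (p : ℝ × ℝ) : ℝ :=
  pdx (pdx f) p * pdy (pdy f) p - (pdx (pdy f) p) ^ 2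

/-- The Jacobian `J[f,g] = f_x g_y - f_y g_x`. -/
noncomputable def jacDet (f g : ℝ × ℝ → ℝ) (p : ℝ × ℝ) : ℝ :=
  pdx f p * pdy g p - pdy f p * pdx g p

open ComplexConjugate

section Degree

/-- `HasDegree f n` says that the `1`-periodic nonvanishing function `f` has degree `n`:
a continuous logarithm of `f` increases by `2πin` over a period. -/
def HasDegree (f : ℝ → ℂ) (n : ℤ) : Prop :=
  ∃ l : ℝ → ℂ, Continuous l ∧ (∀ s, Complex.exp (l s) = f s) ∧
    ∀ s, l (s + 1) = l s + n * (2 * Real.pi * Complex.I)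

/-- A continuous nonvanishing function on a contractible, locally path connected space has a
continuous logarithm. -/
theorem exists_continuous_log {X : Type*} [TopologicalSpace X] [LocallyPathConnectedSpace X]
    [ContractibleSpace X] {f : X → ℂ} (hf : Continuous f) (h0 : ∀ x, f x ≠ 0) :
    ∃ l : X → ℂ, Continuous l ∧ ∀ x, Complex.exp (l x) = f x := by
  have hsc : IsSimplyConnected (univ : Set X) :=
    (Homeomorph.Set.univ X).toHomotopyEquiv.simplyConnectedSpace
  obtain ⟨l, hl, hle⟩ := Complex.exists_continuousOn_eqOn_exp_comp hsc isOpen_univ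
    hf.continuousOn (by rintro ⟨x, -, hx⟩; exact h0 x hx)
  exact ⟨l, continuousOn_univ.1 hl, fun x => hle (mem_univ x)⟩

/-- Two continuous functions with the same exponential differ by a constant multiple of `2πi`. -/
theorem exists_int_of_exp_eq {X : Type*} [TopologicalSpace X] [PreconnectedSpace X] [Nonempty X]
    {l₁ l₂ : X → ℂ} (h₁ : Continuous l₁) (h₂ : Continuous l₂)
    (h : ∀ x, Complex.exp (l₁ x) = Complex.exp (l₂ x)) :
    ∃ n : ℤ, ∀ x, l₁ x = l₂ x + n * (2 * Real.pi * Complex.I) := by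
  have key : ∀ x, ∃ n : ℤ, l₁ x = l₂ x + n * (2 * Real.pi * Complex.I) := fun x =>
    Complex.exp_eq_exp_iff_exists_int.1 (h x)
  choose n hn using key
  have hpi : (2 * Real.pi * Complex.I : ℂ) ≠ 0 := Complex.two_pi_I_ne_zero
  have hcast : Continuous fun x => ((n x : ℤ) : ℝ) := by
    have : (fun x => ((n x : ℤ) : ℝ)) =
        fun x => ((l₁ x - l₂ x) / (2 * Real.pi * Complex.I)).re := by
      ext x
      rw [hn x, add_sub_cancel_left, mul_div_cancel_right₀ _ hpi]
      simp
    rw [this]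
    fun_prop
  have hcont : Continuous n := Int.isClosedEmbedding_coe_real.isEmbedding.continuous_iff.2 hcast
  obtain ⟨x₀⟩ := ‹Nonempty X›
  refine ⟨n x₀, fun x => ?_⟩
  rw [hn x, PreconnectedSpace.constant inferInstance hcont (x := x) (y := x₀)]

theorem HasDegree.exists_of_periodic {f : ℝ → ℂ} (hf : Continuous f) (h0 : ∀ s, f s ≠ 0)
    (hp : ∀ s, f (s + 1) = f s) : ∃ n, HasDegree f n := by
  obtain ⟨l, hl, hle⟩ := exists_continuous_log hf h0
  obtain ⟨n, hn⟩ := exists_int_of_exp_eq (l₁ := fun s => l (s + 1)) (l₂ := l) (by fun_prop) hl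
    (fun s => by rw [hle, hle, hp])
  exact ⟨n, l, hl, hle, hn⟩

theorem HasDegree.unique {f : ℝ → ℂ} {m n : ℤ} (hm : HasDegree f m) (hn : HasDegree f n) :
    m = n := by
  obtain ⟨l₁, h₁, he₁, hp₁⟩ := hm
  obtain ⟨l₂, h₂, he₂, hp₂⟩ := hn
  obtain ⟨k, hk⟩ := exists_int_of_exp_eq h₁ h₂ (fun s => by rw [he₁, he₂])
  have e : (m : ℂ) * (2 * Real.pi * Complex.I) = n * (2 * Real.pi * Complex.I) := by
    have e1 := hp₁ 0
    rw [hk, hk, hp₂] at e1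
    linear_combination -e1
  exact_mod_cast mul_right_cancel₀ Complex.two_pi_I_ne_zero e

theorem HasDegree.mul {f g : ℝ → ℂ} {m n : ℤ} (hf : HasDegree f m) (hg : HasDegree g n) :
    HasDegree (fun s => f s * g s) (m + n) := by
  obtain ⟨l₁, h₁, he₁, hp₁⟩ := hf
  obtain ⟨l₂, h₂, he₂, hp₂⟩ := hg
  refine ⟨fun s => l₁ s + l₂ s, by fun_prop, fun s => by rw [Complex.exp_add, he₁, he₂],
    fun s => ?_⟩
  simp only [hp₁, hp₂]
  push_cast
  ring

theorem HasDegree.const {a : ℂ} (ha : a ≠ 0) : HasDegree (fun _ => a) 0 :=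
  ⟨fun _ => Complex.log a, by fun_prop, fun _ => Complex.exp_log ha, fun _ => by simp⟩

theorem HasDegree.pow {f : ℝ → ℂ} {m : ℤ} (hf : HasDegree f m) (k : ℕ) :
    HasDegree (fun s => f s ^ k) (k * m) := by
  induction k with
  | zero => simpa using HasDegree.const one_ne_zero
  | succ k ih =>
    have := ih.mul hf
    simp only [pow_succ]
    convert this using 1
    push_cast; ring

theorem HasDegree.prod {ι : Type*} (t : Finset ι) {f : ι → ℝ → ℂ} {m : ι → ℤ}
    (hf : ∀ i ∈ t, HasDegree (f i) (m i)) :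
    HasDegree (fun s => ∏ i ∈ t, f i s) (∑ i ∈ t, m i) := by
  classical
  induction t using Finset.induction_on with
  | empty => simpa using HasDegree.const one_ne_zero
  | insert a t ha ih =>
    simp only [Finset.prod_insert ha, Finset.sum_insert ha]
    exact (hf a (by simp)).mul (ih fun i hi => hf i (by simp [hi]))

/-- Dividing by the complex conjugate doubles the degree. -/
theorem HasDegree.div_conj {f : ℝ → ℂ} {m : ℤ} (hf : HasDegree f m) :
    HasDegree (fun s => f s / (starRingEnd ℂ) (f s)) (2 * m) := by
  obtain ⟨l, h, he, hp⟩ := hf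
  refine ⟨fun s => l s - (starRingEnd ℂ) (l s),
    h.sub (Complex.continuous_conj.comp h), fun s => ?_, fun s => ?_⟩
  · rw [Complex.exp_sub, Complex.exp_conj, he]
  · simp only [hp, map_add, map_mul, Complex.conj_I, Complex.conj_ofReal, map_ofNat, map_intCast]
    push_cast
    ring

/-- Degree is invariant under homotopies through periodic nonvanishing functions. -/
theorem HasDegree.homotopy {f : ℝ → ℝ → ℂ} (hf : Continuous fun x : ℝ × ℝ => f x.1 x.2)
    (h0 : ∀ t s, f t s ≠ 0) (hp : ∀ t s, f t (s + 1) = f t s) {a b : ℝ} {n : ℤ}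
    (ha : HasDegree (f a) n) : HasDegree (f b) n := by
  obtain ⟨l, hl, hle⟩ := exists_continuous_log hf (fun x => h0 x.1 x.2)
  obtain ⟨k, hk⟩ := exists_int_of_exp_eq (l₁ := fun x : ℝ × ℝ => l (x.1, x.2 + 1)) (l₂ := l)
    (by fun_prop) hl (fun x => by rw [hle, hle, hp])
  have hdeg : ∀ t, HasDegree (f t) k := fun t =>
    ⟨fun s => l (t, s), by fun_prop, fun s => hle (t, s), fun s => hk (t, s)⟩
  rw [ha.unique (hdeg a)]
  exact hdeg b

/-- On a torus, the degree along the diagonal is the sum of the degrees in both directions. -/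
theorem HasDegree.diag {f : ℝ → ℝ → ℂ} (hf : Continuous fun x : ℝ × ℝ => f x.1 x.2)
    (h0 : ∀ t s, f t s ≠ 0) (hp₁ : ∀ t s, f (t + 1) s = f t s)
    (hp₂ : ∀ t s, f t (s + 1) = f t s) {m n d : ℤ} {a b : ℝ}
    (hm : HasDegree (fun t => f t b) m) (hn : HasDegree (f a) n)
    (hd : HasDegree (fun s => f s s) d) : d = m + n := by
  obtain ⟨l, hl, hle⟩ := exists_continuous_log hf (fun x => h0 x.1 x.2)
  obtain ⟨k, hk⟩ := exists_int_of_exp_eq (l₁ := fun x : ℝ × ℝ => l (x.1, x.2 + 1)) (l₂ := l)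
    (by fun_prop) hl (fun x => by rw [hle, hle, hp₂])
  obtain ⟨j, hj⟩ := exists_int_of_exp_eq (l₁ := fun x : ℝ × ℝ => l (x.1 + 1, x.2)) (l₂ := l)
    (by fun_prop) hl (fun x => by rw [hle, hle, hp₁])
  have hn' : HasDegree (f a) k :=
    ⟨fun s => l (a, s), by fun_prop, fun s => hle (a, s), fun s => hk (a, s)⟩
  have hm' : HasDegree (fun t => f t b) j :=
    ⟨fun t => l (t, b), by fun_prop, fun t => hle (t, b), fun t => hj (t, b)⟩
  have hd' : HasDegree (fun s => f s s) (j + k) :=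
    ⟨fun s => l (s, s), by fun_prop, fun s => hle (s, s), fun s => by
      have e1 := hk (s + 1, s)
      have e2 := hj (s, s)
      simp only at e1 e2 ⊢
      rw [e1, e2]; push_cast; ring⟩
  rw [hd.unique hd', hm.unique hm', hn.unique hn']

/-- A nonvanishing continuous function on a simply connected open set has degree zero along every
closed curve in that set. -/
theorem HasDegree.of_isSimplyConnected {Ω : Set ℂ} (hΩ : IsOpen Ω) (hsc : IsSimplyConnected Ω)
    {g : ℂ → ℂ} (hg : ContinuousOn g Ω) (h0 : ∀ z ∈ Ω, g z ≠ 0) {γ : ℝ → ℂ} (hγ : Continuous γ)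
    (hper : ∀ s, γ (s + 1) = γ s) (hγΩ : ∀ s, γ s ∈ Ω) : HasDegree (fun s => g (γ s)) 0 := by
  obtain ⟨l, hl, hle⟩ := Complex.exists_continuousOn_eqOn_exp_comp hsc hΩ hg
    (by rintro ⟨x, hx, hx0⟩; exact h0 x hx hx0)
  exact ⟨fun s => l (γ s), hl.comp_continuous hγ hγΩ, fun s => hle (hγΩ s),
    fun s => by simp [hper]⟩

end Degree

section Curve

/-- A regular simple closed curve of class `C²` in the plane, parametrized with period `1`. -/
structure IsRegularLoop (γ : ℝ → ℂ) : Prop where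
  contDiff : ContDiff ℝ 2 γ
  periodic : ∀ s, γ (s + 1) = γ s
  injOn : InjOn γ (Ico (0 : ℝ) 1)
  deriv_ne : ∀ s, deriv γ s ≠ 0

/-- The slope `(γ(s) - γ(a)) / (s - a)` of a secant, extended by `γ'(a)` to `s = a`. -/
noncomputable def secantSlope (γ : ℝ → ℂ) (a s : ℝ) : ℂ :=
  ∫ t in (0 : ℝ)..1, deriv γ (a + t * (s - a))

/-- The squared direction of the secant from `γ(a)` to `γ(s)`, extended by the squared direction
of the tangent to pairs with `γ(s) = γ(a)`. -/
noncomputable def secantDir (γ : ℝ → ℂ) (a s : ℝ) : ℂ :=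
  open Classical in
  if γ s = γ a then deriv γ a / (starRingEnd ℂ) (deriv γ a)
  else (γ s - γ a) / (starRingEnd ℂ) (γ s - γ a)

theorem conj_div_ne_zero {z : ℂ} (hz : z ≠ 0) : z / (starRingEnd ℂ) z ≠ 0 :=
  div_ne_zero hz ((map_ne_zero _).2 hz)

namespace IsRegularLoop

theorem continuous {γ : ℝ → ℂ} (h : IsRegularLoop γ) : Continuous γ := h.contDiff.continuous

theorem differentiable {γ : ℝ → ℂ} (h : IsRegularLoop γ) : Differentiable ℝ γ :=
    h.contDiff.differentiable (by norm_num)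

theorem contDiff_deriv {γ : ℝ → ℂ} (h : IsRegularLoop γ) : ContDiff ℝ 1 (deriv γ) := by
  have := h.contDiff
  rw [show (2 : WithTop ℕ∞) = 1 + 1 by norm_num, contDiff_succ_iff_deriv] at this
  exact this.2.2

theorem continuous_deriv {γ : ℝ → ℂ} (h : IsRegularLoop γ) : Continuous (deriv γ) :=
    h.contDiff_deriv.continuous

theorem periodic_int {γ : ℝ → ℂ} (h : IsRegularLoop γ) (s : ℝ) (n : ℤ) : γ (s + n) = γ s := by
  have := (show Function.Periodic γ 1 from h.periodic).int_mul n s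
  simpa using this

theorem deriv_periodic {γ : ℝ → ℂ} (h : IsRegularLoop γ) (s : ℝ) : deriv γ (s + 1) = deriv γ s := by
  rw [← deriv_comp_add_const]
  congr 1
  ext x
  exact h.periodic x

theorem deriv_periodic_int {γ : ℝ → ℂ} (h : IsRegularLoop γ) (s : ℝ) (n : ℤ) : deriv γ
    (s + n) = deriv γ s := by
  have := (show Function.Periodic (deriv γ) 1 from h.deriv_periodic).int_mul n s
  simpa using this

theorem eq_iff {γ : ℝ → ℂ} (h : IsRegularLoop γ) {a s : ℝ} : γ s = γ a ↔ ∃ n : ℤ, s = a + n := by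
  constructor
  · intro hs
    have e1 : γ (Int.fract s) = γ s := by
      rw [← h.periodic_int (Int.fract s) ⌊s⌋, Int.fract_add_floor]
    have e2 : γ (Int.fract a) = γ a := by
      rw [← h.periodic_int (Int.fract a) ⌊a⌋, Int.fract_add_floor]
    have e3 := h.injOn ⟨Int.fract_nonneg s, Int.fract_lt_one s⟩
      ⟨Int.fract_nonneg a, Int.fract_lt_one a⟩ (by rw [e1, e2, hs])
    refine ⟨⌊s⌋ - ⌊a⌋, ?_⟩
    have f1 := Int.fract_add_floor s
    have f2 := Int.fract_add_floor a
    push_cast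
    linarith
  · rintro ⟨n, rfl⟩
    exact h.periodic_int a n

theorem continuous_secantSlope {γ : ℝ → ℂ} (h : IsRegularLoop γ) : Continuous fun x :
    ℝ × ℝ => secantSlope γ x.1 x.2 := by
  unfold secantSlope
  refine intervalIntegral.continuous_parametric_intervalIntegral_of_continuous' ?_ 0 1
  have := h.continuous_deriv
  simp only [Function.uncurry_def]
  fun_prop

theorem secantSlope_self {γ : ℝ → ℂ} (a : ℝ) : secantSlope γ a a = deriv γ a := by
  simp [secantSlope]

theorem mul_secantSlope {γ : ℝ → ℂ} (h : IsRegularLoop γ) (a s : ℝ) :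
    (s - a : ℂ) * secantSlope γ a s = γ s - γ a := by
  have key := intervalIntegral.integral_eq_sub_of_hasDerivAt (a := 0) (b := 1)
    (f := fun t : ℝ => γ (a + t * (s - a)))
    (f' := fun t : ℝ => (s - a) • deriv γ (a + t * (s - a))) (fun t _ => by
      have h1 : HasDerivAt (fun t : ℝ => a + t * (s - a)) (s - a) t := by
        simpa using ((hasDerivAt_id t).mul_const (s - a)).const_add a
      exact (h.differentiable _).hasDerivAt.scomp t h1) (by
      have := h.continuous_deriv
      exact Continuous.intervalIntegrable (by fun_prop) _ _)
  rw [intervalIntegral.integral_smul] at key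
  simp only [one_mul, zero_mul, add_zero, add_sub_cancel, Complex.real_smul] at key
  push_cast at key
  exact key

theorem secantSlope_ne_zero {γ : ℝ → ℂ} (h : IsRegularLoop γ) {a s : ℝ} (hs : |s - a| < 1) :
    secantSlope γ a s ≠ 0 := by
  intro h0
  have h1 := h.mul_secantSlope a s
  rw [h0, mul_zero, eq_comm, sub_eq_zero, h.eq_iff] at h1
  obtain ⟨n, rfl⟩ := h1
  have hn : n = 0 := by
    rw [add_sub_cancel_left] at hs
    have : |n| < 1 := by exact_mod_cast hs
    exact Int.abs_lt_one_iff.1 this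
  subst hn
  rw [Int.cast_zero, add_zero, secantSlope_self] at h0
  exact h.deriv_ne a h0

theorem secantDir_eq_secantSlope {γ : ℝ → ℂ} (h : IsRegularLoop γ) {a s : ℝ} {n : ℤ}
    (hs : |s - n - a| < 1) :
    secantDir γ a s = secantSlope γ a (s - n) / (starRingEnd ℂ) (secantSlope γ a (s - n)) := by
  have hγ : γ (s - n) = γ s := by
    rw [← h.periodic_int (s - n) n, sub_add_cancel]
  have hmul := h.mul_secantSlope a (s - n)
  rw [hγ] at hmul
  unfold secantDir
  split_ifs with h1
  · rw [h1, sub_self, mul_eq_zero] at hmul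
    have h2 := hmul.resolve_right (h.secantSlope_ne_zero hs)
    have h3 : s - n = a := by
      have : (((s - n) - a : ℝ) : ℂ) = 0 := by push_cast; push_cast at h2; exact h2
      have := Complex.ofReal_eq_zero.1 this
      linarith
    rw [h3, secantSlope_self]
  · have h2 : ((s - n : ℝ) - a : ℂ) ≠ 0 := fun h3 => by
      rw [h3, zero_mul] at hmul
      exact h1 (sub_eq_zero.1 hmul.symm)
    rw [← hmul, map_mul, map_sub, Complex.conj_ofReal, Complex.conj_ofReal]
    exact mul_div_mul_left _ _ h2

theorem continuous_secantDir {γ : ℝ → ℂ} (h : IsRegularLoop γ) : Continuous fun x :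
    ℝ × ℝ => secantDir γ x.1 x.2 := by
  rw [continuous_iff_continuousAt]
  rintro ⟨a, s⟩
  set n : ℤ := ⌊s - a⌋
  have hn : |s - n - a| < 1 := by
    have h1 := Int.floor_le (s - a)
    have h2 := Int.lt_floor_add_one (s - a)
    rw [abs_lt]; constructor <;> linarith
  have hopen : IsOpen {x : ℝ × ℝ | |x.2 - n - x.1| < 1} :=
    isOpen_lt (by fun_prop) continuous_const
  have hev : (fun x : ℝ × ℝ => secantDir γ x.1 x.2) =ᶠ[𝓝 (a, s)] fun x =>
      secantSlope γ x.1 (x.2 - n) / (starRingEnd ℂ) (secantSlope γ x.1 (x.2 - n)) := by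
    filter_upwards [hopen.mem_nhds hn] with x hx
    exact h.secantDir_eq_secantSlope hx
  refine ContinuousAt.congr ?_ hev.symm
  have hc : Continuous fun x : ℝ × ℝ => secantSlope γ x.1 (x.2 - n) :=
    h.continuous_secantSlope.comp (f := fun x : ℝ × ℝ => (x.1, x.2 - (n : ℝ))) (by fun_prop)
  exact hc.continuousAt.div (Complex.continuous_conj.comp hc).continuousAt
    ((map_ne_zero _).2 (h.secantSlope_ne_zero hn))

theorem secantDir_ne_zero {γ : ℝ → ℂ} (h : IsRegularLoop γ) (a s : ℝ) : secantDir γ a s ≠ 0 := by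
  unfold secantDir
  split_ifs with h1
  · exact conj_div_ne_zero (h.deriv_ne a)
  · exact conj_div_ne_zero (sub_ne_zero.2 h1)

theorem secantDir_comm {γ : ℝ → ℂ} (h : IsRegularLoop γ) (a s : ℝ) :
    secantDir γ a s = secantDir γ s a := by
  unfold secantDir
  by_cases h1 : γ s = γ a
  · rw [if_pos h1, if_pos h1.symm]
    obtain ⟨n, rfl⟩ := h.eq_iff.1 h1
    rw [h.deriv_periodic_int]
  · rw [if_neg h1, if_neg (Ne.symm h1), ← neg_sub (γ a), map_neg, neg_div_neg_eq]

theorem secantDir_add_one {γ : ℝ → ℂ} (h : IsRegularLoop γ) (a s : ℝ) : secantDir γ a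
    (s + 1) = secantDir γ a s := by
  unfold secantDir
  rw [h.periodic]

theorem secantDir_self {γ : ℝ → ℂ} (a : ℝ) :
    secantDir γ a a = deriv γ a / (starRingEnd ℂ) (deriv γ a) := by
  simp [secantDir]

theorem exists_hasDegree_deriv {γ : ℝ → ℂ} (h : IsRegularLoop γ) : ∃ τ, HasDegree (deriv γ) τ :=
  HasDegree.exists_of_periodic h.continuous_deriv h.deriv_ne h.deriv_periodic

/-- The squared secant direction from a point of the curve has the degree of the tangent. -/
theorem hasDegree_secantDir {γ : ℝ → ℂ} (h : IsRegularLoop γ) {τ : ℤ}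
    (hτ : HasDegree (deriv γ) τ) (a : ℝ) :
    HasDegree (secantDir γ a) τ := by
  have hc := h.continuous_secantDir
  obtain ⟨n, hn⟩ := HasDegree.exists_of_periodic (f := secantDir γ a) (by fun_prop)
    (h.secantDir_ne_zero a) (h.secantDir_add_one a)
  have hm : HasDegree (fun t => secantDir γ t a) n := by
    simpa only [h.secantDir_comm _ a] using hn
  have hd : HasDegree (fun s => secantDir γ s s) (2 * τ) := by
    simpa only [secantDir_self] using hτ.div_conj
  have := HasDegree.diag hc h.secantDir_ne_zero (fun t s => by
    rw [h.secantDir_comm, h.secantDir_add_one, h.secantDir_comm]) h.secantDir_add_one hm hn hd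
  have hτn : τ = n := by omega
  rw [hτn]
  exact hn

/-- The tangent of a regular loop has nonzero degree. -/
theorem degree_ne_zero {γ : ℝ → ℂ} (h : IsRegularLoop γ) {τ : ℤ} (hτ : HasDegree (deriv γ) τ) :
    τ ≠ 0 := by
  rintro rfl
  obtain ⟨a, -, ha⟩ := isCompact_Icc.exists_isMinOn (nonempty_Icc.2 zero_le_one)
    (Complex.continuous_im.comp h.continuous).continuousOn (s := Icc (0 : ℝ) 1)
  have hmin : ∀ s, (γ a).im ≤ (γ s).im := fun s => by
    have h1 := ha (show Int.fract s ∈ Icc (0 : ℝ) 1 from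
      ⟨Int.fract_nonneg s, (Int.fract_lt_one s).le⟩)
    have h2 : γ (Int.fract s) = γ s := by
      rw [← h.periodic_int (Int.fract s) ⌊s⌋, Int.fract_add_floor]
    simpa [h2] using h1
  have hreal : (deriv γ a).im = 0 := by
    have hd : HasDerivAt (fun s => (γ s).im) (deriv γ a).im a :=
      Complex.imCLM.hasFDerivAt.comp_hasDerivAt a (h.differentiable a).hasDerivAt
    have hloc : IsLocalMin (fun s => (γ s).im) a := Filter.Eventually.of_forall hmin
    exact hloc.hasDerivAt_eq_zero hd
  obtain ⟨l, hl, hle, hlp⟩ := h.hasDegree_secantDir hτ a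
  set chord : ℝ → ℂ := fun s => secantSlope γ a s - secantSlope γ a (s - 1) with hchord
  have hslope := h.continuous_secantSlope
  have hcc : Continuous chord := by
    have h1 : Continuous fun s => secantSlope γ a s := by fun_prop
    have h2 : Continuous fun s => secantSlope γ a (s - 1) := by fun_prop
    exact h1.sub h2
  have hmul1 := h.mul_secantSlope a
  have hmul2 : ∀ s : ℝ, (s - 1 - a : ℂ) * secantSlope γ a (s - 1) = γ s - γ a := fun s => by
    have h1 := h.mul_secantSlope a (s - 1)
    rw [← h.periodic (s - 1), sub_add_cancel] at h1
    rw [← h1]; push_cast; ring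
  have hleft : chord a = deriv γ a := by
    have h1 := hmul2 a
    simp only [sub_self, hchord] at h1 ⊢
    rw [secantSlope_self]
    have h3 : secantSlope γ a (a - 1) = 0 := by
      have : (a - 1 - a : ℂ) = -1 := by ring
      rw [this] at h1
      simpa using h1
    rw [h3, sub_zero]
  have hright : chord (a + 1) = -deriv γ a := by
    have h1 := hmul1 (a + 1)
    rw [h.periodic, sub_self] at h1
    have h3 : secantSlope γ a (a + 1) = 0 := by
      have : (((a + 1 : ℝ) : ℂ) - a) = 1 := by push_cast; ring
      rw [this] at h1
      simpa using h1
    simp only [hchord]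
    rw [h3, add_sub_cancel_right, secantSlope_self, zero_sub]
  have hmid : ∀ s ∈ Ioo a (a + 1), ((s - a) * (a + 1 - s) : ℝ) * chord s = γ s - γ a := by
    intro s hs
    simp only [hchord]
    push_cast
    linear_combination (a + 1 - s : ℂ) * hmul1 s + (s - a : ℂ) * hmul2 s
  have hprop : ∀ s ∈ Icc a (a + 1), chord s ≠ 0 ∧ 0 ≤ (chord s).im ∧
      secantDir γ a s = chord s / (starRingEnd ℂ) (chord s) := by
    intro s hs
    rcases eq_or_lt_of_le hs.1 with rfl | h1
    · rw [hleft, secantDir_self]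
      exact ⟨h.deriv_ne _, hreal.ge, rfl⟩
    rcases eq_or_lt_of_le hs.2 with rfl | h2
    · rw [hright, h.secantDir_add_one, secantDir_self]
      refine ⟨neg_ne_zero.2 (h.deriv_ne _), by simp [hreal], ?_⟩
      rw [map_neg, neg_div_neg_eq]
    · have h3 := hmid s ⟨h1, h2⟩
      have hpos : 0 < (s - a) * (a + 1 - s) := mul_pos (by linarith) (by linarith)
      have hne : γ s ≠ γ a := by
        intro h4
        obtain ⟨n, rfl⟩ := h.eq_iff.1 h4
        have h5 : (0 : ℝ) < n := by linarith
        have h6 : (n : ℝ) < 1 := by linarith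
        have h7 : 0 < n := by exact_mod_cast h5
        have h8 : n < 1 := by exact_mod_cast h6
        omega
      refine ⟨fun h4 => ?_, ?_, ?_⟩
      · rw [h4, mul_zero] at h3
        exact hne (sub_eq_zero.1 h3.symm)
      · have h4 : (s - a) * (a + 1 - s) * (chord s).im = (γ s).im - (γ a).im := by
          rw [← Complex.im_ofReal_mul, h3, Complex.sub_im]
        have h5 := hmin s
        by_contra! h6
        nlinarith
      · unfold secantDir
        rw [if_neg hne, ← h3, map_mul, Complex.conj_ofReal]
        exact mul_div_mul_left _ _ (by exact_mod_cast hpos.ne')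
  set v : ℝ → ℂ := fun s => Complex.log (chord s / Complex.I) with hv
  have hslit : ∀ s ∈ Icc a (a + 1), chord s / Complex.I ∈ Complex.slitPlane := fun s hs => by
    obtain ⟨h1, h2, -⟩ := hprop s hs
    rw [Complex.mem_slitPlane_iff]
    simp only [Complex.div_I, Complex.neg_re, Complex.mul_re, Complex.I_re, Complex.I_im,
      Complex.neg_im, Complex.mul_im, mul_zero, mul_one, zero_sub, neg_neg, add_zero]
    rcases h2.lt_or_eq with h3 | h3
    · exact Or.inl h3
    · refine Or.inr fun h4 => h1 (Complex.ext (by simpa using h4) h3.symm)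
  have hvc : ContinuousOn v (Icc a (a + 1)) :=
    ContinuousOn.clog (by fun_prop) hslit
  have hve : ∀ s ∈ Icc a (a + 1), Complex.exp (l s) =
      Complex.exp (v s - (starRingEnd ℂ) (v s) + Real.pi * Complex.I) := fun s hs => by
    obtain ⟨h1, -, h3⟩ := hprop s hs
    have h4 : Complex.exp (v s) = chord s / Complex.I :=
      Complex.exp_log (div_ne_zero h1 Complex.I_ne_zero)
    have h5 : (starRingEnd ℂ) (chord s) ≠ 0 := (map_ne_zero _).2 h1
    rw [hle, h3, Complex.exp_add, Complex.exp_sub, Complex.exp_conj, h4, Complex.exp_pi_mul_I,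
      map_div₀, Complex.conj_I]
    field_simp
  have : PreconnectedSpace (Icc a (a + 1)) :=
    isPreconnected_iff_preconnectedSpace.1 isPreconnected_Icc
  have ha1 : a ∈ Icc a (a + 1) := ⟨le_rfl, by linarith⟩
  have ha2 : a + 1 ∈ Icc a (a + 1) := ⟨by linarith, le_rfl⟩
  have : Nonempty (Icc a (a + 1)) := ⟨⟨a, ha1⟩⟩
  have hvr : Continuous fun s : Icc a (a + 1) => v s :=
    continuousOn_iff_continuous_domRestrict.1 hvc
  obtain ⟨n, hn⟩ := exists_int_of_exp_eq (X := Icc a (a + 1)) (l₁ := fun s => l s)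
    (l₂ := fun s => v s - (starRingEnd ℂ) (v s) + Real.pi * Complex.I)
    (hl.comp continuous_subtype_val)
    ((hvr.sub (Complex.continuous_conj.comp hvr)).add continuous_const) (fun s => hve s s.2)
  have h1 := hn ⟨a, ha1⟩
  have h2 := hn ⟨a + 1, ha2⟩
  have h3 := hlp a
  simp only [Int.cast_zero, zero_mul, add_zero] at h1 h2 h3
  have h4 : v (a + 1) - (starRingEnd ℂ) (v (a + 1)) = v a - (starRingEnd ℂ) (v a) := by
    linear_combination h3 - h2 + h1
  rw [Complex.sub_conj, Complex.sub_conj] at h4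
  have h5 : (v (a + 1)).im = (v a).im := by
    have := mul_right_cancel₀ Complex.I_ne_zero h4
    have := Complex.ofReal_injective this
    linarith
  have h6 : Complex.exp (v (a + 1)) = -Complex.exp (v a) := by
    simp only [hv]
    rw [Complex.exp_log (div_ne_zero (hprop _ ha2).1 Complex.I_ne_zero),
      Complex.exp_log (div_ne_zero (hprop _ ha1).1 Complex.I_ne_zero), hleft, hright, neg_div]
  have h7 : Complex.exp (v (a + 1) - v a) = -1 := by
    rw [Complex.exp_sub, h6, neg_div, div_self (Complex.exp_ne_zero _)]
  have h8 : v (a + 1) - v a = ((v (a + 1) - v a).re : ℝ) := by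
    apply Complex.ext <;> simp [h5]
  rw [h8, ← Complex.ofReal_exp] at h7
  have h9 : Real.exp (v (a + 1) - v a).re = -1 := by exact_mod_cast h7
  linarith [Real.exp_pos (v (a + 1) - v a).re]

end IsRegularLoop

end Curve

namespace IsRegularLoop

/-- Small normal displacements of a regular loop avoid the loop. -/
theorem exists_normal_avoids {γ : ℝ → ℂ} (h : IsRegularLoop γ) : ∃ δ > 0, ∀ t s s' :
    ℝ, t ≠ 0 → |t| < δ →
    γ s + t * (Complex.I * deriv γ s) ≠ γ s' := by
  have hslope := h.continuous_secantSlope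
  have hd := h.continuous_deriv
  set K : Set (ℝ × ℝ) := Icc 0 1 ×ˢ Icc (-1 / 2 : ℝ) (1 / 2) with hK
  have hKc : IsCompact K := isCompact_Icc.prod isCompact_Icc
  have hloc : ∀ y ∈ K, ∀ᶠ x : ℝ × (ℝ × ℝ) in 𝓝 (0, y), x.1 ≠ 0 →
      γ x.2.1 + x.1 * (Complex.I * deriv γ x.2.1) ≠ γ (x.2.1 + x.2.2) := by
    rintro ⟨s, r⟩ ⟨-, hr⟩
    simp only at hr
    have hγc := h.continuous
    by_cases hr0 : r = 0
    · subst hr0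
      have hpos : 0 < ((starRingEnd ℂ) (deriv γ s) * secantSlope γ s (s + 0)).re := by
        rw [add_zero, secantSlope_self, Complex.conj_mul']
        have := norm_pos_iff.2 (h.deriv_ne s)
        norm_cast
        positivity
      have hcont : Continuous fun x : ℝ × (ℝ × ℝ) =>
          ((starRingEnd ℂ) (deriv γ x.2.1) * secantSlope γ x.2.1 (x.2.1 + x.2.2)).re := by
        have h1 : Continuous fun x : ℝ × (ℝ × ℝ) => secantSlope γ x.2.1 (x.2.1 + x.2.2) := by
          fun_prop
        have h2 : Continuous fun x : ℝ × (ℝ × ℝ) => (starRingEnd ℂ) (deriv γ x.2.1) :=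
          Complex.continuous_conj.comp (by fun_prop)
        exact Complex.continuous_re.comp (h2.mul h1)
      filter_upwards [(isOpen_lt continuous_const hcont).mem_nhds hpos] with x hx hx0 heq
      obtain ⟨t, s', r'⟩ := x
      simp only at hx hx0 heq
      have h1 := h.mul_secantSlope s' (s' + r')
      rw [← heq, add_sub_cancel_left] at h1
      have h2 : ((r' : ℝ) : ℂ) * ((starRingEnd ℂ) (deriv γ s') * secantSlope γ s' (s' + r')) =
          (t * ‖deriv γ s'‖ ^ 2 : ℝ) * Complex.I := by
        have h3 := Complex.conj_mul' (deriv γ s')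
        push_cast at h1 h3 ⊢
        linear_combination (starRingEnd ℂ) (deriv γ s') * h1 + t * Complex.I * h3
      have h4 := congrArg Complex.re h2
      rw [Complex.re_ofReal_mul, Complex.re_ofReal_mul, Complex.I_re, mul_zero, mul_eq_zero] at h4
      have h5 : r' = 0 := h4.resolve_right hx.ne'
      have h6 := congrArg Complex.im h2
      rw [h5, Complex.im_ofReal_mul, Complex.im_ofReal_mul, Complex.I_im, zero_mul, mul_one,
        eq_comm, mul_eq_zero] at h6
      have := h.deriv_ne s'
      rcases h6 with h6 | h6
      · exact hx0 h6
      · exact this (by simpa using h6)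
    · have hne : γ s + (0 : ℝ) * (Complex.I * deriv γ s) - γ (s + r) ≠ 0 := by
        simp only [Complex.ofReal_zero, zero_mul, add_zero, sub_ne_zero]
        intro h1
        obtain ⟨n, hn⟩ := h.eq_iff.1 h1
        have h2 : r = ((-n : ℤ) : ℝ) := by push_cast; linarith
        have h3 : |(-n : ℤ)| < 1 := by
          have : |r| < 1 := abs_lt.2 ⟨by linarith [hr.1], by linarith [hr.2]⟩
          rw [h2] at this
          exact_mod_cast this
        rw [Int.abs_lt_one_iff] at h3
        rw [h3] at h2
        exact hr0 (by simpa using h2)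
      have hcont : Continuous fun x : ℝ × (ℝ × ℝ) =>
          γ x.2.1 + x.1 * (Complex.I * deriv γ x.2.1) - γ (x.2.1 + x.2.2) := by fun_prop
      filter_upwards [hcont.continuousAt.eventually_ne (x := (0, (s, r))) hne] with x hx _ heq
      exact hx (sub_eq_zero.2 heq)
  have hall := hKc.eventually_forall_of_forall_eventually (x₀ := (0 : ℝ))
    (P := fun t y => t ≠ 0 → γ y.1 + t * (Complex.I * deriv γ y.1) ≠ γ (y.1 + y.2)) hloc
  obtain ⟨δ, hδ, hball⟩ := Metric.eventually_nhds_iff.1 hall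
  refine ⟨δ, hδ, fun t s s' ht0 ht => ?_⟩
  have h1 := hball (y := t) (by simpa using ht) (Int.fract s, s' - s - round (s' - s))
    ⟨⟨Int.fract_nonneg s, (Int.fract_lt_one s).le⟩, by
      have := abs_sub_round (s' - s)
      rw [abs_le] at this
      constructor <;> linarith [this.1, this.2]⟩ ht0
  have e0 : Int.fract s = s + ((-⌊s⌋ : ℤ) : ℝ) := by push_cast; rw [Int.fract]; ring
  have e1 : s + ((-⌊s⌋ : ℤ) : ℝ) + (s' - s - round (s' - s)) =
      s' + ((-⌊s⌋ - round (s' - s) : ℤ) : ℝ) := by push_cast; ring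
  rw [e0] at h1
  simp only [e1, h.periodic_int, h.deriv_periodic_int] at h1
  exact h1

/-- A one-sided normal collar of a regular loop bounding an open set lies in that set. -/
theorem exists_normal_mem {γ : ℝ → ℂ} (h : IsRegularLoop γ) {Ω : Set ℂ} (hΩ : IsOpen Ω)
    (hfr : frontier Ω = range γ) :
    ∃ b : ℝ, b ≠ 0 ∧ ∀ t ∈ Ioc (0 : ℝ) 1, ∀ s, γ s + (t * b : ℝ) * (Complex.I * deriv γ s) ∈ Ω := by
  obtain ⟨δ, hδ, hav⟩ := h.exists_normal_avoids
  have hγc := h.continuous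
  have hdc := h.continuous_deriv
  set Φ : ℝ × ℝ → ℂ := fun x => γ x.1 + x.2 * (Complex.I * deriv γ x.1) with hΦ
  have hΦc : Continuous Φ := by fun_prop
  have hΦs : ContDiff ℝ 1 Φ := by
    have h1 : ContDiff ℝ 1 γ := h.contDiff.of_le (by norm_num)
    have h2 := h.contDiff_deriv
    have h3 : ContDiff ℝ 1 fun x : ℝ × ℝ => ((x.2 : ℝ) : ℂ) :=
      Complex.ofRealCLM.contDiff.comp contDiff_snd
    exact (h1.comp contDiff_fst).add (h3.mul (contDiff_const.mul (h2.comp contDiff_fst)))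
  have hst : HasStrictFDerivAt Φ (fderiv ℝ Φ (0, 0)) (0, 0) :=
    hΦs.contDiffAt.hasStrictFDerivAt (by norm_num)
  have e1 : fderiv ℝ Φ (0, 0) (1, 0) = deriv γ 0 := by
    have hl : HasDerivAt (fun s : ℝ => ((s, 0) : ℝ × ℝ)) (1, 0) 0 :=
      (hasDerivAt_id _).prodMk (hasDerivAt_const _ _)
    have h1 := HasFDerivAt.comp_hasDerivAt (f := fun s : ℝ => ((s, 0) : ℝ × ℝ)) (0 : ℝ)
      hst.hasFDerivAt hl
    have h2 : (Φ ∘ fun s : ℝ => ((s, 0) : ℝ × ℝ)) = γ := by ext s; simp [hΦ]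
    rw [h2] at h1
    exact h1.deriv.symm
  have e2 : fderiv ℝ Φ (0, 0) (0, 1) = Complex.I * deriv γ 0 := by
    have hl : HasDerivAt (fun s : ℝ => ((0, s) : ℝ × ℝ)) (0, 1) 0 :=
      (hasDerivAt_const _ _).prodMk (hasDerivAt_id _)
    have h1 := HasFDerivAt.comp_hasDerivAt (f := fun s : ℝ => ((0, s) : ℝ × ℝ)) (0 : ℝ)
      hst.hasFDerivAt hl
    have h2 : HasDerivAt (fun s : ℝ => γ 0 + s * (Complex.I * deriv γ 0))
        (1 * (Complex.I * deriv γ 0)) 0 :=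
      ((Complex.ofRealCLM.hasDerivAt (x := (0 : ℝ))).mul_const _).const_add _
    rw [one_mul] at h2
    exact h1.unique h2
  have hsurj : (fderiv ℝ Φ (0, 0)).range = ⊤ := by
    rw [LinearMap.range_eq_top]
    intro w
    refine ⟨((w / deriv γ 0).re, (w / deriv γ 0).im), ?_⟩
    have : (((w / deriv γ 0).re, (w / deriv γ 0).im) : ℝ × ℝ) =
        (w / deriv γ 0).re • (1, 0) + (w / deriv γ 0).im • ((0, 1) : ℝ × ℝ) := by simp
    rw [this]
    show fderiv ℝ Φ (0, 0) _ = w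
    rw [map_add, map_smul, map_smul, e1, e2, Complex.real_smul, Complex.real_smul]
    have h1 := Complex.re_add_im (w / deriv γ 0)
    have h2 := div_mul_cancel₀ w (h.deriv_ne 0)
    linear_combination deriv γ 0 * h1 + h2
  have hmap := hst.map_nhds_eq_of_surj hsurj
  have hfrq : ∃ᶠ z in 𝓝 (Φ (0, 0)), z ∈ Ω := by
    have h1 : Φ (0, 0) ∈ frontier Ω := by rw [hfr]; exact ⟨0, by simp [hΦ]⟩
    exact mem_closure_iff_frequently.1 (frontier_subset_closure h1)
  rw [← hmap] at hfrq
  have hsm : ∀ᶠ x : ℝ × ℝ in 𝓝 (0, 0), |x.2| < δ :=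
    (isOpen_lt (by fun_prop : Continuous fun x : ℝ × ℝ => |x.2|) continuous_const).mem_nhds
      (by simpa using hδ)
  obtain ⟨⟨s₀, t₀⟩, hmem, ht₀⟩ := (hfrq.and_eventually (f := 𝓝 ((0 : ℝ), (0 : ℝ))) hsm).exists
  simp only at ht₀
  have hdisj : ∀ s t, t ≠ 0 → |t| < δ → Φ (s, t) ∉ frontier Ω := fun s t h0 h1 h2 => by
    rw [hfr] at h2
    obtain ⟨s', hs'⟩ := h2
    exact hav t s s' h0 h1 hs'.symm
  have ht₀0 : t₀ ≠ 0 := by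
    rintro rfl
    have h1 : Φ (s₀, 0) ∈ frontier Ω := by rw [hfr]; exact ⟨s₀, by simp [hΦ]⟩
    rw [hΩ.frontier_eq] at h1
    exact h1.2 hmem
  refine ⟨t₀, ht₀0, fun t ht s => ?_⟩
  have hconn : IsPreconnected (Φ '' (univ ×ˢ ((fun r => r * t₀) '' Ioc (0 : ℝ) 1))) :=
    (isPreconnected_univ.prod (isPreconnected_Ioc.image _ (by fun_prop))).image _
      hΦc.continuousOn
  have hsub : Φ '' (univ ×ˢ ((fun r => r * t₀) '' Ioc (0 : ℝ) 1)) ⊆ Ω := by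
    refine hconn.subset_left_of_subset_union hΩ isClosed_closure.isOpen_compl
      (disjoint_compl_right.mono_left subset_closure |>.mono_right subset_rfl) ?_ ?_
    · rintro - ⟨⟨s, -⟩, ⟨-, r, hr, rfl⟩, rfl⟩
      by_contra hn
      simp only [mem_union, not_or, mem_compl_iff, not_not] at hn
      refine hdisj s (r * t₀) (mul_ne_zero hr.1.ne' ht₀0) ?_
        (by rw [hΩ.frontier_eq]; exact ⟨hn.2, hn.1⟩)
      rw [abs_mul, abs_of_pos hr.1]
      nlinarith [hr.1, hr.2, abs_nonneg t₀]
    · exact ⟨Φ (s₀, t₀), ⟨(s₀, t₀), ⟨mem_univ _, 1, by simp, by simp⟩, rfl⟩, hmem⟩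
  exact hsub ⟨(s, t * t₀), ⟨mem_univ _, t, ht, rfl⟩, rfl⟩

end IsRegularLoop

namespace IsRegularLoop

/-- A nonvanishing continuous function on the closure of a simply connected open set bounded by a
regular loop has degree zero along that loop. -/
theorem hasDegree_comp {γ : ℝ → ℂ} (h : IsRegularLoop γ) {Ω : Set ℂ} (hΩ : IsOpen Ω)
    (hsc : IsSimplyConnected Ω)
    (hfr : frontier Ω = range γ) {g : ℂ → ℂ} (hg : ContinuousOn g (closure Ω))
    (h0 : ∀ z ∈ closure Ω, g z ≠ 0) : HasDegree (fun s => g (γ s)) 0 := by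
  obtain ⟨b, -, hmem⟩ := h.exists_normal_mem hΩ hfr
  have hγc := h.continuous
  have hdc := h.continuous_deriv
  set c : ℝ → ℝ := fun t => max 0 (min 1 t) with hc
  have hcc : Continuous c := by fun_prop
  set f : ℝ → ℝ → ℂ := fun t s => γ s + (c t * b : ℝ) * (Complex.I * deriv γ s) with hf
  have hfc : Continuous fun x : ℝ × ℝ => f x.1 x.2 := by simp only [hf]; fun_prop
  have hfm : ∀ t s, f t s ∈ closure Ω := fun t s => by
    have h1 : 0 ≤ c t := le_max_left _ _
    have h2 : c t ≤ 1 := max_le zero_le_one (min_le_left _ _)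
    rcases h1.eq_or_lt with h3 | h3
    · apply frontier_subset_closure
      rw [hfr]
      exact ⟨s, by simp [hf, ← h3]⟩
    · exact subset_closure (hmem _ ⟨h3, h2⟩ s)
  have hper : ∀ t s, f t (s + 1) = f t s := fun t s => by
    simp only [hf, h.periodic, h.deriv_periodic]
  have h1 : HasDegree (fun s => g (f 1 s)) 0 :=
    HasDegree.of_isSimplyConnected hΩ hsc (hg.mono subset_closure)
      (fun z hz => h0 z (subset_closure hz)) (by fun_prop) (hper 1) (fun s => by
        have : c 1 = 1 := by simp [hc]
        simp only [hf, this]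
        exact hmem 1 (by simp) s)
  have h2 := HasDegree.homotopy (f := fun t s => g (f t s)) (b := 0)
    (hg.comp_continuous hfc fun x => hfm x.1 x.2) (fun t s => h0 _ (hfm t s))
    (fun t s => by rw [hper]) h1
  have h3 : ∀ s, f 0 s = γ s := fun s => by simp [hf, hc]
  simpa only [h3] using h2

/-- The winding number of a regular loop around an interior point is the degree of its tangent. -/
theorem hasDegree_sub {γ : ℝ → ℂ} (h : IsRegularLoop γ) {Ω : Set ℂ} (hΩ : IsOpen Ω)
    (hsc : IsSimplyConnected Ω)
    (hfr : frontier Ω = range γ) {τ : ℤ} (hτ : HasDegree (deriv γ) τ) {p : ℂ} (hp : p ∈ Ω) :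
    HasDegree (fun s => γ s - p) τ := by
  obtain ⟨b, hb, hmem⟩ := h.exists_normal_mem hΩ hfr
  have hγc := h.continuous
  have hdc := h.continuous_deriv
  have hnot : ∀ s, γ s ∉ Ω := fun s hs => by
    have : γ s ∈ frontier Ω := by rw [hfr]; exact ⟨s, rfl⟩
    rw [hΩ.frontier_eq] at this
    exact this.2 hs
  set η : ℝ → ℂ := fun s => γ s + (1 * b : ℝ) * (Complex.I * deriv γ s) with hη
  have hηc : Continuous η := by simp only [hη]; fun_prop
  have hηm : ∀ s, η s ∈ Ω := hmem 1 (by simp)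
  have hηp : ∀ s, η (s + 1) = η s := fun s => by simp only [hη, h.periodic, h.deriv_periodic]
  have hne : ∀ a s, γ s - η a ≠ 0 := fun a s h1 => hnot s (by
    rw [sub_eq_zero.1 h1]; exact hηm a)
  obtain ⟨n, hn⟩ := HasDegree.exists_of_periodic (f := fun s => γ s - η 0) (by fun_prop)
    (hne 0) (fun s => by rw [h.periodic])
  have hm : HasDegree (fun a => γ 0 - η a) 0 :=
    HasDegree.of_isSimplyConnected hΩ hsc (g := fun z => γ 0 - z) (by fun_prop)
      (fun z hz h1 => hnot 0 (by rw [sub_eq_zero.1 h1]; exact hz)) hηc hηp hηm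
  have hd : HasDegree (fun s => γ s - η s) τ := by
    have h1 := (HasDegree.const (a := -(b * Complex.I))
      (neg_ne_zero.2 (mul_ne_zero (by exact_mod_cast hb) Complex.I_ne_zero))).mul hτ
    rw [zero_add] at h1
    convert h1 using 2 with s
    simp only [hη]; push_cast; ring
  have := HasDegree.diag (f := fun a s => γ s - η a) (by fun_prop) hne
    (fun a s => by rw [hηp]) (fun a s => by rw [h.periodic]) hm hn hd
  rw [zero_add] at this
  subst this
  have hj := hsc.isPathConnected.joinedIn _ (hηm 0) _ hp
  have h2 := HasDegree.homotopy (f := fun t s => γ s - hj.somePath.extend t) (a := 0) (b := 1)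
    (by have := hj.somePath.continuous_extend; fun_prop)
    (fun t s h1 => hnot s (by
      rw [sub_eq_zero.1 h1]
      exact hj.somePath_mem (projIcc 0 1 zero_le_one t)))
    (fun t s => by rw [h.periodic]) (by simpa using hn)
  simpa using h2

end IsRegularLoop

section LocalForm

/-- Local structure of a plane line field at a point: either an isolated zero of `q` with
holomorphic leading form `a ζ ^ k`, or a point near which `q` is a real function times a
nonvanishing continuous one, with leading form `a (ζ + e ζ̄) ^ k`. -/
def HasLocalForm (q : ℂ → ℂ) (p : ℂ) : Prop :=
  ∃ (k : ℕ) (a e : ℂ), a ≠ 0 ∧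
    ((fun ζ => q (p + ζ) - a * (ζ + e * (starRingEnd ℂ) ζ) ^ k) =O[𝓝 0] fun ζ => ‖ζ‖ ^ (k + 1)) ∧
    (e = 0 ∨ (e ≠ 0 ∧ ∃ E : ℂ → ℂ, E p = e ∧ (∀ᶠ z in 𝓝 p, ContinuousAt E z) ∧
      ∀ᶠ z in 𝓝 p, (starRingEnd ℂ) (q z * E z) = q z * E z))

theorem tendsto_div_pow_of_leadingForm {q : ℂ → ℂ} {p a e : ℂ} {k : ℕ}
    (hq : (fun ζ => q (p + ζ) - a * (ζ + e * (starRingEnd ℂ) ζ) ^ k) =O[𝓝 0]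
      fun ζ => ‖ζ‖ ^ (k + 1)) {c : ℝ → ℂ} {s : ℝ} {η : ℂ} (hc : HasDerivAt c η s) (hcs : c s = p) :
    Filter.Tendsto (fun t : ℝ => q (c (s + t)) / (t : ℂ) ^ k) (𝓝[≠] 0)
      (𝓝 (a * (η + e * (starRingEnd ℂ) η) ^ k)) := by
  have hsl : Filter.Tendsto (fun t : ℝ => (t : ℂ)⁻¹ * (c (s + t) - p)) (𝓝[≠] 0) (𝓝 η) := by
    have := hasDerivAt_iff_tendsto_slope_zero.1 hc
    simpa [hcs] using this
  have h0 : Filter.Tendsto (fun t : ℝ => c (s + t) - p) (𝓝[≠] 0) (𝓝 0) := by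
    have h1 : ContinuousAt (fun t : ℝ => c (s + t) - p) 0 := by
      have : ContinuousAt c (s + 0) := by simpa using hc.continuousAt
      exact (this.comp (f := fun t => s + t) (by fun_prop)).sub continuousAt_const
    have h2 := h1.tendsto
    simp only [add_zero, hcs, sub_self] at h2
    exact h2.mono_left nhdsWithin_le_nhds
  have hO := hq.comp_tendsto h0
  have hmain : Filter.Tendsto (fun t : ℝ => a * ((t : ℂ)⁻¹ * (c (s + t) - p) +
      e * (starRingEnd ℂ) ((t : ℂ)⁻¹ * (c (s + t) - p))) ^ k) (𝓝[≠] 0)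
      (𝓝 (a * (η + e * (starRingEnd ℂ) η) ^ k)) :=
    ((hsl.add (((Complex.continuous_conj.tendsto _).comp hsl).const_mul e)).pow k).const_mul a
  have hrem : Filter.Tendsto (fun t : ℝ => (q (p + (c (s + t) - p)) - a * ((c (s + t) - p) +
      e * (starRingEnd ℂ) (c (s + t) - p)) ^ k) / (t : ℂ) ^ k) (𝓝[≠] 0) (𝓝 0) := by
    have h1 : (fun t : ℝ => (q (p + (c (s + t) - p)) - a * ((c (s + t) - p) +
      e * (starRingEnd ℂ) (c (s + t) - p)) ^ k) / (t : ℂ) ^ k) =O[𝓝[≠] 0]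
        fun t : ℝ => ‖c (s + t) - p‖ ^ (k + 1) / (t : ℂ) ^ k := by
      have : (fun t : ℝ => ((‖c (s + t) - p‖ ^ (k + 1) : ℝ) : ℂ) / (t : ℂ) ^ k) =
        fun t : ℝ => ‖c (s + t) - p‖ ^ (k + 1) / (t : ℂ) ^ k := by ext t; push_cast; rfl
      rw [← this]
      simp only [div_eq_mul_inv]
      refine IsBigO.mul ?_ (isBigO_refl _ _)
      refine hO.trans (IsBigO.of_bound 1 (Filter.Eventually.of_forall fun t => ?_))
      simp
    refine h1.trans_tendsto ?_
    rw [tendsto_zero_iff_norm_tendsto_zero]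
    have h2 : Filter.Tendsto (fun t : ℝ => ‖(t : ℂ)⁻¹ * (c (s + t) - p)‖ ^ k * ‖c (s + t) - p‖)
        (𝓝[≠] 0) (𝓝 (‖η‖ ^ k * ‖(0 : ℂ)‖)) := (hsl.norm.pow k).mul h0.norm
    rw [norm_zero, mul_zero] at h2
    refine h2.congr fun t => ?_
    simp only [norm_div, norm_mul, norm_inv, norm_pow, Complex.norm_real, norm_norm]
    rw [mul_pow, inv_pow]
    ring
  have hsum := hmain.add hrem
  rw [add_zero] at hsum
  refine hsum.congr' ?_
  filter_upwards [self_mem_nhdsWithin] with t ht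
  have ht' : (t : ℂ) ≠ 0 := by exact_mod_cast ht
  rw [map_mul, map_inv₀, Complex.conj_ofReal, add_sub_cancel]
  have e1 : (t : ℂ)⁻¹ * (c (s + t) - p) + e * ((t : ℂ)⁻¹ * (starRingEnd ℂ) (c (s + t) - p)) =
      ((c (s + t) - p) + e * (starRingEnd ℂ) (c (s + t) - p)) / t := by
    field_simp
  rw [e1, div_pow]
  field_simp
  ring

theorem HasLocalForm.mem_closure {q : ℂ → ℂ} {p : ℂ} (hq : HasLocalForm q p) :
    p ∈ closure {z | q z ≠ 0} := by
  obtain ⟨k, a, e, ha, hO, -⟩ := hq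
  obtain ⟨η, hη⟩ : ∃ η : ℂ, η + e * (starRingEnd ℂ) η ≠ 0 := by
    by_contra! hall
    have h1 := hall 1
    have h2 := hall Complex.I
    simp only [map_one, Complex.conj_I] at h1 h2
    have h3 : (2 : ℂ) * Complex.I = 0 := by linear_combination h2 + Complex.I * h1
    simp at h3
  have hd : HasDerivAt (fun t : ℝ => p + t * η) η 0 := by
    have := ((Complex.ofRealCLM.hasDerivAt (x := (0 : ℝ))).mul_const η).const_add p
    simpa using this
  have ht := tendsto_div_pow_of_leadingForm hO hd (by simp)
  have hev := ht.eventually_ne (mul_ne_zero ha (pow_ne_zero k hη))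
  have hlim : Filter.Tendsto (fun t : ℝ => p + ((0 + t : ℝ) : ℂ) * η) (𝓝[≠] 0) (𝓝 p) := by
    have : Continuous (fun t : ℝ => p + ((0 + t : ℝ) : ℂ) * η) := by fun_prop
    have h1 := this.tendsto 0
    simp only [add_zero, Complex.ofReal_zero, zero_mul] at h1
    exact h1.mono_left nhdsWithin_le_nhds
  refine mem_closure_of_tendsto hlim ?_
  filter_upwards [hev] with t ht1 ht2
  exact ht1 (by rw [ht2, zero_div])

end LocalForm

section LineField

/-- Near an isolated zero with holomorphic leading form, `q` does not vanish and its squared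
direction is asymptotic to that of `ζ ^ k`. -/
theorem tendsto_dir_of_holomorphic_leadingForm {q : ℂ → ℂ} {p a : ℂ} {k : ℕ} (ha : a ≠ 0)
    (hO : (fun ζ => q (p + ζ) - a * (ζ + 0 * (starRingEnd ℂ) ζ) ^ k) =O[𝓝 0]
      fun ζ => ‖ζ‖ ^ (k + 1)) :
    (∀ᶠ z in 𝓝[≠] p, q z ≠ 0) ∧
    Filter.Tendsto (fun z => q z / (starRingEnd ℂ) (q z) *
      ((starRingEnd ℂ) (z - p) / (z - p)) ^ k) (𝓝[≠] p) (𝓝 (a / (starRingEnd ℂ) a)) := by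
  have h0 : Filter.Tendsto (fun z => z - p) (𝓝[≠] p) (𝓝 0) := by
    have : Continuous fun z => z - p := by fun_prop
    have h1 := this.tendsto p
    rw [sub_self] at h1
    exact h1.mono_left nhdsWithin_le_nhds
  have hO' := hO.comp_tendsto h0
  have hlim : Filter.Tendsto (fun z => q z / (z - p) ^ k) (𝓝[≠] p) (𝓝 a) := by
    have h1 : Filter.Tendsto (fun z => (q z - a * (z - p) ^ k) / (z - p) ^ k) (𝓝[≠] p) (𝓝 0) := by
      obtain ⟨C, hC⟩ := hO'.bound
      refine squeeze_zero_norm' (a := fun z => C * ‖z - p‖) ?_ ?_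
      · filter_upwards [hC, self_mem_nhdsWithin] with z hz hzp
        simp only [Function.comp, add_sub_cancel, zero_mul, add_zero, norm_pow, norm_norm] at hz
        have hpos : 0 < ‖z - p‖ := norm_pos_iff.2 (sub_ne_zero.2 hzp)
        rw [norm_div, norm_pow, div_le_iff₀ (by positivity)]
        calc _ ≤ _ := hz
          _ = _ := by ring
      · simpa using h0.norm.const_mul C
    have h2 := h1.add_const a
    rw [zero_add] at h2
    refine h2.congr' ?_
    filter_upwards [self_mem_nhdsWithin] with z hz
    have : (z - p) ^ k ≠ 0 := pow_ne_zero _ (sub_ne_zero.2 hz)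
    field_simp
    ring
  refine ⟨?_, ?_⟩
  · filter_upwards [hlim.eventually_ne ha] with z hz h1
    exact hz (by rw [h1, zero_div])
  · have h1 := hlim.div ((Complex.continuous_conj.tendsto _).comp hlim) ((map_ne_zero _).2 ha)
    refine h1.congr fun z => ?_
    show q z / (z - p) ^ k / (starRingEnd ℂ) (q z / (z - p) ^ k) = _
    simp only [map_div₀, map_pow, div_pow]
    rw [div_div_div_eq, div_mul_div_comm]
    ring

theorem eventually_dir_eq {q E : ℂ → ℂ} {p : ℂ} (hE : ContinuousAt E p) (h0 : E p ≠ 0)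
    (hq : ∀ᶠ z in 𝓝 p, (starRingEnd ℂ) (q z * E z) = q z * E z) :
    ∀ᶠ z in 𝓝 p, E z ≠ 0 ∧ (q z ≠ 0 →
      q z / (starRingEnd ℂ) (q z) = (starRingEnd ℂ) (E z) / E z) := by
  filter_upwards [hE.eventually_ne h0, hq] with z hz h1
  refine ⟨hz, fun h2 => ?_⟩
  have h3 : (starRingEnd ℂ) (q z) ≠ 0 := (map_ne_zero _).2 h2
  rw [div_eq_div_iff h3 hz, ← h1, map_mul, mul_comm]

/-- The squared direction of a line field with local forms everywhere has a limit along its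
nonzero set at all but finitely many points of a compact set. -/
theorem finite_setOf_not_tendsto_dir {K : Set ℂ} (hK : IsCompact K) {q : ℂ → ℂ}
    (hc : ∀ᶠ z in 𝓝ˢ K, ContinuousAt q z) (hq : ∀ p ∈ K, HasLocalForm q p) :
    {p ∈ K | ¬ ∃ y, Filter.Tendsto (fun z => q z / (starRingEnd ℂ) (q z))
      (𝓝[{z | q z ≠ 0}] p) (𝓝 y)}.Finite := by
  by_contra hinf
  obtain ⟨p, hp, hacc⟩ := Set.Infinite.exists_accPt_of_subset_isCompact hinf hK (sep_subset _ _)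
  rw [accPt_iff_frequently_nhdsNE] at hacc
  refine hacc ?_
  have hcp : ∀ᶠ z in 𝓝 p, ContinuousAt q z := hc.filter_mono (nhds_le_nhdsSet hp)
  obtain ⟨k, a, e, ha, hO, rfl | ⟨he, E, rfl, hEc, hE⟩⟩ := hq p hp
  · have h1 := (tendsto_dir_of_holomorphic_leadingForm ha hO).1
    filter_upwards [h1, hcp.filter_mono nhdsWithin_le_nhds] with z hz hz2 hz3
    refine hz3.2 ⟨_, ((hz2.div (Complex.continuous_conj.continuousAt.comp hz2)
      ((map_ne_zero _).2 hz)).tendsto).mono_left nhdsWithin_le_nhds⟩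
  · have h1 := eventually_dir_eq hEc.self_of_nhds he hE
    have h2 := (h1.eventually_nhds.and hEc).filter_mono (nhdsWithin_le_nhds (s := {p}ᶜ))
    filter_upwards [h2] with z hz hz3
    obtain ⟨hz1, hz2⟩ := hz
    refine hz3.2 ⟨_, Filter.Tendsto.congr' ?_ (((Complex.continuous_conj.continuousAt.comp hz2).div
      hz2 hz1.self_of_nhds.1).tendsto.mono_left nhdsWithin_le_nhds)⟩
    filter_upwards [hz1.filter_mono nhdsWithin_le_nhds, self_mem_nhdsWithin] with w hw hw2
    exact (hw.2 hw2).symm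

theorem continuousAt_conj_sub_div_pow {p x : ℂ} (k : ℕ) (hx : x ≠ p) :
    ContinuousAt (fun z => ((starRingEnd ℂ) (z - p) / (z - p)) ^ k) x := by
  have h1 : ContinuousAt (fun z : ℂ => (starRingEnd ℂ) (z - p)) x :=
    (Complex.continuous_conj.comp (by fun_prop : Continuous fun z : ℂ => z - p)).continuousAt
  have h2 : ContinuousAt (fun z : ℂ => z - p) x := by fun_prop
  exact (h1.div h2 (sub_ne_zero.2 hx)).pow k

set_option maxHeartbeats 400000 in
/-- There is no line field with nonnegative local indices on a simply connected plane domain which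
is parallel or orthogonal to the boundary curve. -/
theorem IsRegularLoop.not_hasLocalForm {γ : ℝ → ℂ} (h : IsRegularLoop γ) {Ω : Set ℂ}
    (hΩ : IsOpen Ω) (hsc : IsSimplyConnected Ω) (hbd : Bornology.IsBounded Ω)
    (hfr : frontier Ω = range γ) {q : ℂ → ℂ}
    (hc : ∀ᶠ z in 𝓝ˢ (closure Ω), ContinuousAt q z) (hq : ∀ p ∈ closure Ω, HasLocalForm q p)
    (htan : ∀ s, (starRingEnd ℂ) (q (γ s) * deriv γ s ^ 2) = q (γ s) * deriv γ s ^ 2) : False := by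
  classical
  have hKc : IsCompact (closure Ω) := hbd.isCompact_closure
  set Z : Set ℂ := {z | q z ≠ 0} with hZ
  set dir : ℂ → ℂ := fun z => q z / (starRingEnd ℂ) (q z) with hdir
  have hfin := finite_setOf_not_tendsto_dir hKc hc hq
  set S : Finset ℂ := hfin.toFinset with hS
  have hSK : ∀ p ∈ S, p ∈ closure Ω := fun p hp => ((hfin.mem_toFinset).1 hp).1
  have hcont : ∀ p ∈ closure Ω, ContinuousAt q p := fun p hp =>
    (hc.filter_mono (nhds_le_nhdsSet hp)).self_of_nhds
  have hdirc : ∀ p ∈ closure Ω, p ∈ Z → ContinuousAt dir p := fun p hp hpZ =>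
    (hcont p hp).div (Complex.continuous_conj.continuousAt.comp (hcont p hp))
      ((map_ne_zero _).2 hpZ)
  have hSZ : ∀ p ∈ S, p ∉ Z := fun p hp hpZ => ((hfin.mem_toFinset).1 hp).2
    ⟨_, (hdirc p (hSK p hp) hpZ).tendsto.mono_left nhdsWithin_le_nhds⟩
  have hSlim : ∀ p ∈ closure Ω, p ∉ S → ∃ y, Filter.Tendsto dir (𝓝[Z] p) (𝓝 y) :=
    fun p hp hpS => by
      by_contra hn
      exact hpS ((hfin.mem_toFinset).2 ⟨hp, hn⟩)
  have hidx : ∀ p ∈ S, ∃ k : ℕ, ∃ y, Filter.Tendsto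
      (fun z => dir z * ((starRingEnd ℂ) (z - p) / (z - p)) ^ k) (𝓝[Z] p) (𝓝 y) := fun p hp => by
    obtain ⟨k, a, e, ha, hO, rfl | ⟨he, E, rfl, hEc, hE⟩⟩ := hq p (hSK p hp)
    · refine ⟨k, _, (tendsto_dir_of_holomorphic_leadingForm ha hO).2.mono_left
        (nhdsWithin_mono _ fun z hz hzp => hSZ p hp (by rw [← mem_singleton_iff.1 hzp]; exact hz))⟩
    · have hEp := hEc.self_of_nhds
      refine (((hfin.mem_toFinset).1 hp).2 ⟨_, Filter.Tendsto.congr' ?_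
        (((Complex.continuous_conj.continuousAt.comp hEp).div hEp he).tendsto.mono_left
          nhdsWithin_le_nhds)⟩).elim
      filter_upwards [(eventually_dir_eq hEp he hE).filter_mono nhdsWithin_le_nhds,
        self_mem_nhdsWithin] with w hw hw2
      exact (hw.2 hw2).symm
  choose! k hk using hidx
  obtain ⟨fac, hfac⟩ : ∃ fac : ℂ → ℂ → ℂ,
      fac = fun p z => ((starRingEnd ℂ) (z - p) / (z - p)) ^ k p := ⟨_, rfl⟩
  have hfacc : ∀ p x, x ≠ p → ContinuousAt (fac p) x := fun p x hx => by
    rw [hfac]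
    exact continuousAt_conj_sub_div_pow (k p) hx
  have hfac' : ∀ p z, ((starRingEnd ℂ) (z - p) / (z - p)) ^ k p = fac p z := fun p z => by rw [hfac]
  set g : ℂ → ℂ := fun z => dir z * ∏ p ∈ S, fac p z with hg
  have hglim : ∀ x ∈ closure Ω, x ∉ S → ∀ y, Filter.Tendsto dir (𝓝[Z] x) (𝓝 y) →
      Filter.Tendsto g (𝓝[Z] x) (𝓝 (y * ∏ p ∈ S, fac p x)) := fun x hx hxS y hy =>
    hy.mul (tendsto_finsetProd _ fun p hp => (hfacc p x (by
      rintro rfl; exact hxS hp)).tendsto.mono_left nhdsWithin_le_nhds)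
  have hnb : ∀ x ∈ closure Ω, (𝓝[Z] x).NeBot := fun x hx =>
    mem_closure_iff_nhdsWithin_neBot.1 (hq x hx).mem_closure
  have hgex : ∀ x ∈ closure Ω, ∃ y, Filter.Tendsto g (𝓝[Z] x) (𝓝 y) := fun x hx => by
    by_cases hxS : x ∈ S
    · obtain ⟨y, hy⟩ := hk x hxS
      refine ⟨y * ∏ p ∈ S.erase x, fac p x, (hy.mul (tendsto_finsetProd (S.erase x) fun p hp =>
        (hfacc p x (Finset.ne_of_mem_erase hp).symm).tendsto.mono_left
          nhdsWithin_le_nhds)).congr fun z => ?_⟩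
      rw [mul_assoc, hfac', Finset.mul_prod_erase S (fun p => fac p z) hxS]
    · obtain ⟨y, hy⟩ := hSlim x hx hxS
      exact ⟨_, hglim x hx hxS y hy⟩
  set G : ℂ → ℂ := extendFrom Z g with hG
  have hGc : ContinuousOn G (closure Ω) :=
    continuousOn_extendFrom (fun x hx => (hq x hx).mem_closure) hgex
  have hGeq : ∀ x ∈ closure Ω, ∀ y, Filter.Tendsto g (𝓝[Z] x) (𝓝 y) → G x = y := fun x hx y hy =>
    extendFrom_eq (hq x hx).mem_closure hy
  have hnorm : ∀ z ∈ Z, ‖g z‖ = 1 := fun z hz => by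
    simp only [hg, hdir, hfac, norm_mul, norm_div, norm_prod, norm_pow, RCLike.norm_conj]
    rw [div_self (norm_ne_zero_iff.2 hz), one_mul]
    refine Finset.prod_eq_one fun p hp => ?_
    rw [div_self (norm_ne_zero_iff.2 (sub_ne_zero.2 (by rintro rfl; exact hSZ _ hp hz))), one_pow]
  have hG0 : ∀ x ∈ closure Ω, G x ≠ 0 := fun x hx h0 => by
    obtain ⟨y, hy⟩ := hgex x hx
    have h1 := hGeq x hx y hy
    have := hnb x hx
    have h2 : ‖y‖ = 1 := tendsto_nhds_unique hy.norm (tendsto_const_nhds.congr'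
      (by filter_upwards [self_mem_nhdsWithin] with z hz using (hnorm z hz).symm))
    rw [← h1, h0, norm_zero] at h2
    exact zero_ne_one h2
  have hGdeg := h.hasDegree_comp hΩ hsc hfr hGc hG0
  obtain ⟨τ, hτ⟩ := h.exists_hasDegree_deriv
  have hγm : ∀ s, γ s ∈ closure Ω := fun s => frontier_subset_closure (by rw [hfr]; exact ⟨s, rfl⟩)
  have hD : ∀ p ∈ S, ∃ (D : ℝ → ℂ) (d : ℕ), Continuous D ∧ HasDegree D (d * τ) ∧
      ∀ s, γ s ≠ p → D s = (γ s - p) / (starRingEnd ℂ) (γ s - p) := fun p hp => by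
    by_cases hpΩ : p ∈ Ω
    · have h1 := (h.hasDegree_sub hΩ hsc hfr hτ hpΩ).div_conj
      refine ⟨_, 2, ?_, h1, fun s _ => rfl⟩
      obtain ⟨l, hl, hle, -⟩ := h1
      have : (fun s => (γ s - p) / (starRingEnd ℂ) (γ s - p)) = fun s => Complex.exp (l s) := by
        ext s; rw [hle]
      rw [this]
      fun_prop
    · have h1 : p ∈ frontier Ω := by
        rw [hΩ.frontier_eq]; exact ⟨hSK p hp, hpΩ⟩
      rw [hfr] at h1
      obtain ⟨a, rfl⟩ := h1
      have hsd := h.continuous_secantDir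
      refine ⟨secantDir γ a, 1, by fun_prop, by simpa using h.hasDegree_secantDir hτ a,
        fun s hs => ?_⟩
      unfold secantDir
      rw [if_neg hs]
  choose! D d hDc hDdeg hDeq using hD
  set N : ℝ → ℂ := fun s => G (γ s) * (∏ p ∈ S, D p s ^ k p) *
    (deriv γ s / (starRingEnd ℂ) (deriv γ s)) ^ 2 with hN
  have hNdeg : HasDegree N (0 + ∑ p ∈ S, (k p : ℤ) * (d p * τ) + (2 : ℕ) * (2 * τ)) :=
    (hGdeg.mul (HasDegree.prod S fun p hp => (hDdeg p hp).pow (k p))).mul (hτ.div_conj.pow 2)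
  have hdc := h.continuous_deriv
  have hNc : Continuous N := by
    have h1 : Continuous fun s => G (γ s) := hGc.comp_continuous h.continuous hγm
    have h2 : Continuous fun s => ∏ p ∈ S, D p s ^ k p :=
      continuous_finsetProd _ fun p hp => (hDc p hp).pow _
    have h3 : Continuous fun s => deriv γ s / (starRingEnd ℂ) (deriv γ s) :=
      hdc.div (Complex.continuous_conj.comp hdc) fun s => (map_ne_zero _).2 (h.deriv_ne s)
    exact (h1.mul h2).mul (h3.pow 2)
  have hNval : ∀ s, γ s ∉ S → ∀ y, Filter.Tendsto dir (𝓝[Z] (γ s)) (𝓝 y) →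
      N s = y * (deriv γ s / (starRingEnd ℂ) (deriv γ s)) ^ 2 := fun s hs y hy => by
    simp only [hN]
    rw [hGeq _ (hγm s) _ (hglim _ (hγm s) hs y hy), mul_assoc y, ← Finset.prod_mul_distrib]
    rw [Finset.prod_eq_one, mul_one]
    intro p hp
    have hne : γ s ≠ p := by rintro rfl; exact hs hp
    have h1 : γ s - p ≠ 0 := sub_ne_zero.2 hne
    have h2 : (starRingEnd ℂ) (γ s - p) ≠ 0 := (map_ne_zero _).2 h1
    rw [hDeq p hp s hne, ← hfac', ← mul_pow, div_mul_div_comm, mul_comm, div_self (mul_ne_zero h1 h2),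
      one_pow]
  have hNone₀ : ∀ s ∈ {s | q (γ s) ≠ 0}, N s = 1 := fun s hs => by
    have h1 : γ s ∈ Z := hs
    rw [hNval s (fun h2 => hSZ _ h2 h1) _
      ((hdirc _ (hγm s) h1).tendsto.mono_left nhdsWithin_le_nhds)]
    have h2 := htan s
    have h3 : (starRingEnd ℂ) (q (γ s)) ≠ 0 := (map_ne_zero _).2 h1
    have h4 : (starRingEnd ℂ) (deriv γ s) ≠ 0 := (map_ne_zero _).2 (h.deriv_ne s)
    simp only [hdir]
    rw [map_mul, map_pow] at h2
    rw [div_pow, div_mul_div_comm, ← h2, div_self (mul_ne_zero h3 (pow_ne_zero _ h4))]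
  have hNone : ∀ s, N s = 1 := fun s => by
    by_cases hs : s ∈ closure {s | q (γ s) ≠ 0}
    · exact closure_minimal hNone₀ (isClosed_eq hNc continuous_const) hs
    · rw [mem_closure_iff_frequently, Filter.not_frequently] at hs
      have hz : ∀ᶠ t in 𝓝[≠] (0 : ℝ), q (γ (s + t)) = 0 := by
        have h1 : Filter.Tendsto (fun t => s + t) (𝓝[≠] (0 : ℝ)) (𝓝 s) := by
          have h2 : Filter.Tendsto (fun t => s + t) (𝓝 0) (𝓝 (s + 0)) :=
            (continuous_const.add continuous_id).tendsto 0
          rw [add_zero] at h2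
          exact h2.mono_left nhdsWithin_le_nhds
        filter_upwards [h1.eventually hs] with t ht
        simpa using ht
      obtain ⟨k', a, e, ha, hO, hcase⟩ := hq _ (hγm s)
      have hlim := tendsto_div_pow_of_leadingForm hO (h.differentiable s).hasDerivAt rfl
      have hzero : deriv γ s + e * (starRingEnd ℂ) (deriv γ s) = 0 := by
        have h1 := tendsto_nhds_unique hlim (tendsto_const_nhds.congr' (by
          filter_upwards [hz] with t ht
          rw [ht, zero_div]))
        exact eq_zero_of_pow_eq_zero ((mul_eq_zero.1 h1).resolve_left ha)
      obtain rfl | ⟨he, E, rfl, hEc, hE⟩ := hcase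
      · simp only [zero_mul, add_zero] at hzero
        exact (h.deriv_ne s hzero).elim
      · have hEp := hEc.self_of_nhds
        have hl : Filter.Tendsto dir (𝓝[Z] (γ s))
            (𝓝 ((starRingEnd ℂ) (E (γ s)) / E (γ s))) := by
          refine Filter.Tendsto.congr' ?_ (((Complex.continuous_conj.continuousAt.comp hEp).div
            hEp he).tendsto.mono_left nhdsWithin_le_nhds)
          filter_upwards [(eventually_dir_eq hEp he hE).filter_mono nhdsWithin_le_nhds,
            self_mem_nhdsWithin] with w hw hw2
          exact (hw.2 hw2).symm
        rw [hNval s (fun h2 => ((hfin.mem_toFinset).1 h2).2 ⟨_, hl⟩) _ hl]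
        have h4 : (starRingEnd ℂ) (deriv γ s) ≠ 0 := (map_ne_zero _).2 (h.deriv_ne s)
        have h5 : E (γ s) = -(deriv γ s / (starRingEnd ℂ) (deriv γ s)) := by
          field_simp
          linear_combination hzero
        have h6 := h.deriv_ne s
        rw [h5, map_neg, map_div₀, Complex.conj_conj]
        field_simp
  have hN1 : N = fun _ => 1 := funext hNone
  rw [hN1] at hNdeg
  have h1 := hNdeg.unique (HasDegree.const one_ne_zero)
  have h2 : τ * (∑ p ∈ S, (k p : ℤ) * d p + 4) = 0 := by
    rw [mul_add, Finset.mul_sum, ← h1, zero_add]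
    congr 1
    · exact Finset.sum_congr rfl fun p _ => by ring
    · push_cast; ring
  have h3 : (0 : ℤ) ≤ ∑ p ∈ S, (k p : ℤ) * d p := Finset.sum_nonneg fun p _ => by positivity
  rcases mul_eq_zero.1 h2 with h4 | h4
  · exact h.degree_ne_zero hτ h4
  · omega

end LineField

/-- Formal power series in two variables `z` (outer) and `w` (inner). -/
abbrev BiSeries : Type := PowerSeries (PowerSeries ℂ)

namespace BiSeries

/-- The coefficient of `z ^ i * w ^ j`. -/
noncomputable def cf (a : BiSeries) (i j : ℕ) : ℂ := PowerSeries.coeff j (PowerSeries.coeff i a)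

theorem ext_cf {a b : BiSeries} (h : ∀ i j, cf a i j = cf b i j) : a = b :=
  PowerSeries.ext fun i => PowerSeries.ext fun j => h i j

/-- The series with given coefficients. -/
noncomputable def ofCf (c : ℕ → ℕ → ℂ) : BiSeries :=
  PowerSeries.mk fun i => PowerSeries.mk fun j => c i j

@[simp] theorem cf_ofCf (c : ℕ → ℕ → ℂ) (i j : ℕ) : cf (ofCf c) i j = c i j := by
  simp [cf, ofCf]

@[simp] theorem cf_add (a b : BiSeries) (i j : ℕ) : cf (a + b) i j = cf a i j + cf b i j := by
  simp [cf]

@[simp] theorem cf_sub (a b : BiSeries) (i j : ℕ) : cf (a - b) i j = cf a i j - cf b i j := by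
  simp [cf]

@[simp] theorem cf_zero (i j : ℕ) : cf 0 i j = 0 := by
  simp [cf]

theorem cf_mul (a b : BiSeries) (i j : ℕ) : cf (a * b) i j =
    ∑ x ∈ Finset.HasAntidiagonal.antidiagonal i,
      ∑ y ∈ Finset.HasAntidiagonal.antidiagonal j, cf a x.1 y.1 * cf b x.2 y.2 := by
  simp [cf, PowerSeries.coeff_mul]

/-- The variable `z`. -/
noncomputable def z : BiSeries := PowerSeries.X

/-- The variable `w`. -/
noncomputable def w : BiSeries := PowerSeries.C PowerSeries.X

/-- The constant series. -/
noncomputable def const : ℂ →+* BiSeries := (PowerSeries.C).comp PowerSeries.C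

@[simp] theorem cf_const_mul (c : ℂ) (a : BiSeries) (i j : ℕ) :
    cf (const c * a) i j = c * cf a i j := by
  simp [cf, const]

theorem cf_const (c : ℂ) (i j : ℕ) : cf (const c) i j = if i = 0 ∧ j = 0 then c else 0 := by
  simp only [cf, const, RingHom.comp_apply, PowerSeries.coeff_C]
  split_ifs <;> simp_all [PowerSeries.coeff_C]

@[simp] theorem cf_z_mul_succ (a : BiSeries) (i j : ℕ) : cf (z * a) (i + 1) j = cf a i j := by
  simp [cf, z, PowerSeries.coeff_succ_X_mul]

@[simp] theorem cf_z_mul_zero (a : BiSeries) (j : ℕ) : cf (z * a) 0 j = 0 := by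
  simp [cf, z]

@[simp] theorem cf_w_mul_succ (a : BiSeries) (i j : ℕ) : cf (w * a) i (j + 1) = cf a i j := by
  simp [cf, w, PowerSeries.coeff_succ_X_mul]

@[simp] theorem cf_w_mul_zero (a : BiSeries) (i : ℕ) : cf (w * a) i 0 = 0 := by
  simp [cf, w]

theorem cf_z_pow_mul (s : ℕ) (a : BiSeries) (i j : ℕ) : cf (z ^ s * a) (s + i) j = cf a i j := by
  induction s with
  | zero => simp
  | succ s ih => rw [pow_succ', mul_assoc, add_right_comm, cf_z_mul_succ, ih]

theorem cf_w_pow_mul (s : ℕ) (a : BiSeries) (i j : ℕ) : cf (w ^ s * a) i (s + j) = cf a i j := by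
  induction s with
  | zero => simp
  | succ s ih => rw [pow_succ', mul_assoc, add_right_comm, cf_w_mul_succ, ih]

theorem cf_w_pow_mul_of_lt {s j : ℕ} (hj : j < s) (a : BiSeries) (i : ℕ) :
    cf (w ^ s * a) i j = 0 := by
  induction s generalizing j with
  | zero => omega
  | succ s ih =>
    rw [pow_succ', mul_assoc]
    cases j with
    | zero => simp
    | succ j => rw [cf_w_mul_succ, ih (by omega)]

theorem w_pow_dvd_iff {s : ℕ} {a : BiSeries} : w ^ s ∣ a ↔ ∀ i j, j < s → cf a i j = 0 := by
  refine ⟨?_, fun h => ⟨ofCf fun i j => cf a i (s + j), ext_cf fun i j => ?_⟩⟩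
  · rintro ⟨b, rfl⟩ i j hj
    exact cf_w_pow_mul_of_lt hj b i
  · rcases lt_or_ge j s with hj | hj
    · rw [h i j hj, cf_w_pow_mul_of_lt hj]
    · obtain ⟨j, rfl⟩ := Nat.exists_eq_add_of_le hj
      rw [cf_w_pow_mul, cf_ofCf]

theorem w_dvd_iff {a : BiSeries} : w ∣ a ↔ ∀ i, cf a i 0 = 0 := by
  have := w_pow_dvd_iff (s := 1) (a := a)
  rw [pow_one] at this
  exact this.trans ⟨fun h i => h i 0 one_pos, fun h i j hj => by rw [Nat.lt_one_iff.1 hj, h]⟩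

/-- Formal derivative with respect to `z`. -/
noncomputable def dz (a : BiSeries) : BiSeries := PowerSeries.derivative (PowerSeries ℂ) a

/-- Formal derivative with respect to `w`. -/
noncomputable def dw (a : BiSeries) : BiSeries :=
  PowerSeries.mk fun i => PowerSeries.derivative ℂ (PowerSeries.coeff i a)

@[simp] theorem cf_dz (a : BiSeries) (i j : ℕ) : cf (dz a) i j = (i + 1) * cf a (i + 1) j := by
  rw [cf, dz, PowerSeries.coeff_derivative, mul_comm]
  have : ((i : PowerSeries ℂ) + 1) = PowerSeries.C ((i : ℂ) + 1) := by simp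
  rw [this, PowerSeries.coeff_C_mul]
  rfl

@[simp] theorem cf_dw (a : BiSeries) (i j : ℕ) : cf (dw a) i j = (j + 1) * cf a i (j + 1) := by
  rw [cf, dw, PowerSeries.coeff_mk, PowerSeries.coeff_derivative, mul_comm]
  rfl

theorem dz_mul (a b : BiSeries) : dz (a * b) = a * dz b + b * dz a := by
  simp [dz]

theorem dw_mul (a b : BiSeries) : dw (a * b) = a * dw b + b * dw a := by
  ext1 i
  simp only [dw, PowerSeries.coeff_mk, PowerSeries.coeff_mul, map_sum, Derivation.leibniz, map_add,
    smul_eq_mul]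
  rw [← Finset.Nat.sum_antidiagonal_swap (n := i) (f := fun x => PowerSeries.coeff x.1 b * _),
    ← Finset.sum_add_distrib]
  exact Finset.sum_congr rfl fun x _ => rfl

theorem dz_add (a b : BiSeries) : dz (a + b) = dz a + dz b := by simp [dz]

theorem dw_add (a b : BiSeries) : dw (a + b) = dw a + dw b :=
  ext_cf fun i j => by simp; ring

theorem dz_dw_comm (a : BiSeries) : dz (dw a) = dw (dz a) := ext_cf fun i j => by simp; ring

theorem dz_pow (a : BiSeries) (n : ℕ) : dz (a ^ n) = n * a ^ (n - 1) * dz a := by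
  simp [dz, Derivation.leibniz_pow, mul_assoc]

theorem dw_pow (a : BiSeries) (n : ℕ) : dw (a ^ n) = n * a ^ (n - 1) * dw a := by
  induction n with
  | zero =>
    refine ext_cf fun i j => ?_
    have : (1 : BiSeries) = const 1 := by simp
    simp only [pow_zero, this, cf_dw, cf_const]
    simp
  | succ n ih =>
    rw [pow_succ, dw_mul, ih]
    rcases n with _ | n
    · simp
    · push_cast [Nat.add_sub_cancel]
      ring

/-- All coefficients of total degree less than `n` vanish. -/
def OrdGE (n : ℕ) (a : BiSeries) : Prop := ∀ i j, i + j < n → cf a i j = 0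

theorem OrdGE.mono {m n : ℕ} (h : m ≤ n) {a : BiSeries} (ha : OrdGE n a) : OrdGE m a :=
  fun i j hij => ha i j (hij.trans_le h)

theorem OrdGE.add {n : ℕ} {a b : BiSeries} (ha : OrdGE n a) (hb : OrdGE n b) : OrdGE n (a + b) :=
  fun i j hij => by rw [cf_add, ha i j hij, hb i j hij, add_zero]

theorem OrdGE.mul {m n : ℕ} {a b : BiSeries} (ha : OrdGE m a) (hb : OrdGE n b) :
    OrdGE (m + n) (a * b) := fun i j hij => by
  rw [cf_mul]
  refine Finset.sum_eq_zero fun x hx => Finset.sum_eq_zero fun y hy => ?_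
  rw [Finset.HasAntidiagonal.mem_antidiagonal] at hx hy
  rcases lt_or_ge (x.1 + y.1) m with h | h
  · rw [ha _ _ h, zero_mul]
  · rw [hb _ _ (by omega), mul_zero]

theorem OrdGE.dz {n : ℕ} {a : BiSeries} (ha : OrdGE (n + 1) a) : OrdGE n (dz a) :=
  fun i j hij => by rw [cf_dz, ha _ _ (by omega), mul_zero]

theorem exists_ordGE {a : BiSeries} (ha : a ≠ 0) :
    ∃ n, OrdGE n a ∧ ∃ i j, i + j = n ∧ cf a i j ≠ 0 := by
  classical
  have hex : ∃ n, ∃ i j, i + j = n ∧ cf a i j ≠ 0 := by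
    by_contra! h
    exact ha (ext_cf fun i j => by rw [h _ i j rfl, cf_zero])
  refine ⟨Nat.find hex, fun i j hij => ?_, Nat.find_spec hex⟩
  by_contra h
  exact Nat.find_min hex hij ⟨i, j, rfl, h⟩

theorem const_natCast_dvd {f b : BiSeries} {n : ℕ} (hn : n ≠ 0) (h : f ∣ (n : BiSeries) * b) :
    f ∣ b := by
  have h1 : const ((n : ℂ)⁻¹) * (n : BiSeries) = 1 := by
    rw [← map_natCast const n, ← map_mul, inv_mul_cancel₀ (Nat.cast_ne_zero.2 hn), map_one]
  have h2 := h.mul_left (const ((n : ℂ)⁻¹))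
  rwa [← mul_assoc, h1, one_mul] at h2

theorem isUnit_iff {a : BiSeries} : IsUnit a ↔ cf a 0 0 ≠ 0 := by
  rw [PowerSeries.isUnit_iff_constantCoeff, PowerSeries.isUnit_iff_constantCoeff, isUnit_iff_ne_zero]
  simp [cf]

theorem cf_zero_mul (a b : BiSeries) : cf (a * b) 0 0 = cf a 0 0 * cf b 0 0 := by
  simp [cf_mul]

theorem prime_w : Prime w := by
  have h : Prime (PowerSeries.X : PowerSeries ℂ) := PowerSeries.X_prime
  refine ⟨fun h0 => ?_, fun h0 => ?_, fun a b hab => ?_⟩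
  · have := cf_w_mul_succ 1 0 0
    rw [h0, zero_mul, cf_zero, ← map_one const, cf_const] at this
    simp at this
  · rw [isUnit_iff] at h0
    have := cf_w_mul_zero 1 0
    rw [mul_one] at this
    exact h0 this
  · have key : ∀ c : BiSeries, w ∣ c ↔ PowerSeries.map (PowerSeries.constantCoeff (R := ℂ)) c = 0 :=
      fun c => by
        rw [w_dvd_iff, PowerSeries.ext_iff]
        simp [cf]
    rw [key, map_mul, mul_eq_zero] at hab
    rwa [key, key]

/-- The Jacobian of two series. -/
noncomputable def jac (a b : BiSeries) : BiSeries := dz a * dw b - dw a * dz b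

theorem jac_mul_right (a b c : BiSeries) : jac a (b * c) = b * jac a c + c * jac a b := by
  simp only [jac, dz_mul, dw_mul]; ring

theorem jac_mul_left (a b c : BiSeries) : jac (a * b) c = a * jac b c + b * jac a c := by
  simp only [jac, dz_mul, dw_mul]; ring

theorem jac_add_left (a b c : BiSeries) : jac (a + b) c = jac a c + jac b c := by
  simp only [jac, dz_add, dw_add]; ring

theorem jac_self (a : BiSeries) : jac a a = 0 := by
  simp only [jac]; ring

theorem jac_pow_right (a b : BiSeries) (n : ℕ) :
    jac a (b ^ n) = n * b ^ (n - 1) * jac a b := by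
  simp only [jac, dz_pow, dw_pow]; ring

theorem dw_w : dw w = 1 := by
  simp [dw, w]
  ext i j
  rcases i with _ | i <;> simp [PowerSeries.coeff_C, PowerSeries.coeff_one]

theorem dz_C (s : PowerSeries ℂ) : dz (PowerSeries.C s) = 0 := by simp [dz]

theorem dw_C (s : PowerSeries ℂ) :
    dw (PowerSeries.C s) = PowerSeries.C (PowerSeries.derivative ℂ s) := by
  ext1 i
  rw [dw, PowerSeries.coeff_mk, PowerSeries.coeff_C, PowerSeries.coeff_C]
  split_ifs <;> simp

end BiSeries

/-- In the quotient of a power series ring by a Weierstrass divisor, every element has a minimal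
polynomial over the coefficient ring. -/
theorem PowerSeries.exists_monic_minimal_dvd_eval₂ {A : Type*} [CommRing A] [IsDomain A]
    [IsLocalRing A] [IsAdicComplete (IsLocalRing.maximalIdeal A) A] [IsIntegrallyClosed A]
    {f : PowerSeries A} (hf : Prime f) (hmap : f.map (IsLocalRing.residue A) ≠ 0)
    (hinj : ∀ s : A, f ∣ PowerSeries.C s → s = 0) (a : PowerSeries A) :
    ∃ P : Polynomial A, P.Monic ∧ f ∣ P.eval₂ PowerSeries.C a ∧
      ∀ P' : Polynomial A, P'.degree < P.degree → f ∣ P'.eval₂ PowerSeries.C a → P' = 0 := by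
  obtain ⟨P, u, H⟩ := PowerSeries.exists_isWeierstrassFactorization hmap
  have hfin : Module.Finite A (Polynomial A ⧸ Ideal.span {P}) :=
    H.isDistinguishedAt.monic.finite_quotient
  have hfin2 : Module.Finite A (PowerSeries A ⧸ Ideal.span {f}) :=
    Module.Finite.equiv (H.algEquivQuotient).toLinearEquiv
  have hprime : (Ideal.span {f}).IsPrime := (Ideal.span_singleton_prime hf.ne_zero).2 hf
  have halg : ∀ s : A, algebraMap A (PowerSeries A ⧸ Ideal.span {f}) s =
      Ideal.Quotient.mk _ (PowerSeries.C s) := fun s => rfl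
  have htf : Module.IsTorsionFree A (PowerSeries A ⧸ Ideal.span {f}) := by
    rw [Module.isTorsionFree_iff_algebraMap_injective, injective_iff_map_eq_zero]
    intro s hs
    rw [halg, Ideal.Quotient.eq_zero_iff_mem, Ideal.mem_span_singleton] at hs
    exact hinj s hs
  have haeval : ∀ P : Polynomial A, f ∣ P.eval₂ PowerSeries.C a ↔
      Polynomial.aeval (Ideal.Quotient.mk (Ideal.span {f}) a) P = 0 := fun P => by
    rw [← Ideal.mem_span_singleton, ← Ideal.Quotient.eq_zero_iff_mem, Polynomial.hom_eval₂]
    rfl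
  have h_integral : IsIntegral A (Ideal.Quotient.mk (Ideal.span {f}) a) :=
    Algebra.IsIntegral.isIntegral _
  refine ⟨minpoly A (Ideal.Quotient.mk (Ideal.span {f}) a), minpoly.monic h_integral,
    (haeval _).2 (minpoly.aeval _ _), fun P' hdeg hP' => ?_⟩
  by_contra h0
  exact absurd hdeg (not_lt.2 (minpoly.IsIntegrallyClosed.degree_le_of_ne_zero h0
    ((haeval _).1 hP')))

namespace BiSeries

/-- If `z`-differentiation maps a nonunit `f` to a multiple of `f`, then `w` divides `f`. -/
theorem w_dvd_of_dvd_dz {f : BiSeries} (hf : ¬ IsUnit f) (h : f ∣ dz f) : w ∣ f := by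
  obtain ⟨g, hg⟩ := h
  rw [w_dvd_iff]
  intro i
  induction i using Nat.strong_induction_on with
  | _ i ih =>
    rcases i with _ | i
    · rw [isUnit_iff, not_not] at hf
      exact hf
    · have h1 := cf_dz f i 0
      rw [hg, cf_mul, Finset.sum_eq_zero] at h1
      · have h2 : (i : ℂ) + 1 ≠ 0 := by exact_mod_cast i.succ_ne_zero
        exact (mul_eq_zero.1 h1.symm).resolve_left h2
      · intro x hx
        have hx := Finset.HasAntidiagonal.mem_antidiagonal.1 hx
        rw [Finset.Nat.antidiagonal_zero, Finset.sum_singleton, ih x.1 (by omega), zero_mul]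

theorem jac_sum_left {ι : Type*} (s : Finset ι) (g : ι → BiSeries) (f : BiSeries) :
    jac (∑ n ∈ s, g n) f = ∑ n ∈ s, jac (g n) f := by
  induction s using Finset.cons_induction with
  | empty => simpa using jac_add_left 0 0 f
  | cons n s hn ih => rw [Finset.sum_cons, Finset.sum_cons, jac_add_left, ih]

/-- Differentiating a polynomial relation with coefficients in `w`. -/
theorem dvd_eval₂_derivative {f a : BiSeries} {P : Polynomial (PowerSeries ℂ)} {N : ℕ}
    (hN : P.natDegree < N) (hJ : f ∣ jac a f) (hP : f ∣ P.eval₂ PowerSeries.C a) :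
    f ∣ (∑ n ∈ Finset.range N, PowerSeries.C (PowerSeries.derivative ℂ (P.coeff n)) * a ^ n) *
      dz f := by
  have key : jac (P.eval₂ PowerSeries.C a) f =
      (∑ n ∈ Finset.range N, PowerSeries.C (P.coeff n) * (n * a ^ (n - 1))) * jac a f
      - (∑ n ∈ Finset.range N, PowerSeries.C (PowerSeries.derivative ℂ (P.coeff n)) * a ^ n) *
        dz f := by
    rw [Polynomial.eval₂_eq_sum_range' _ hN, jac_sum_left, Finset.sum_mul, Finset.sum_mul,
      ← Finset.sum_sub_distrib]
    refine Finset.sum_congr rfl fun n _ => ?_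
    rw [jac_mul_left]
    simp only [jac, dz_pow, dw_pow, dz_C, dw_C]
    ring
  obtain ⟨g, hg⟩ := hP
  have h1 : f ∣ jac (P.eval₂ PowerSeries.C a) f := by
    rw [hg, jac_mul_left, jac_self, mul_zero, add_zero]
    exact dvd_mul_right _ _
  rw [key] at h1
  exact (dvd_sub_right (hJ.mul_left _)).1 h1

/-- A series whose Jacobian with a prime `f` vanishes along `f`, and which vanishes at the origin,
vanishes along `f`. -/
theorem dvd_of_dvd_jac {f a : BiSeries} (hf : Prime f) (ha : cf a 0 0 = 0) (hJ : f ∣ jac a f) :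
    f ∣ a := by
  by_cases hw : w ∣ f
  · obtain ⟨u, rfl⟩ := hw
    have hu : IsUnit u := (hf.irreducible.isUnit_or_isUnit rfl).resolve_left prime_w.not_isUnit
    rw [hu.mul_right_dvd]
    have h1 : w ∣ dz a * u := by
      have h2 := (dvd_mul_right w u).trans hJ
      rw [jac_mul_right, dvd_add_right (dvd_mul_right _ _)] at h2
      have h3 : jac a w = dz a := by
        have : dz w = 0 := dz_C _
        rw [jac, dw_w, this, mul_one, mul_zero, sub_zero]
      rwa [h3, mul_comm] at h2
    rw [hu.dvd_mul_right, w_dvd_iff] at h1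
    rw [w_dvd_iff]
    rintro (_ | i)
    · exact ha
    · have h2 := h1 i
      rw [cf_dz] at h2
      exact (mul_eq_zero.1 h2).resolve_left (by exact_mod_cast i.succ_ne_zero)
  have hc : IsAdicComplete (IsLocalRing.maximalIdeal (PowerSeries ℂ)) (PowerSeries ℂ) := by
    rw [PowerSeries.maximalIdeal_eq_span_X]
    infer_instance
  have hmap : f.map (IsLocalRing.residue (PowerSeries ℂ)) ≠ 0 := fun h0 => by
    refine hw (w_dvd_iff.2 fun i => ?_)
    have h1 := congrArg (PowerSeries.coeff i) h0
    rw [PowerSeries.coeff_map, map_zero, IsLocalRing.residue_eq_zero_iff,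
      PowerSeries.maximalIdeal_eq_span_X, Ideal.mem_span_singleton, PowerSeries.X_dvd_iff] at h1
    simpa [cf] using h1
  have hinj : ∀ s : PowerSeries ℂ, f ∣ PowerSeries.C s → s = 0 := fun s hs => by
    by_contra h0
    obtain ⟨n, u, hu⟩ := IsDiscreteValuationRing.associated_pow_irreducible h0
      (PowerSeries.X_prime (R := ℂ)).irreducible
    have h1 : f ∣ w ^ n := by
      rw [w, ← map_pow, ← hu, map_mul]
      exact hs.mul_right _
    have h2 := hf.dvd_of_dvd_pow h1
    exact hw (((hf.irreducible.dvd_irreducible_iff_associated prime_w.irreducible).1 h2).symm.dvd)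
  obtain ⟨P, hmon, hP, hmin⟩ := PowerSeries.exists_monic_minimal_dvd_eval₂ hf hmap hinj a
  have hfz : ¬ f ∣ dz f := fun h => hw (w_dvd_of_dvd_dz hf.not_isUnit h)
  have h1 := (hf.dvd_or_dvd (dvd_eval₂_derivative (Nat.lt_succ_self _) hJ hP)).resolve_right hfz
  rw [Finset.sum_range_succ, hmon.coeff_natDegree] at h1
  simp only [Derivation.map_one_eq_zero, map_zero, zero_mul, add_zero] at h1
  have h2 : ∑ n ∈ Finset.range P.natDegree,
      Polynomial.monomial n (PowerSeries.derivative ℂ (P.coeff n)) = 0 := by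
    refine hmin _ ?_ ?_
    · rw [Polynomial.degree_eq_natDegree hmon.ne_zero]
      refine (Polynomial.degree_sum_le _ _).trans_lt
        ((Finset.sup_lt_iff (WithBot.bot_lt_coe _)).2 fun n hn => ?_)
      exact (Polynomial.degree_monomial_le _ _).trans_lt
        (by exact_mod_cast Finset.mem_range.1 hn)
    · rw [Polynomial.eval₂_finsetSum]
      simpa only [Polynomial.eval₂_monomial] using h1
  have h3 : ∀ n, PowerSeries.derivative ℂ (P.coeff n) = 0 := fun n => by
    rcases lt_trichotomy n P.natDegree with hn | rfl | hn
    · have h4 := congrArg (fun p => Polynomial.coeff p n) h2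
      simpa [Polynomial.finsetSum_coeff, Polynomial.coeff_monomial, hn] using h4
    · rw [hmon.coeff_natDegree, Derivation.map_one_eq_zero]
    · rw [Polynomial.coeff_eq_zero_of_natDegree_lt hn, map_zero]
  have h4 : P ∈ Polynomial.lifts (PowerSeries.C (R := ℂ)) := by
    rw [Polynomial.lifts_iff_coeff_lifts]
    intro n
    refine ⟨PowerSeries.constantCoeff (P.coeff n), PowerSeries.derivative.ext ?_ ?_⟩
    · rw [h3, PowerSeries.derivative_C]
    · simp
  obtain ⟨P₀, rfl, -, hmon₀⟩ := Polynomial.lifts_and_natDegree_eq_and_monic h4 hmon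
  rw [Polynomial.eval₂_map, (IsAlgClosed.splits P₀).eq_prod_roots_of_monic hmon₀,
    Polynomial.eval₂_multiset_prod, Multiset.map_map] at hP
  obtain ⟨α, -, hα⟩ := hf.exists_mem_multiset_map_dvd hP
  have h5 : f ∣ a - const α := by simpa [const] using hα
  have h6 : α = 0 := by
    obtain ⟨g, hg⟩ := h5
    have h7 := congrArg (fun b => cf b 0 0) hg
    have h8 : cf f 0 0 = 0 := by
      by_contra h
      exact hf.not_isUnit (isUnit_iff.2 h)
    simpa [cf_zero_mul, h8, ha, cf_const] using h7
  rwa [h6, map_zero, sub_zero] at h5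

end BiSeries

namespace BiSeries

variable {A Q B : BiSeries}

theorem prime_dvd_of_jac_eq_zero (hA0 : cf A 0 0 = 0) (hB : B ≠ 0) (hJ : jac A B = 0)
    {f : BiSeries} (hf : Prime f) (hfB : f ∣ B) : f ∣ A := by
  obtain ⟨c, hc, hfc⟩ : ∃ c, B = f ^ (multiplicity f B) * c ∧ ¬ f ∣ c :=
    (FiniteMultiplicity.of_prime_left hf hB).exists_eq_pow_mul_and_not_dvd
  set n := multiplicity f B
  have hn : n ≠ 0 := fun h0 => hfc (by rw [h0, pow_zero, one_mul] at hc; rwa [← hc])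
  refine dvd_of_dvd_jac hf hA0 ?_
  rw [hc, jac_mul_right, jac_pow_right] at hJ
  obtain ⟨m, hm⟩ := Nat.exists_eq_succ_of_ne_zero hn
  rw [hm, Nat.succ_sub_one, pow_succ] at hJ
  have h1 : f ^ m * (f * jac A c + c * ((m + 1 : ℕ) * jac A f)) = 0 := by
    rw [← hJ]; push_cast; ring
  have h2 := (mul_eq_zero.1 h1).resolve_left (pow_ne_zero _ hf.ne_zero)
  have h3 : f ∣ c * ((m + 1 : ℕ) * jac A f) :=
    (dvd_add_right (dvd_mul_right f (jac A c))).1 (by rw [h2]; exact dvd_zero f)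
  exact const_natCast_dvd m.succ_ne_zero ((hf.dvd_or_dvd h3).resolve_left hfc)

theorem pow_dvd_of_dw_eq_dz (hQA : dw Q = dz A) {f : BiSeries} (hf : Prime f) (hw : ¬ w ∣ f)
    (h1 : f ∣ Q → f ∣ A) (n : ℕ) (hn : f ^ n ∣ Q) : f ^ n ∣ A := by
  induction n with
  | zero => simp
  | succ n ih =>
    obtain ⟨h, hh⟩ := ih ((pow_dvd_pow f n.le_succ).trans hn)
    rcases n with _ | n
    · rw [zero_add, pow_one] at hn ⊢
      exact h1 hn
    obtain ⟨g, hg⟩ := hn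
    have h2 : f ^ n * (f * ((n + 1 + 1 : ℕ) * dw f * g + f * dw g - dz h)) =
        f ^ n * ((n + 1 : ℕ) * (dz f * h)) := by
      have h3 := hQA
      rw [hg, hh, dw_mul, dz_mul, dw_pow, dz_pow, Nat.add_sub_cancel, Nat.add_sub_cancel] at h3
      linear_combination h3
    have h3 := mul_left_cancel₀ (pow_ne_zero n hf.ne_zero) h2
    have h4 : f ∣ dz f * h := const_natCast_dvd n.succ_ne_zero ⟨_, h3.symm⟩
    have h5 := (hf.dvd_or_dvd h4).resolve_left fun h => hw (w_dvd_of_dvd_dz hf.not_isUnit h)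
    rw [hh, pow_succ _ (n + 1)]
    exact mul_dvd_mul_left _ h5

/-- The part of `Q` prime to `w` divides `A`. -/
theorem dvd_of_jac_eq_zero {Q' : BiSeries} (hA0 : cf A 0 0 = 0) (hQA : dw Q = dz A) (hQ : Q ≠ 0)
    (hQ' : Q' ≠ 0) (hJ : jac A (Q * Q') = 0) {x : BiSeries} (hx : x ∣ Q) (hw : ¬ w ∣ x) :
    x ∣ A := by
  revert hx hw
  refine UniqueFactorizationMonoid.induction_on_coprime x ?_ ?_ ?_ ?_
  · intro h
    exact absurd (zero_dvd_iff.1 h) hQ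
  · intro x hx _ _
    exact hx.dvd
  · intro p i hp hpi hw
    rcases i with _ | i
    · simp
    refine pow_dvd_of_dw_eq_dz hQA hp (fun h => hw (dvd_pow h i.succ_ne_zero)) (fun h => ?_) _ hpi
    exact prime_dvd_of_jac_eq_zero hA0 (mul_ne_zero hQ hQ') hJ hp (h.mul_right _)
  · intro x y hxy hx hy hd hw
    exact hxy.mul_dvd (hx ((dvd_mul_right _ _).trans hd) fun h => hw (h.mul_right _))
      (hy ((dvd_mul_left _ _).trans hd) fun h => hw (h.mul_left _))

end BiSeries

namespace BiSeries

theorem OrdGE.sub {n : ℕ} {a b : BiSeries} (ha : OrdGE n a) (hb : OrdGE n b) : OrdGE n (a - b) :=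
  fun i j h => by simp [ha i j h, hb i j h]

theorem cf_mul_eq_cf_mul_const {k : ℕ} {a : BiSeries} (ha : OrdGE k a) (b : BiSeries) {i j : ℕ}
    (hij : i + j = k) : cf (a * b) i j = cf b 0 0 * cf a i j := by
  have hb : OrdGE 1 (b - const (cf b 0 0)) := by
    intro i j h
    obtain ⟨rfl, rfl⟩ : i = 0 ∧ j = 0 := by omega
    simp [cf_const]
  have h := ha.mul hb i j (by omega)
  rw [mul_sub, cf_sub, mul_comm a (const _), cf_const_mul, sub_eq_zero] at h
  exact h

theorem cf_leading_of_dvd {k : ℕ} {Q A E : BiSeries} (hk : OrdGE k Q)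
    (hQA : dw Q = dz A) (hA : A = Q * E) (j i : ℕ) (hij : i + j = k) :
    cf Q i j = cf Q k 0 * k.choose j * cf E 0 0 ^ j := by
  induction j generalizing i with
  | zero => obtain rfl : i = k := by omega
            simp
  | succ j ih =>
    have h : cf (dw Q) i j = cf (dz A) i j := by rw [hQA]
    rw [cf_dw, cf_dz, hA, cf_mul_eq_cf_mul_const hk E (by omega), ih (i + 1) (by omega)] at h
    have hc : (k.choose (j + 1) : ℂ) * (j + 1) = k.choose j * (i + 1) := by
      have := Nat.choose_succ_right_eq k j
      rw [show k - j = i + 1 by omega] at this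
      exact_mod_cast this
    have hj : (j + 1 : ℂ) ≠ 0 := by exact_mod_cast Nat.succ_ne_zero j
    apply mul_left_cancel₀ hj
    rw [h, pow_succ]
    linear_combination (-cf Q k 0 * cf E 0 0 ^ j * cf E 0 0) * hc

theorem cf_leading_ne_zero_of_dvd {k : ℕ} {Q A E : BiSeries} (hk : OrdGE k Q)
    (hne : ∃ i j, i + j = k ∧ cf Q i j ≠ 0)
    (hQA : dw Q = dz A) (hA : A = Q * E) : cf Q k 0 ≠ 0 := by
  intro h0
  obtain ⟨i, j, hij, h⟩ := hne
  exact h (by rw [cf_leading_of_dvd hk hQA hA j i hij, h0]; ring)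

theorem exists_eq_w_pow_mul {a : BiSeries} (ha : a ≠ 0) :
    ∃ n b, a = w ^ n * b ∧ ¬ w ∣ b := by
  obtain ⟨b, hb, h⟩ := (FiniteMultiplicity.of_prime_left prime_w ha).exists_eq_pow_mul_and_not_dvd
  exact ⟨_, b, hb, h⟩

theorem cf_monomial (a b i j : ℕ) :
    cf (z ^ a * w ^ b) i j = if i = a ∧ j = b then 1 else 0 := by
  rw [cf, z, w, ← map_pow, mul_comm, PowerSeries.coeff_C_mul, PowerSeries.coeff_X_pow]
  by_cases h : i = a <;> simp [h, PowerSeries.coeff_X_pow]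

theorem cf_z (i j : ℕ) : cf z i j = if i = 1 ∧ j = 0 then 1 else 0 := by
  simpa using cf_monomial 1 0 i j

theorem cf_w (i j : ℕ) : cf w i j = if i = 0 ∧ j = 1 then 1 else 0 := by
  simpa using cf_monomial 0 1 i j

theorem cf_mul_linear {d : ℕ} {a b : BiSeries} (ha : OrdGE d a) (hb : cf b 0 0 = 0) {i j : ℕ}
    (hij : i + j = d + 1) :
    cf (a * b) i j = cf b 1 0 * cf (z * a) i j + cf b 0 1 * cf (w * a) i j := by
  have hb2 : OrdGE 2 (b - (const (cf b 1 0) * z + const (cf b 0 1) * w)) := by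
    intro i j h
    rcases i with _ | _ | i <;> rcases j with _ | _ | j <;> try omega
    all_goals simp [hb, cf_z, cf_w]
  have h := ha.mul hb2 i j (by omega)
  rw [show a * (b - (const (cf b 1 0) * z + const (cf b 0 1) * w)) =
    a * b - (const (cf b 1 0) * (z * a) + const (cf b 0 1) * (w * a)) by ring] at h
  simp only [cf_sub, cf_add, cf_const_mul, sub_eq_zero] at h
  exact h

/-- The two series `A`, `Q` have leading parts proportional to `(z w) ^ (n + 1)` and
`z ^ n w ^ (n + 2)`. -/
def IsRadialType (Q A : BiSeries) (n : ℕ) (p : ℂ) : Prop :=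
  p ≠ 0 ∧ conj p = p ∧ OrdGE (2 * n + 2) Q ∧ OrdGE (2 * n + 2) A ∧
    OrdGE (2 * n + 3) (Q - const p * (z ^ n * w ^ (n + 2))) ∧
    OrdGE (2 * n + 3) (A - const ((n + 2) / (n + 1) * p) * (z ^ (n + 1) * w ^ (n + 1)))

theorem exists_isRadialType {Q Q' A : BiSeries} (hw : w ∣ Q) (hQ : Q ≠ 0) (hQ' : Q' ≠ 0)
    (hA0 : cf A 0 0 = 0) (hQA : dw Q = dz A) (hJ : jac A (Q * Q') = 0)
    (hreal : ∀ i j, cf A j i = conj (cf A i j)) : ∃ n p, IsRadialType Q A n p := by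
  have hwA : w ∣ A := prime_dvd_of_jac_eq_zero hA0 (mul_ne_zero hQ hQ') hJ prime_w (hw.mul_right _)
  have hcoef (i j : ℕ) : (j + 1) * cf Q i (j + 1) = (i + 1) * cf A (i + 1) j := by
    rw [← cf_dw, ← cf_dz, hQA]
  have hA : A ≠ 0 := by
    rintro rfl
    refine hQ (ext_cf fun i j => ?_)
    rcases j with _ | j
    · simpa using w_dvd_iff.1 hw i
    · have h := hcoef i j
      rw [cf_zero, mul_zero] at h
      simpa using (mul_eq_zero.1 h).resolve_left (by exact_mod_cast j.succ_ne_zero)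
  have hA0' (j : ℕ) : cf A 0 j = 0 := by
    rw [hreal j 0, w_dvd_iff.1 hwA j, map_zero]
  obtain ⟨m, Q₁, hQ₁, hwQ₁⟩ := exists_eq_w_pow_mul hQ
  obtain ⟨l, A₁, hA₁, hwA₁⟩ := exists_eq_w_pow_mul hA
  obtain ⟨E, hE⟩ : Q₁ ∣ A₁ := by
    obtain ⟨t, ht⟩ : Q₁ ∣ A := dvd_of_jac_eq_zero hA0 hQA hQ hQ' hJ ⟨_, by rw [hQ₁, mul_comm]⟩ hwQ₁
    obtain ⟨s, rfl⟩ : w ^ l ∣ t := prime_w.pow_dvd_of_dvd_mul_left l hwQ₁ ⟨A₁, by rw [← ht, hA₁]⟩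
    refine ⟨s, mul_left_cancel₀ (pow_ne_zero l prime_w.ne_zero) ?_⟩
    rw [← hA₁, ht]; ring
  have hm1 : m ≠ 0 := by
    rintro rfl
    exact hwQ₁ (by simpa [hQ₁] using hw)
  have cQ (i b : ℕ) : cf Q i (m + b) = cf Q₁ i b := by rw [hQ₁, cf_w_pow_mul]
  have cA (i b : ℕ) : cf A i (l + b) = cf A₁ i b := by rw [hA₁, cf_w_pow_mul]
  have hml : m = l + 1 := by
    rcases lt_trichotomy m (l + 1) with h | h | h
    · exfalso
      refine hwQ₁ (w_dvd_iff.2 fun i => ?_)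
      have h1 := hcoef i (m - 1)
      rw [hA₁, cf_w_pow_mul_of_lt (by omega), mul_zero, Nat.sub_add_cancel (by omega)] at h1
      have h2 := (mul_eq_zero.1 h1).resolve_left (by exact_mod_cast (m - 1).succ_ne_zero)
      rw [← cQ]; exact h2
    · exact h
    · exfalso
      refine hwA₁ (w_dvd_iff.2 fun i => ?_)
      rw [← cA]
      rcases i with _ | i
      · exact hA0' _
      have h1 := hcoef i l
      rw [hQ₁, cf_w_pow_mul_of_lt h, mul_zero] at h1
      exact (mul_eq_zero.1 h1.symm).resolve_left (by exact_mod_cast i.succ_ne_zero)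
  subst hml
  have hc (i b : ℕ) : (l + 1 + b : ℂ) * cf Q₁ i b = (i + 1) * cf A₁ (i + 1) b := by
    have h := hcoef i (l + b)
    rw [cA, show l + b + 1 = l + 1 + b by ring, cQ] at h
    rw [← h]; push_cast; ring
  have hl : 1 ≤ l := by
    by_contra h
    obtain rfl : l = 0 := by omega
    exact hwA₁ (by simpa [hA₁] using hwA)
  obtain ⟨d, hd, hne⟩ := exists_ordGE (a := Q₁) (by rintro rfl; simp at hwQ₁)
  have hA₁0 (b : ℕ) : cf A₁ 0 b = 0 := by rw [← cA]; exact hA0' _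
  have hE0 : cf E 0 0 = 0 := by
    by_contra hE0
    obtain ⟨a, b, hab, h⟩ := hne
    have h1 : cf A₁ a b = cf E 0 0 * cf Q₁ a b := by rw [hE, cf_mul_eq_cf_mul_const hd E hab]
    refine mul_ne_zero hE0 h ?_
    rw [← h1]
    rcases a with _ | a
    · exact hA₁0 b
    have h2 := hc a b
    rw [hd a b (by omega), mul_zero] at h2
    exact (mul_eq_zero.1 h2.symm).resolve_left (by exact_mod_cast a.succ_ne_zero)
  have hlin {i b : ℕ} (h : i + b = d + 1) :
      cf A₁ i b = cf E 1 0 * cf (z * Q₁) i b + cf E 0 1 * cf (w * Q₁) i b := by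
    rw [hE, cf_mul_linear hd hE0 h]
  have hβ : cf E 0 1 = 0 := by
    by_contra hβ
    have hall (i : ℕ) : ∀ b, i + b = d → cf Q₁ i b = 0 := by
      induction i with
      | zero =>
        intro b hb
        have h := hlin (i := 0) (b := b + 1) (by omega)
        rw [hA₁0, cf_z_mul_zero, cf_w_mul_succ, mul_zero, zero_add] at h
        exact (mul_eq_zero.1 h.symm).resolve_left hβ
      | succ i ih =>
        intro b hb
        have h := hc i (b + 1)
        rw [hlin (by omega), cf_z_mul_succ, cf_w_mul_succ, ih (b + 1) (by omega), mul_zero,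
          mul_zero, zero_add] at h
        have h2 := (mul_eq_zero.1 h.symm).resolve_left (by exact_mod_cast i.succ_ne_zero)
        exact (mul_eq_zero.1 h2).resolve_left hβ
    obtain ⟨a, b, hab, h⟩ := hne
    exact h (hall a b hab)
  have hlin' {i b : ℕ} (h : i + b = d) : cf A₁ (i + 1) b = cf E 1 0 * cf Q₁ i b := by
    rw [hlin (by omega), hβ, zero_mul, add_zero, cf_z_mul_succ]
  obtain ⟨a, b, hab, hp⟩ := hne
  have hα {i j : ℕ} (hij : i + j = d) (h : cf Q₁ i j ≠ 0) : (l + 1 + j : ℂ) = (i + 1) * cf E 1 0 := by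
    have h1 := hc i j
    rw [hlin' hij, ← mul_assoc] at h1
    exact mul_right_cancel₀ h h1
  have hα0 : cf E 1 0 ≠ 0 := by
    intro h0
    have h1 := hα hab hp
    rw [h0, mul_zero] at h1
    exact absurd h1 (by exact_mod_cast (by omega : l + 1 + b ≠ 0))
  have huniq {i j : ℕ} (hij : i + j = d) (h : cf Q₁ i j ≠ 0) : i = a := by
    have h1 := hα hij h
    have h2 := hα hab hp
    have h3 : ((l + 1 + j : ℕ) : ℂ) * (a + 1 : ℕ) = ((l + 1 + b : ℕ) : ℂ) * (i + 1 : ℕ) := by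
      push_cast
      rw [h1, h2]; ring
    have h4 : (l + 1 + j) * (a + 1) = (l + 1 + b) * (i + 1) := by exact_mod_cast h3
    rcases lt_trichotomy i a with h | h | h
    · nlinarith
    · exact h
    · nlinarith
  have hOA : OrdGE (d + l + 1) A := by
    intro i j hij
    rcases i with _ | i
    · exact hA0' j
    rcases lt_or_ge j l with hj | hj
    · rw [hA₁, cf_w_pow_mul_of_lt hj]
    obtain ⟨b', rfl⟩ := Nat.exists_eq_add_of_le hj
    have h := hc i b'
    rw [hd i b' (by omega), mul_zero] at h
    rw [cA]
    exact (mul_eq_zero.1 h.symm).resolve_left (by exact_mod_cast i.succ_ne_zero)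
  have hLA {i j : ℕ} (hij : i + j = d + l + 1) (hi : i ≠ a + 1) : cf A i j = 0 := by
    rcases i with _ | i
    · exact hA0' j
    rcases lt_or_ge j l with hj | hj
    · rw [hA₁, cf_w_pow_mul_of_lt hj]
    obtain ⟨b', rfl⟩ := Nat.exists_eq_add_of_le hj
    rw [cA, hlin' (by omega)]
    by_contra h
    exact hi (by rw [huniq (by omega) (right_ne_zero_of_mul h)])
  have hLA' : cf A (a + 1) (l + b) = cf E 1 0 * cf Q₁ a b := by rw [cA, hlin' hab]
  have hal : l + b = a + 1 := by
    by_contra h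
    have h1 := hreal (a + 1) (l + b)
    rw [hLA (by omega) h, hLA', eq_comm, map_eq_zero] at h1
    exact mul_ne_zero hα0 hp h1
  have hval : cf E 1 0 = (a + 2) / (a + 1) := by
    have h1 := hα hab hp
    rw [show (l + 1 + b : ℂ) = a + 2 by
      have : ((l + b : ℕ) : ℂ) = (a + 1 : ℕ) := by rw [hal]
      push_cast at this
      linear_combination this] at h1
    rw [eq_div_iff (by exact_mod_cast a.succ_ne_zero), h1, mul_comm]
  refine ⟨a, cf Q₁ a b, hp, ?_, ?_, ?_, ?_, ?_⟩
  · have h1 := hreal (a + 1) (l + b)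
    have h2 := hLA'
    rw [hal] at h1 h2
    rw [h2, map_mul, hval, map_div₀] at h1
    simp only [map_add, map_one, Complex.conj_natCast, Complex.conj_ofNat] at h1
    rw [← hval] at h1
    exact (mul_left_cancel₀ hα0 h1).symm
  · intro i j hij
    rcases lt_or_ge j (l + 1) with hj | hj
    · rw [hQ₁, cf_w_pow_mul_of_lt hj]
    obtain ⟨b', rfl⟩ := Nat.exists_eq_add_of_le hj
    rw [cQ, hd i b' (by omega)]
  · exact hOA.mono (by omega)
  · intro i j hij
    rw [cf_sub, cf_const_mul, cf_monomial]
    have h0 : ¬ (i = a ∧ j = a + 2) → cf Q i j = 0 := by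
      intro hn
      rcases lt_or_ge j (l + 1) with hj | hj
      · rw [hQ₁, cf_w_pow_mul_of_lt hj]
      obtain ⟨b', rfl⟩ := Nat.exists_eq_add_of_le hj
      rw [cQ]
      rcases lt_or_ge (i + b') d with h | h
      · exact hd i b' h
      · by_contra h2
        have := huniq (by omega) h2
        omega
    split_ifs with h
    · obtain ⟨rfl, rfl⟩ := h
      rw [show i + 2 = l + 1 + b by omega, cQ, mul_one, sub_self]
    · rw [h0 h, mul_zero, sub_zero]
  · intro i j hij
    rw [cf_sub, cf_const_mul, cf_monomial, ← hval]
    split_ifs with h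
    · obtain ⟨rfl, rfl⟩ := h
      nth_rewrite 2 [← hal]
      rw [hLA', mul_one, sub_self]
    · rw [mul_zero, sub_zero]
      rcases lt_or_ge (i + j) (d + l + 1) with h2 | h2
      · exact hOA i j h2
      · exact hLA (by omega) (by omega)

theorem cf_z_sq_dz_dz (a : BiSeries) (i j : ℕ) :
    cf (z ^ 2 * dz (dz a)) i j = i * (i - 1) * cf a i j := by
  rw [pow_two, mul_assoc]
  rcases i with _ | _ | i <;> simp
  ring

theorem cf_w_sq_dw_dw (a : BiSeries) (i j : ℕ) :
    cf (w ^ 2 * dw (dw a)) i j = j * (j - 1) * cf a i j := by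
  rw [pow_two, mul_assoc]
  rcases j with _ | _ | j <;> simp
  ring

theorem cf_z_w_dz_dw (a : BiSeries) (i j : ℕ) :
    cf (z * (w * dz (dw a))) i j = i * j * cf a i j := by
  rcases i with _ | i <;> rcases j with _ | j <;> simp
  ring

/-- Angular derivative. -/
noncomputable def rot (a : BiSeries) : BiSeries := z * dz a - w * dw a

theorem cf_rot (a : BiSeries) (i j : ℕ) : cf (rot a) i j = (i - j) * cf a i j := by
  rw [rot, cf_sub]
  rcases i with _ | i <;> rcases j with _ | j <;> simp <;> ring

theorem rot_mul (a b : BiSeries) : rot (a * b) = a * rot b + b * rot a := by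
  simp only [rot, dz_mul, dw_mul]; ring

theorem rot_dz_dz (a : BiSeries) : rot (dz (dz a)) = dz (dz (rot a)) - 2 * dz (dz a) := by
  refine ext_cf fun i j => ?_
  rw [show (2 : BiSeries) = const 2 from (map_ofNat const 2).symm]
  simp [cf_rot]; ring

theorem rot_dw_dw (a : BiSeries) : rot (dw (dw a)) = dw (dw (rot a)) + 2 * dw (dw a) := by
  refine ext_cf fun i j => ?_
  rw [show (2 : BiSeries) = const 2 from (map_ofNat const 2).symm]
  simp [cf_rot]; ring

theorem rot_dz_dw (a : BiSeries) : rot (dz (dw a)) = dz (dw (rot a)) := by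
  refine ext_cf fun i j => ?_
  simp [cf_rot]; ring

theorem dz_mul_rot_of_jac_eq_zero {a b : BiSeries} (h : jac a b = 0) :
    dz a * rot b = dz b * rot a := by
  rw [jac] at h
  simp only [rot]
  linear_combination -w * h

theorem OrdGE.mul_sub_mul {m n : ℕ} {a a' b b' : BiSeries} (ha : OrdGE (m + 1) (a - a'))
    (hb : OrdGE (n + 1) (b - b')) (ha' : OrdGE m a) (hb' : OrdGE n b') :
    OrdGE (m + n + 1) (a * b - a' * b') := by
  rw [show a * b - a' * b' = a * (b - b') + (a - a') * b' by ring]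
  exact ((ha'.mul hb).mono (by omega)).add ((ha.mul hb').mono (by omega))

theorem dz_monomial (a : ℂ) (s t : ℕ) :
    dz (const a * (z ^ (s + 1) * w ^ t)) = const (a * (s + 1)) * (z ^ s * w ^ t) := by
  refine ext_cf fun i j => ?_
  simp only [cf_dz, cf_const_mul, cf_monomial, Nat.add_right_cancel_iff]
  split_ifs with h
  · rw [h.1]; ring
  · ring

theorem cf_eq_zero_of_isRadialType {c : BiSeries} {k p : ℂ} {n : ℕ}
    (hreal : ∀ i j, cf c j i = conj (cf c i j))
    (hJ : jac (dz (dw c) - const k) (dz (dz c) * dw (dw c)) = 0)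
    (h : IsRadialType (dz (dz c)) (dz (dw c) - const k) n p) (i j : ℕ) (hij : 2 ≤ i + j)
    (hne : i ≠ j) : cf c i j = 0 := by
  obtain ⟨hp, hpr, hQ, hA, hQl, hAl⟩ := h
  have hconj (i j : ℕ) : cf (dw (dw c)) i j = conj (cf (dz (dz c)) j i) := by
    simp only [cf_dw, cf_dz, map_mul, map_add, map_one, Complex.conj_natCast, ← hreal]
  have hQ' : OrdGE (2 * n + 2) (dw (dw c)) := fun i j hij => by
    rw [hconj, hQ j i (by omega), map_zero]
  have hQl' : OrdGE (2 * n + 3) (dw (dw c) - const p * (z ^ (n + 2) * w ^ n)) := fun i j hij => by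
    have h1 := hQl j i (by omega)
    rw [cf_sub, cf_const_mul, cf_monomial, sub_eq_zero] at h1
    rw [cf_sub, cf_const_mul, cf_monomial, hconj, h1, map_mul, hpr]
    by_cases h : i = n + 2 ∧ j = n
    · rw [if_pos h, if_pos h.symm, map_one, sub_self]
    · rw [if_neg h, if_neg fun h2 => h h2.symm, map_zero, sub_self]
  obtain ⟨v, hv⟩ : ∃ v, v = rot c := ⟨_, rfl⟩
  have hid : dz (dz (dw c) - const k) * (dz (dz c) * dw (dw v) + dw (dw c) * dz (dz v)) =
      dz (dz (dz c) * dw (dw c)) * dz (dw v) := by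
    have h1 := dz_mul_rot_of_jac_eq_zero hJ
    rw [rot_mul, rot_dz_dz, rot_dw_dw, ← hv] at h1
    rw [show rot (dz (dw c) - const k) = dz (dw v) by
      rw [hv, ← rot_dz_dw]
      refine ext_cf fun i j => ?_
      simp only [cf_rot, cf_sub, cf_const]
      split_ifs with h
      · simp [h.1, h.2]
      · ring] at h1
    rw [← h1]; ring
  by_contra hc
  have hex : ∃ d, ∃ i j, i + j = d ∧ 2 ≤ d ∧ cf v i j ≠ 0 := by
    refine ⟨_, i, j, rfl, hij, ?_⟩
    rw [hv, cf_rot]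
    exact mul_ne_zero (sub_ne_zero.2 (by exact_mod_cast hne)) hc
  clear! i j
  classical
  obtain ⟨i, j, hd, hd2, hvij⟩ := Nat.find_spec hex
  have hmin {i' j' : ℕ} (h2 : 2 ≤ i' + j') (hlt : i' + j' < i + j) : cf v i' j' = 0 := by
    by_contra hc
    exact Nat.find_min hex (hlt.trans_eq hd) ⟨i', j', rfl, h2, hc⟩
  rw [← hd] at hd2
  clear hd
  obtain ⟨e, he⟩ := Nat.exists_eq_add_of_le' hd2
  have hvzz : OrdGE e (dz (dz v)) := fun i' j' h => by
    rw [cf_dz, cf_dz, hmin (by omega) (by omega)]; ring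
  have hvzw : OrdGE e (dz (dw v)) := fun i' j' h => by
    rw [cf_dz, cf_dw, hmin (by omega) (by omega)]; ring
  have hvww : OrdGE e (dw (dw v)) := fun i' j' h => by
    rw [cf_dw, cf_dw, hmin (by omega) (by omega)]; ring
  have hvne := hvij
  rw [hv, cf_rot] at hvne
  have hijne : i ≠ j := fun h => left_ne_zero_of_mul hvne (by rw [h, sub_self])
  have hcne := right_ne_zero_of_mul hvne
  have hlarge : 2 * n + 2 ≤ e := by
    by_contra hlt
    rcases Nat.lt_or_ge i 2 with hi | hi
    · rcases Nat.lt_or_ge j 2 with hj | hj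
      · omega
      obtain ⟨j', rfl⟩ := Nat.exists_eq_add_of_le' hj
      have h1 := hQ' i j' (by omega)
      rw [cf_dw, cf_dw] at h1
      have h2 : (j' + 1 : ℂ) ≠ 0 := by exact_mod_cast j'.succ_ne_zero
      have h3 : ((j' + 1 : ℕ) + 1 : ℂ) ≠ 0 := by exact_mod_cast (j' + 1).succ_ne_zero
      exact mul_ne_zero h2 (mul_ne_zero h3 hcne) h1
    · obtain ⟨i', rfl⟩ := Nat.exists_eq_add_of_le' hi
      have h1 := hQ i' j (by omega)
      rw [cf_dz, cf_dz] at h1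
      have h2 : (i' + 1 : ℂ) ≠ 0 := by exact_mod_cast i'.succ_ne_zero
      have h3 : ((i' + 1 : ℕ) + 1 : ℂ) ≠ 0 := by exact_mod_cast (i' + 1).succ_ne_zero
      exact mul_ne_zero h2 (mul_ne_zero h3 hcne) h1
  have hmon (s t : ℕ) (a : ℂ) : OrdGE (s + t) (const a * (z ^ s * w ^ t)) := fun i j h => by
    rw [cf_const_mul, cf_monomial, if_neg (by omega), mul_zero]
  have hBl := (hQl.mul_sub_mul hQl' hQ ((hmon (n + 2) n p).mono (by omega))).dz
  have hl := hBl.mul hvzw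
  have dz_sub (a b : BiSeries) : dz (a - b) = dz a - dz b := ext_cf fun i j => by simp; ring
  have hAl' := hAl.dz
  rw [dz_sub] at hAl'
  have hY : OrdGE (2 * n + 3 + e) ((dz (dz c) * dw (dw v) + dw (dw c) * dz (dz v)) -
      (const p * (z ^ n * w ^ (n + 2)) * dw (dw v) + const p * (z ^ (n + 2) * w ^ n) * dz (dz v))) := by
    have := (hQl.mul hvww).add (hQl'.mul hvzz)
    convert this using 1
    ring
  have hr := hAl'.mul_sub_mul (m := 2 * n + 1) (n := 2 * n + 2 + e) (hY.mono (by omega)) hA.dz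
    (((((hmon n (n + 2) p).mono (by omega)).mul hvww).add
      (((hmon (n + 2) n p).mono (by omega)).mul hvzz)))
  have hd1 : dz (a := const p * (z ^ n * w ^ (n + 2)) * (const p * (z ^ (n + 2) * w ^ n))) =
      const (p ^ 2 * (2 * n + 2)) * (z ^ (2 * n + 1) * w ^ (2 * n + 2)) := by
    rw [show const p * (z ^ n * w ^ (n + 2)) * (const p * (z ^ (n + 2) * w ^ n)) =
      const (p ^ 2) * (z ^ (2 * n + 1 + 1) * w ^ (2 * n + 2)) by rw [map_pow]; ring, dz_monomial]
    push_cast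
    ring_nf
  have hn1 : (n + 1 : ℂ) ≠ 0 := by exact_mod_cast n.succ_ne_zero
  have hd2' : dz (const ((n + 2) / (n + 1) * p) * (z ^ (n + 1) * w ^ (n + 1))) =
      const ((n + 2) * p) * (z ^ n * w ^ (n + 1)) := by
    rw [dz_monomial]
    congr 2
    field_simp
  rw [dz_sub, hd1] at hl
  rw [hd2'] at hr
  have hfin := (hr.mono (m := 4 * n + 4 + e) (by omega)).sub (hl.mono (m := 4 * n + 4 + e) (by omega))
  rw [hid] at hfin
  have h0 := hfin (2 * n + i) (2 * n + 1 + j) (by omega)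
  rw [show dz (dz (dz c) * dw (dw c)) * dz (dw v) -
      const ((n + 2) * p) * (z ^ n * w ^ (n + 1)) * (const p * (z ^ n * w ^ (n + 2)) * dw (dw v) +
        const p * (z ^ (n + 2) * w ^ n) * dz (dz v)) -
      (dz (dz (dz c) * dw (dw c)) -
        const (p ^ 2 * (2 * n + 2)) * (z ^ (2 * n + 1) * w ^ (2 * n + 2))) * dz (dw v) =
      z ^ (2 * n) * (w ^ (2 * n + 1) * (const (p ^ 2 * (2 * n + 2)) * (z * (w * dz (dw v))) -
        const ((n + 2) * p ^ 2) * (z ^ 2 * dz (dz v) + w ^ 2 * dw (dw v)))) by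
      rw [map_mul const (p ^ 2), map_mul const (_ + _) p, map_mul const (_ + _) (p ^ 2), map_pow]
      ring, cf_z_pow_mul, cf_w_pow_mul] at h0
  simp only [cf_sub, cf_const_mul, cf_add, cf_z_w_dz_dw, cf_z_sq_dz_dz, cf_w_sq_dw_dw] at h0
  have h1 : (p ^ 2 * cf v i j) * ((2 * n + 2) * (i * j) - (n + 2) * (i * (i - 1) + j * (j - 1))) = 0 := by
    linear_combination h0
  have h2 := (mul_eq_zero.1 h1).resolve_left (mul_ne_zero (pow_ne_zero 2 hp) hvij)
  have h3 : ((2 * n + 2) * (i * j) - (n + 2) * (i * (i - 1) + j * (j - 1)) : ℤ) = 0 := by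
    exact_mod_cast h2
  have h4 : (i : ℤ) + j = e + 2 := by exact_mod_cast he
  have h5 : (2 * n + 2 : ℤ) ≤ e := by exact_mod_cast hlarge
  have h6 : ((i : ℤ) - j) ^ 2 ≥ 1 := by
    have : (i : ℤ) - j ≠ 0 := sub_ne_zero.2 (by exact_mod_cast hijne)
    exact (one_le_sq_iff_one_le_abs _).2 (Int.one_le_abs this)
  have h7 : ((i : ℤ) + j) * (i + j - (2 * n + 4)) + (2 * n + 3) * ((i : ℤ) - j) ^ 2 = 0 := by
    linear_combination -2 * h3
  have h8 : ((i : ℤ) + j) * (i + j - (2 * n + 4)) ≥ 0 := by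
    rw [h4]; exact mul_nonneg (by omega) (by omega)
  nlinarith

end BiSeries

namespace BiSeries

/-- The coefficients grow at most geometrically. -/
def Geom (a : BiSeries) : Prop := ∃ K : ℝ, 1 ≤ K ∧ ∀ i j, ‖cf a i j‖ ≤ K ^ (i + j + 1)

theorem Geom.of_le {a : BiSeries} {C R : ℝ} (h : ∀ i j, ‖cf a i j‖ ≤ C * R ^ (i + j)) :
    Geom a := by
  refine ⟨max 1 (max |C| |R|), le_max_left _ _, fun i j => (h i j).trans ?_⟩
  rw [pow_succ']
  have h1 : C ≤ max 1 (max |C| |R|) := (le_abs_self C).trans (by simp)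
  have h2 : R ^ (i + j) ≤ max 1 (max |C| |R|) ^ (i + j) :=
    (le_abs_self _).trans (by rw [abs_pow]; exact pow_le_pow_left₀ (abs_nonneg _) (by simp) _)
  calc C * R ^ (i + j) ≤ |C| * |R| ^ (i + j) := by
        rw [← abs_pow, ← abs_mul]; exact le_abs_self _
    _ ≤ _ := by gcongr <;> simp

theorem sum_geometric_le {η : ℝ} (h0 : 0 ≤ η) (h1 : η ≤ 1 / 2) (s : Finset (ℕ × ℕ))
    (hs : (0, 0) ∉ s) : ∑ x ∈ s, η ^ x.1 * η ^ x.2 ≤ 6 * η := by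
  have hg := hasSum_geometric_of_lt_one h0 (by linarith)
  have hprod := hg.mul hg (hg.summable.mul_of_nonneg hg.summable (fun n => pow_nonneg h0 n)
    (fun n => pow_nonneg h0 n))
  have h2 := sum_le_hasSum (insert (0, 0) s) (fun x _ => by positivity) hprod
  rw [Finset.sum_insert hs] at h2
  have h3 : (1 - η)⁻¹ * (1 - η)⁻¹ ≤ 1 + 6 * η := by
    have h4 : 0 < 1 - η := by linarith
    rw [← mul_inv, inv_le_iff_one_le_mul₀ (by positivity)]
    nlinarith [mul_nonneg h0 (by linarith : (0 : ℝ) ≤ 1 - 2 * η), mul_nonneg h0 h0, mul_nonneg h0 (mul_nonneg h0 h0)]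
  simp only [pow_zero, mul_one] at h2
  linarith

theorem geom_of_mul_eq {Q E A : BiSeries} {k : ℕ} (hQ : Geom Q) (hA : Geom A) (hA' : Q * E = A)
    (hk : OrdGE k Q) (ha : cf Q k 0 ≠ 0) : Geom E := by
  obtain ⟨K₁, hK₁1, hK₁⟩ := hQ
  obtain ⟨K₂, hK₂1, hK₂⟩ := hA
  obtain ⟨K, hK1, hKQ, hKA⟩ : ∃ K : ℝ, 1 ≤ K ∧ (∀ i j, ‖cf Q i j‖ ≤ K ^ (i + j + 1)) ∧
      ∀ i j, ‖cf A i j‖ ≤ K ^ (i + j + 1) :=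
    ⟨max K₁ K₂, hK₁1.trans (le_max_left _ _),
      fun i j => (hK₁ i j).trans (pow_le_pow_left₀ (by linarith) (le_max_left _ _) _),
      fun i j => (hK₂ i j).trans (pow_le_pow_left₀ (by linarith) (le_max_right _ _) _)⟩
  clear hK₁ hK₂ hK₁1 hK₂1 K₁ K₂
  have hapos : 0 < ‖cf Q k 0‖ := norm_pos_iff.2 ha
  have hKpos : 0 < K := by linarith
  obtain ⟨η, hη0, hη2, hηa⟩ : ∃ η : ℝ, 0 < η ∧ η ≤ 1 / 2 ∧ K ^ (k + 1) * (6 * η) ≤ ‖cf Q k 0‖ / 2 := by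
    refine ⟨min (1 / 2) (‖cf Q k 0‖ / (12 * K ^ (k + 1))), by positivity, min_le_left _ _, ?_⟩
    calc K ^ (k + 1) * (6 * min (1 / 2) (‖cf Q k 0‖ / (12 * K ^ (k + 1))))
        ≤ K ^ (k + 1) * (6 * (‖cf Q k 0‖ / (12 * K ^ (k + 1)))) := by gcongr; exact min_le_right _ _
      _ = ‖cf Q k 0‖ / 2 := by field_simp; norm_num
  obtain ⟨R, hR⟩ : ∃ R, R = K / η := ⟨_, rfl⟩
  obtain ⟨S, hS⟩ : ∃ S, S = η⁻¹ := ⟨_, rfl⟩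
  obtain ⟨C, hC⟩ : ∃ C, C = 2 * K ^ (k + 1) / ‖cf Q k 0‖ := ⟨_, rfl⟩
  have hRpos : 0 < R := by rw [hR]; positivity
  have hSpos : 0 < S := by rw [hS]; positivity
  have hCpos : 0 < C := by rw [hC]; positivity
  have hKR : K = η * R := by rw [hR]; field_simp
  have hSη : S * η = 1 := by rw [hS]; field_simp
  have hS1 : 1 ≤ S := by rw [hS]; exact (one_le_inv₀ hη0).2 (by linarith)
  have hKleR : K ≤ R := by rw [hKR]; nlinarith
  have hCa : K ^ (k + 1) = C * (‖cf Q k 0‖ / 2) := by rw [hC]; field_simp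
  have key (n : ℕ) : ∀ j i, i + j = n → ‖cf E i j‖ ≤ C * R ^ n * S ^ j := by
    induction n using Nat.strong_induction_on with
    | _ n ihn =>
    intro j
    induction j using Nat.strong_induction_on with
    | _ j ihj =>
    intro i hij
    have hcoef : cf A (i + k) j = cf Q k 0 * cf E i j +
        ∑ x ∈ ((Finset.HasAntidiagonal.antidiagonal (i + k)) ×ˢ
          (Finset.HasAntidiagonal.antidiagonal j)).erase ((k, i), (0, j)),
          cf Q x.1.1 x.2.1 * cf E x.1.2 x.2.2 := by
      rw [← hA', cf_mul, ← Finset.sum_product']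
      exact (Finset.add_sum_erase _
        (fun x : (ℕ × ℕ) × (ℕ × ℕ) => cf Q x.1.1 x.2.1 * cf E x.1.2 x.2.2)
        (a := ((k, i), (0, j))) (by simp [add_comm])).symm
    have hterm : ‖∑ x ∈ ((Finset.HasAntidiagonal.antidiagonal (i + k)) ×ˢ
          (Finset.HasAntidiagonal.antidiagonal j)).erase ((k, i), (0, j)),
          cf Q x.1.1 x.2.1 * cf E x.1.2 x.2.2‖ ≤ C * R ^ n * S ^ j * (‖cf Q k 0‖ / 2) := by
      rw [← Finset.sum_filter_of_ne (p := fun x => k ≤ x.1.1 + x.2.1)]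
      swap
      · intro x _ hx
        by_contra hlt
        exact hx (by rw [hk _ _ (by omega), zero_mul])
      refine (norm_sum_le _ _).trans ?_
      calc _ ≤ ∑ x ∈ (((Finset.HasAntidiagonal.antidiagonal (i + k)) ×ˢ
            (Finset.HasAntidiagonal.antidiagonal j)).erase ((k, i), (0, j))).filter
              (fun x => k ≤ x.1.1 + x.2.1), C * R ^ n * S ^ j * K ^ (k + 1) *
              (η ^ (x.1.1 + x.2.1 - k) * η ^ x.2.1) := by
            refine Finset.sum_le_sum fun x hx => ?_
            obtain ⟨⟨i₁, i₂⟩, ⟨j₁, j₂⟩⟩ := x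
            simp only [Finset.mem_filter, Finset.mem_erase, Finset.mem_product, Prod.mk.injEq,
              Finset.HasAntidiagonal.mem_antidiagonal, ne_eq] at hx ⊢
            obtain ⟨⟨hne, hi, hj⟩, hle⟩ := hx
            obtain ⟨t, ht⟩ := Nat.exists_eq_add_of_le hle
            have hE : ‖cf E i₂ j₂‖ ≤ C * R ^ (n - t) * S ^ j₂ := by
              rcases Nat.eq_zero_or_pos t with rfl | htpos
              · exact ihj j₂ (by omega) i₂ (by omega)
              · exact ihn (n - t) (by omega) j₂ i₂ (by omega)
            rw [norm_mul]
            calc _ ≤ K ^ (i₁ + j₁ + 1) * (C * R ^ (n - t) * S ^ j₂) := by gcongr; exact hKQ _ _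
              _ = K ^ (k + 1) * (η * R) ^ t * (C * R ^ (n - t) * S ^ j₂) * (S * η) ^ j₁ := by
                  rw [hSη, ← hKR, ht]; ring
              _ = _ := by
                  rw [show i₁ + j₁ - k = t by omega, ← hj,
                    show R ^ n = R ^ t * R ^ (n - t) by rw [← pow_add]; congr 1; omega]
                  ring
        _ ≤ C * R ^ n * S ^ j * K ^ (k + 1) * (6 * η) := by
            rw [← Finset.mul_sum]
            refine mul_le_mul_of_nonneg_left ?_ (by positivity)
            rw [← Finset.sum_image (f := fun y : ℕ × ℕ => η ^ y.1 * η ^ y.2)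
              (g := fun x : (ℕ × ℕ) × (ℕ × ℕ) => (x.1.1 + x.2.1 - k, x.2.1))]
            · refine sum_geometric_le hη0.le hη2 _ ?_
              simp only [Finset.mem_image, Finset.mem_filter, Finset.mem_erase, Finset.mem_product,
                Prod.mk.injEq, Finset.HasAntidiagonal.mem_antidiagonal, ne_eq, Prod.exists]
              rintro ⟨a, b, c, d, h⟩
              omega
            · rintro ⟨⟨i₁, i₂⟩, ⟨j₁, j₂⟩⟩ hx ⟨⟨i₁', i₂'⟩, ⟨j₁', j₂'⟩⟩ hx' h
              simp only [Finset.coe_filter, Set.mem_ofPred_eq, Finset.mem_erase, Finset.mem_product,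
                Prod.mk.injEq, Finset.HasAntidiagonal.mem_antidiagonal, ne_eq] at hx hx' h ⊢
              omega
        _ ≤ _ := by rw [mul_assoc]; exact mul_le_mul_of_nonneg_left hηa (by positivity)
    have hAb : ‖cf A (i + k) j‖ ≤ C * R ^ n * S ^ j * (‖cf Q k 0‖ / 2) := by
      calc _ ≤ K ^ (i + k + j + 1) := hKA _ _
        _ = K ^ (k + 1) * K ^ n := by rw [← hij]; ring
        _ ≤ K ^ (k + 1) * (R ^ n * S ^ j) := by
            gcongr
            calc K ^ n = K ^ n * 1 := (mul_one _).symm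
              _ ≤ _ := by gcongr; exact one_le_pow₀ hS1
        _ = _ := by rw [hCa]; ring
    have hfin : ‖cf Q k 0‖ * ‖cf E i j‖ ≤ ‖cf Q k 0‖ * (C * R ^ n * S ^ j) := by
      rw [← norm_mul, eq_sub_of_add_eq hcoef.symm]
      refine (norm_sub_le _ _).trans ?_
      linarith
    exact le_of_mul_le_mul_left hfin hapos
  refine Geom.of_le (C := C) (R := R * S) fun i j => (key _ j i rfl).trans ?_
  rw [mul_pow, ← mul_assoc]
  gcongr
  omega

end BiSeries

theorem HasSum.sum_fiber {α β : Type*} {f : α → ℂ} {s : ℂ} (h : HasSum f s) (g : α → β)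
    (t : β → Finset α) (ht : ∀ a b, a ∈ t b ↔ g a = b) :
    HasSum (fun b => ∑ a ∈ t b, f a) s := by
  have h1 := (Equiv.sigmaFiberEquiv g).hasSum_iff.2 h
  refine h1.sigma fun b => ?_
  have h2 : HasSum ({a | g a = b}.indicator f) (∑ a ∈ t b, {a | g a = b}.indicator f a) :=
    hasSum_sum_of_ne_finset_zero fun a ha => Set.indicator_of_notMem (by simpa [ht] using ha) _
  rw [Finset.sum_congr rfl fun a ha => Set.indicator_of_mem (by simpa [ht] using ha) f] at h2
  exact hasSum_subtype_iff_indicator.2 h2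

namespace BiSeries

/-- The monomial of index `x` evaluated at `z = ζ`, `w = conj ζ`. -/
noncomputable def term (c : BiSeries) (ζ : ℂ) (x : ℕ × ℕ) : ℂ :=
  cf c x.1 x.2 * ζ ^ x.1 * conj ζ ^ x.2

/-- Evaluation of a series at `z = ζ`, `w = conj ζ`. -/
noncomputable def ev (c : BiSeries) (ζ : ℂ) : ℂ := ∑' x, term c ζ x

theorem summable_half : Summable fun x : ℕ × ℕ => ((1 / 2 : ℝ) ^ x.1 * (1 / 2 : ℝ) ^ x.2) :=
  summable_geometric_two.mul_of_nonneg summable_geometric_two (fun _ => by positivity)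
    (fun _ => by positivity)

theorem norm_term_le {c : BiSeries} {K : ℝ} (hK : 1 ≤ K)
    (h : ∀ i j, ‖cf c i j‖ ≤ K ^ (i + j + 1)) {ζ : ℂ} (hζ : ‖ζ‖ ≤ (2 * K)⁻¹) (x : ℕ × ℕ) :
    ‖term c ζ x‖ ≤ K * ((1 / 2) ^ x.1 * (1 / 2) ^ x.2) := by
  rw [term, norm_mul, norm_mul, norm_pow, norm_pow, RCLike.norm_conj]
  have hK0 : 0 < K := by linarith
  calc _ ≤ K ^ (x.1 + x.2 + 1) * (2 * K)⁻¹ ^ x.1 * (2 * K)⁻¹ ^ x.2 := by gcongr; exact h _ _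
    _ = _ := by
      simp only [mul_inv, mul_pow, inv_pow, div_pow, one_pow, pow_succ, pow_add]
      field_simp

theorem Geom.exists_summable {c : BiSeries} (hc : Geom c) :
    ∃ r > 0, ∀ ζ : ℂ, ‖ζ‖ ≤ r → Summable fun x => ‖term c ζ x‖ := by
  obtain ⟨K, hK, h⟩ := hc
  exact ⟨(2 * K)⁻¹, by positivity, fun ζ hζ => Summable.of_nonneg_of_le (fun _ => norm_nonneg _)
    (norm_term_le hK h hζ) (summable_half.mul_left K)⟩

theorem Geom.eventually_summable {c : BiSeries} (hc : Geom c) :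
    ∀ᶠ ζ in 𝓝 (0 : ℂ), Summable fun x => ‖term c ζ x‖ := by
  obtain ⟨r, hr, h⟩ := hc.exists_summable
  filter_upwards [Metric.closedBall_mem_nhds (0 : ℂ) hr] with ζ hζ
  exact h ζ (by simpa using hζ)

theorem Geom.eventually_hasSum {c : BiSeries} (hc : Geom c) :
    ∀ᶠ ζ in 𝓝 (0 : ℂ), HasSum (term c ζ) (ev c ζ) :=
  hc.eventually_summable.mono fun _ h => h.of_norm.hasSum

theorem Geom.add {a b : BiSeries} (ha : Geom a) (hb : Geom b) : Geom (a + b) := by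
  obtain ⟨K, hK, h⟩ := ha
  obtain ⟨L, hL, h'⟩ := hb
  refine Geom.of_le (C := K + L) (R := max K L) fun i j => ?_
  rw [cf_add]
  refine (norm_add_le _ _).trans ?_
  calc _ ≤ K ^ (i + j + 1) + L ^ (i + j + 1) := add_le_add (h i j) (h' i j)
    _ ≤ K * max K L ^ (i + j) + L * max K L ^ (i + j) := by
      rw [pow_succ', pow_succ']
      gcongr <;> simp
    _ = _ := by ring

theorem Geom.const_mul {a : BiSeries} (ha : Geom a) (s : ℂ) : Geom (const s * a) := by
  obtain ⟨K, hK, h⟩ := ha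
  refine Geom.of_le (C := ‖s‖ * K) (R := K) fun i j => ?_
  rw [cf_const_mul, norm_mul, mul_assoc, ← pow_succ']
  gcongr
  exact h i j

theorem Geom.sub {a b : BiSeries} (ha : Geom a) (hb : Geom b) : Geom (a - b) := by
  have h := ha.add (hb.const_mul (-1))
  rwa [map_neg, map_one, neg_one_mul, ← sub_eq_add_neg] at h

theorem Geom.mul {a b : BiSeries} (ha : Geom a) (hb : Geom b) : Geom (a * b) := by
  obtain ⟨K, hK, h⟩ := ha
  obtain ⟨L, hL, h'⟩ := hb
  refine Geom.of_le (C := K * L) (R := 2 * max K L) fun i j => ?_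
  have hM : 0 ≤ max K L := by positivity
  rw [cf_mul, ← Finset.sum_product']
  refine (norm_sum_le _ _).trans ((Finset.sum_le_card_nsmul _ _ (K * L * max K L ^ (i + j)) ?_).trans ?_)
  · rintro ⟨⟨i₁, i₂⟩, ⟨j₁, j₂⟩⟩ hx
    simp only [Finset.mem_product, Finset.HasAntidiagonal.mem_antidiagonal] at hx ⊢
    rw [norm_mul]
    calc _ ≤ K ^ (i₁ + j₁ + 1) * L ^ (i₂ + j₂ + 1) := by gcongr; exacts [h _ _, h' _ _]
      _ = K * L * (K ^ (i₁ + j₁) * L ^ (i₂ + j₂)) := by ring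
      _ ≤ K * L * (max K L ^ (i₁ + j₁) * max K L ^ (i₂ + j₂)) := by gcongr <;> simp
      _ = _ := by rw [← pow_add]; congr 2; omega
  · rw [nsmul_eq_mul, Finset.card_product, Finset.Nat.card_antidiagonal,
      Finset.Nat.card_antidiagonal, mul_pow]
    have h2 : (((i + 1) * (j + 1) : ℕ) : ℝ) ≤ 2 ^ (i + j) := by
      have hi : i + 1 ≤ 2 ^ i := Nat.lt_two_pow_self
      have hj : j + 1 ≤ 2 ^ j := Nat.lt_two_pow_self
      rw [pow_add]
      exact_mod_cast Nat.mul_le_mul hi hj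
    calc _ ≤ (2 : ℝ) ^ (i + j) * (K * L * max K L ^ (i + j)) := by gcongr
      _ = _ := by ring

theorem Geom.dz {a : BiSeries} (ha : Geom a) : Geom (dz a) := by
  obtain ⟨K, hK, h⟩ := ha
  refine Geom.of_le (C := K ^ 2) (R := 2 * K) fun i j => ?_
  rw [cf_dz, norm_mul]
  have h2 : ‖(i + 1 : ℂ)‖ ≤ 2 ^ (i + j) := by
    have hi : i + 1 ≤ 2 ^ (i + j) := (Nat.succ_le_of_lt Nat.lt_two_pow_self).trans
      (Nat.pow_le_pow_right (by norm_num) (by omega))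
    rw [← Nat.cast_succ, Complex.norm_natCast]
    exact_mod_cast hi
  calc _ ≤ (2 : ℝ) ^ (i + j) * K ^ (i + 1 + j + 1) := by gcongr; exact h _ _
    _ = _ := by rw [mul_pow]; ring

theorem Geom.dw {a : BiSeries} (ha : Geom a) : Geom (dw a) := by
  obtain ⟨K, hK, h⟩ := ha
  refine Geom.of_le (C := K ^ 2) (R := 2 * K) fun i j => ?_
  rw [cf_dw, norm_mul]
  have h2 : ‖(j + 1 : ℂ)‖ ≤ 2 ^ (i + j) := by
    have hi : j + 1 ≤ 2 ^ (i + j) := (Nat.succ_le_of_lt Nat.lt_two_pow_self).trans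
      (Nat.pow_le_pow_right (by norm_num) (by omega))
    rw [← Nat.cast_succ, Complex.norm_natCast]
    exact_mod_cast hi
  calc _ ≤ (2 : ℝ) ^ (i + j) * K ^ (i + (j + 1) + 1) := by gcongr; exact h _ _
    _ = _ := by rw [mul_pow]; ring

theorem ev_add {a b : BiSeries} (ha : Geom a) (hb : Geom b) :
    ∀ᶠ ζ in 𝓝 (0 : ℂ), ev (a + b) ζ = ev a ζ + ev b ζ := by
  filter_upwards [ha.eventually_hasSum, hb.eventually_hasSum] with ζ h1 h2
  rw [← (h1.add h2).tsum_eq, ev]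
  refine tsum_congr fun x => ?_
  simp only [term, cf_add]; ring

theorem ev_const_mul (a : BiSeries) (s ζ : ℂ) : ev (const s * a) ζ = s * ev a ζ := by
  rw [ev, ev, ← tsum_mul_left]
  refine tsum_congr fun x => ?_
  simp only [term, cf_const_mul]; ring

theorem ev_sub {a b : BiSeries} (ha : Geom a) (hb : Geom b) :
    ∀ᶠ ζ in 𝓝 (0 : ℂ), ev (a - b) ζ = ev a ζ - ev b ζ := by
  filter_upwards [ha.eventually_hasSum, hb.eventually_hasSum] with ζ h1 h2
  rw [← (h1.sub h2).tsum_eq, ev]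
  refine tsum_congr fun x => ?_
  simp only [term, cf_sub]; ring

theorem ev_mul {a b : BiSeries} (ha : Geom a) (hb : Geom b) :
    ∀ᶠ ζ in 𝓝 (0 : ℂ), ev (a * b) ζ = ev a ζ * ev b ζ := by
  filter_upwards [ha.eventually_summable, hb.eventually_summable] with ζ h1 h2
  have h3 := (h1.of_norm.hasSum).mul (h2.of_norm.hasSum) (summable_mul_of_summable_norm h1 h2)
  have h4 := (Equiv.prodProdProdComm ℕ ℕ ℕ ℕ).hasSum_iff.2 h3
  have h5 := h4.sum_fiber (fun q => (q.1.1 + q.1.2, q.2.1 + q.2.2))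
    (fun y => Finset.HasAntidiagonal.antidiagonal y.1 ×ˢ Finset.HasAntidiagonal.antidiagonal y.2)
    (fun q y => by simp [Prod.ext_iff])
  rw [ev, ev, ev, ← h5.tsum_eq]
  refine tsum_congr fun y => ?_
  rw [term, cf_mul, ← Finset.sum_product', Finset.sum_mul, Finset.sum_mul]
  refine Finset.sum_congr rfl fun q hq => ?_
  simp only [Finset.mem_product, Finset.HasAntidiagonal.mem_antidiagonal] at hq
  simp only [Function.comp, term, Equiv.prodProdProdComm_apply, ← hq.1, ← hq.2]
  ring

theorem hasFDerivAt_term (c : BiSeries) (x : ℕ × ℕ) (ζ : ℂ) :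
    HasFDerivAt (fun ζ => term c ζ x)
      ((cf c x.1 x.2 * x.1 * ζ ^ (x.1 - 1) * conj ζ ^ x.2) • (ContinuousLinearMap.id ℝ ℂ) +
        (cf c x.1 x.2 * x.2 * ζ ^ x.1 * conj ζ ^ (x.2 - 1)) • (Complex.conjCLE : ℂ →L[ℝ] ℂ)) ζ := by
  have h1 := (hasFDerivAt_id (𝕜 := ℝ) ζ).pow x.1
  have h2 := ((Complex.conjCLE : ℂ →L[ℝ] ℂ).hasFDerivAt (x := ζ)).pow x.2
  have h3 := (h1.const_mul (cf c x.1 x.2)).mul h2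
  refine h3.congr_fderiv ?_
  ext v
  simp
  ring

theorem hasSum_shift_fst {c : BiSeries} {ζ s : ℂ} (h : HasSum (term (dz c) ζ) s) :
    HasSum (fun x : ℕ × ℕ => cf c x.1 x.2 * x.1 * ζ ^ (x.1 - 1) * conj ζ ^ x.2) s := by
  have hinj : Function.Injective fun x : ℕ × ℕ => (x.1 + 1, x.2) := fun x y h => by
    simpa [Prod.ext_iff] using h
  rw [← hinj.hasSum_iff]
  · convert h using 1
    ext x
    simp only [term, Function.comp, cf_dz, Nat.add_sub_cancel]
    push_cast
    ring
  · rintro ⟨i, j⟩ hx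
    rcases i with _ | i
    · simp
    · exact absurd ⟨(i, j), rfl⟩ hx

theorem hasSum_shift_snd {c : BiSeries} {ζ s : ℂ} (h : HasSum (term (dw c) ζ) s) :
    HasSum (fun x : ℕ × ℕ => cf c x.1 x.2 * x.2 * ζ ^ x.1 * conj ζ ^ (x.2 - 1)) s := by
  have hinj : Function.Injective fun x : ℕ × ℕ => (x.1, x.2 + 1) := fun x y h => by
    simpa [Prod.ext_iff] using h
  rw [← hinj.hasSum_iff]
  · convert h using 1
    ext x
    simp only [term, Function.comp, cf_dw, Nat.add_sub_cancel]
    push_cast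
    ring
  · rintro ⟨i, j⟩ hx
    rcases j with _ | j
    · simp
    · exact absurd ⟨(i, j), rfl⟩ hx

theorem hasFDerivAt_ev {c : BiSeries} (hc : Geom c) : ∀ᶠ ζ in 𝓝 (0 : ℂ),
    HasFDerivAt (ev c) (ev (dz c) ζ • (ContinuousLinearMap.id ℝ ℂ) +
      ev (dw c) ζ • (Complex.conjCLE : ℂ →L[ℝ] ℂ)) ζ := by
  obtain ⟨r, hr, hs⟩ := hc.exists_summable
  obtain ⟨rz, hrz, hz⟩ := hc.dz.exists_summable
  obtain ⟨rw', hrw, hw⟩ := hc.dw.exists_summable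
  obtain ⟨ρ, hρ, hρr, hρz, hρw⟩ : ∃ ρ > 0, ρ ≤ r ∧ ρ ≤ rz ∧ ρ ≤ rw' :=
    ⟨min r (min rz rw'), by positivity, by simp, by simp, by simp⟩
  have hρn : ‖(ρ : ℂ)‖ = ρ := by simp [abs_of_pos hρ]
  filter_upwards [Metric.ball_mem_nhds (0 : ℂ) hρ] with ζ hζ
  have hζ' : ‖ζ‖ < ρ := by simpa using hζ
  have hsz := (hasSum_shift_fst (hz ρ (by rw [hρn]; exact hρz)).of_norm.hasSum).summable.norm
  have hsw := (hasSum_shift_snd (hw ρ (by rw [hρn]; exact hρw)).of_norm.hasSum).summable.norm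
  have h := hasFDerivAt_tsum_of_isPreconnected (𝕜 := ℝ) (f := fun x ζ => term c ζ x)
    (hsz.add hsw) Metric.isOpen_ball (convex_ball (0 : ℂ) ρ).isPreconnected
    (fun x ζ _ => hasFDerivAt_term c x ζ) (fun x ξ hξ => ?_) (Metric.mem_ball_self hρ)
    (hs 0 (by simpa using hr.le)).of_norm hζ
  · refine h.congr_fderiv ?_
    have h1 := hasSum_shift_fst (hz ζ (hζ'.le.trans hρz)).of_norm.hasSum
    have h2 := hasSum_shift_snd (hw ζ (hζ'.le.trans hρw)).of_norm.hasSum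
    exact ((h1.smul_const _).add (h2.smul_const _)).tsum_eq
  · have hξ' : ‖ξ‖ ≤ ρ := by simpa using (Metric.mem_ball.1 hξ).le
    refine (norm_add_le _ _).trans (add_le_add ?_ ?_)
    · rw [norm_smul]
      refine (mul_le_of_le_one_right (norm_nonneg _) ContinuousLinearMap.norm_id_le).trans ?_
      simp only [norm_mul, norm_pow, RCLike.norm_conj, hρn]
      gcongr
    · rw [norm_smul]
      refine (mul_le_of_le_one_right (norm_nonneg _) ?_).trans ?_
      · exact ContinuousLinearMap.opNorm_le_bound _ zero_le_one fun v => by simp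
      simp only [norm_mul, norm_pow, RCLike.norm_conj, hρn]
      gcongr

theorem ev_zero (c : BiSeries) : ev c 0 = cf c 0 0 := by
  rw [ev, tsum_eq_single (0, 0)]
  · simp [term]
  · rintro ⟨i, j⟩ h
    rcases i with _ | i
    · rcases j with _ | j
      · simp at h
      · simp [term]
    · simp [term]

theorem ev_dz_dw_eventuallyEq {a b : BiSeries} (ha : Geom a) (hb : Geom b)
    (h : ev a =ᶠ[𝓝 0] ev b) : ev (dz a) =ᶠ[𝓝 0] ev (dz b) ∧ ev (dw a) =ᶠ[𝓝 0] ev (dw b) := by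
  have key : ∀ᶠ ζ in 𝓝 (0 : ℂ), ev (dz a) ζ = ev (dz b) ζ ∧ ev (dw a) ζ = ev (dw b) ζ := by
    filter_upwards [hasFDerivAt_ev ha, hasFDerivAt_ev hb, h.eventuallyEq_nhds] with ζ h1 h2 h3
    have h4 := h1.unique (h2.congr_of_eventuallyEq h3)
    have e1 := DFunLike.congr_fun h4 1
    have e2 := DFunLike.congr_fun h4 Complex.I
    simp at e1 e2
    have e3 : (ev (dz a) ζ - ev (dw a) ζ) * Complex.I = (ev (dz b) ζ - ev (dw b) ζ) * Complex.I := by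
      linear_combination e2
    have e4 := mul_right_cancel₀ Complex.I_ne_zero e3
    exact ⟨by linear_combination (e1 + e4) / 2, by linear_combination (e1 - e4) / 2⟩
  exact ⟨key.mono fun _ h => h.1, key.mono fun _ h => h.2⟩

theorem eq_of_ev_eventuallyEq {a b : BiSeries} (ha : Geom a) (hb : Geom b)
    (h : ev a =ᶠ[𝓝 0] ev b) : a = b := by
  refine ext_cf fun i => ?_
  induction i generalizing a b with
  | zero =>
    intro j
    induction j generalizing a b with
    | zero => rw [← ev_zero, ← ev_zero, h.self_of_nhds]
    | succ j ih =>
      have h1 := ih ha.dw hb.dw (ev_dz_dw_eventuallyEq ha hb h).2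
      rw [cf_dw, cf_dw] at h1
      exact mul_left_cancel₀ (by exact_mod_cast j.succ_ne_zero) h1
  | succ i ih =>
    intro j
    have h1 := ih ha.dz hb.dz (ev_dz_dw_eventuallyEq ha hb h).1 j
    rw [cf_dz, cf_dz] at h1
    exact mul_left_cancel₀ (by exact_mod_cast i.succ_ne_zero) h1

theorem ev_isBigO {a : BiSeries} (ha : Geom a) {k : ℕ} (hk : OrdGE k a) :
    ev a =O[𝓝 0] fun ζ => ‖ζ‖ ^ k := by
  obtain ⟨K, hK, h⟩ := ha
  have hK0 : 0 < K := by linarith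
  refine IsBigO.of_bound (∑' x : ℕ × ℕ, K * (2 * K) ^ k * ((1 / 2) ^ x.1 * (1 / 2) ^ x.2)) ?_
  filter_upwards [Metric.closedBall_mem_nhds (0 : ℂ) (by positivity : 0 < (2 * K)⁻¹)] with ζ hζ
  have hζ' : ‖ζ‖ ≤ (2 * K)⁻¹ := by simpa using hζ
  have hs := summable_half.mul_left (K * (2 * K) ^ k)
  rw [norm_pow, norm_norm, ← tsum_mul_right]
  refine tsum_of_norm_bounded (hs.mul_right _).hasSum fun x => ?_
  rcases lt_or_ge (x.1 + x.2) k with hx | hx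
  · rw [term, hk _ _ hx, zero_mul, zero_mul, norm_zero]; positivity
  rw [term, norm_mul, norm_mul, norm_pow, norm_pow, RCLike.norm_conj, mul_assoc, ← pow_add]
  calc _ ≤ K ^ (x.1 + x.2 + 1) * ((2 * K)⁻¹ ^ (x.1 + x.2 - k) * ‖ζ‖ ^ k) := by
        rw [show ‖ζ‖ ^ (x.1 + x.2) = ‖ζ‖ ^ (x.1 + x.2 - k) * ‖ζ‖ ^ k by
          rw [← pow_add, Nat.sub_add_cancel hx]]
        gcongr
        exact h _ _
    _ = _ := by
        obtain ⟨m, hm⟩ := Nat.exists_eq_add_of_le hx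
        rw [← pow_add, hm, Nat.add_sub_cancel_left]
        simp only [mul_inv, mul_pow, inv_pow, div_pow, one_pow, pow_succ, pow_add]
        field_simp

end BiSeries

namespace BiSeries

/-- `f` is given near `p` by a convergent series in `ζ`, `conj ζ`. -/
def HasExp (c : BiSeries) (f : ℂ → ℂ) (p : ℂ) : Prop :=
  Geom c ∧ ∀ᶠ ζ in 𝓝 (0 : ℂ), f (p + ζ) = ev c ζ

/-- Coefficient of `ζ` in the real part (for `b`) or the imaginary part of `ζ`. -/
noncomputable def wt (b : Prop) [Decidable b] : ℂ := if b then 1 / 2 else 1 / (2 * Complex.I)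

/-- Coefficient of `conj ζ` in the real part (for `b`) or the imaginary part of `ζ`. -/
noncomputable def wt' (b : Prop) [Decidable b] : ℂ := if b then 1 / 2 else -1 / (2 * Complex.I)

/-- Coefficient of a real multilinear map in the expansion by `ζ` and `conj ζ`. -/
noncomputable def multiCoeff {n : ℕ} (P : ContinuousMultilinearMap ℝ (fun _ : Fin n => ℂ) ℂ)
    (S : Finset (Fin n)) : ℂ :=
  ∑ T : Finset (Fin n), P (T.piecewise (fun _ => 1) (fun _ => Complex.I)) *
    ((∏ k ∈ S, wt (k ∈ T)) * ∏ k ∈ Finset.univ \ S, wt' (k ∈ T))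

theorem map_diag_eq_sum {n : ℕ} (P : ContinuousMultilinearMap ℝ (fun _ : Fin n => ℂ) ℂ) (ζ : ℂ) :
    P (fun _ => ζ) = ∑ S : Finset (Fin n), multiCoeff P S * ζ ^ S.card * conj ζ ^ (n - S.card) := by
  have h1 : (fun _ : Fin n => ζ) = (fun _ => ζ.re • (1 : ℂ)) + fun _ => ζ.im • Complex.I := by
    ext; simp
  have h2 : P (fun _ => ζ) = ∑ T : Finset (Fin n), P.toMultilinearMap
      (T.piecewise (fun _ => ζ.re • (1 : ℂ)) (fun _ => ζ.im • Complex.I)) := by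
    rw [h1]
    exact P.toMultilinearMap.map_add_univ _ _
  have h3 (T : Finset (Fin n)) : P.toMultilinearMap
      (T.piecewise (fun _ => ζ.re • (1 : ℂ)) (fun _ => ζ.im • Complex.I)) =
      ∑ S : Finset (Fin n), P (T.piecewise (fun _ => 1) (fun _ => Complex.I)) *
        ((∏ k ∈ S, wt (k ∈ T)) * ∏ k ∈ Finset.univ \ S, wt' (k ∈ T)) * ζ ^ S.card *
          conj ζ ^ (n - S.card) := by
    have e1 : T.piecewise (fun _ => ζ.re • (1 : ℂ)) (fun _ => ζ.im • Complex.I) =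
        fun k => (if k ∈ T then ζ.re else ζ.im) • T.piecewise (fun _ => 1) (fun _ => Complex.I) k := by
      ext k
      by_cases hk : k ∈ T <;> simp [hk]
    have e2 (k : Fin n) : ((if k ∈ T then ζ.re else ζ.im : ℝ) : ℂ) =
        wt (k ∈ T) * ζ + wt' (k ∈ T) * conj ζ := by
      rw [wt, wt']
      split_ifs
      · rw [Complex.re_eq_add_conj]; ring
      · rw [Complex.im_eq_sub_conj]; ring
    rw [e1, MultilinearMap.map_smul_univ, Complex.real_smul, Complex.ofReal_prod,
      Finset.prod_congr rfl fun k _ => e2 k, Finset.prod_add, Finset.sum_mul, Finset.powerset_univ]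
    refine Finset.sum_congr rfl fun S _ => ?_
    rw [Finset.prod_mul_distrib, Finset.prod_mul_distrib, Finset.prod_const, Finset.prod_const,
      Finset.card_sdiff_of_subset (Finset.subset_univ S), Finset.card_univ, Fintype.card_fin]
    simp only [ContinuousMultilinearMap.coe_coe]
    ring
  rw [h2, Finset.sum_congr rfl fun T _ => h3 T, Finset.sum_comm]
  refine Finset.sum_congr rfl fun S _ => ?_
  rw [multiCoeff, Finset.sum_mul, Finset.sum_mul]

theorem norm_multiCoeff_le {n : ℕ} (P : ContinuousMultilinearMap ℝ (fun _ : Fin n => ℂ) ℂ)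
    (S : Finset (Fin n)) : ‖multiCoeff P S‖ ≤ ‖P‖ := by
  have hw (b : Prop) [Decidable b] : ‖wt b‖ = 1 / 2 := by rw [wt]; split_ifs <;> simp
  have hw' (b : Prop) [Decidable b] : ‖wt' b‖ = 1 / 2 := by rw [wt']; split_ifs <;> simp
  have key (T : Finset (Fin n)) : ‖P (T.piecewise (fun _ => 1) (fun _ => Complex.I)) *
    ((∏ k ∈ S, wt (k ∈ T)) * ∏ k ∈ Finset.univ \ S, wt' (k ∈ T))‖ ≤ ‖P‖ * (1 / 2) ^ n := by
    rw [norm_mul, norm_mul, norm_prod, norm_prod, Finset.prod_congr rfl fun k _ => hw _,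
      Finset.prod_congr rfl fun k _ => hw' _, Finset.prod_const, Finset.prod_const,
      Finset.card_sdiff_of_subset (Finset.subset_univ S), Finset.card_univ, Fintype.card_fin,
      ← pow_add, Nat.add_sub_cancel' (by simpa using Finset.card_le_univ S)]
    gcongr
    refine (P.le_opNorm _).trans (mul_le_of_le_one_right (norm_nonneg _) ?_)
    refine Finset.prod_le_one (fun _ _ => norm_nonneg _) fun k _ => ?_
    by_cases hk : k ∈ T <;> simp [hk]
  refine (norm_sum_le _ _).trans ((Finset.sum_le_card_nsmul _ _ _ fun T _ => key T).trans ?_)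
  rw [Finset.card_univ, Fintype.card_finset, Fintype.card_fin, nsmul_eq_mul]
  push_cast
  rw [mul_left_comm, ← mul_pow]
  norm_num

theorem exists_hasExp {f : ℂ → ℂ} {p : ℂ} (hf : AnalyticAt ℝ f p) : ∃ c, HasExp c f p := by
  obtain ⟨P, hP⟩ := hf
  obtain ⟨C, r, hC, hr, hPb⟩ := P.le_mul_pow_of_radius_pos hP.radius_pos
  obtain ⟨cc, hcc⟩ : ∃ cc : ℕ → ℕ → ℂ, ∀ i n, cc i n =
    ∑ S : Finset (Fin n) with S.card = i, multiCoeff (P n) S := ⟨_, fun _ _ => rfl⟩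
  have hgeom : Geom (ofCf fun i j => cc i (i + j)) := by
    refine Geom.of_le (C := C) (R := 2 * r) fun i j => ?_
    rw [cf_ofCf, hcc]
    refine (norm_sum_le _ _).trans ((Finset.sum_le_card_nsmul _ _ _ fun S _ =>
      (norm_multiCoeff_le _ S).trans (hPb _)).trans ?_)
    rw [nsmul_eq_mul]
    have : ((Finset.univ.filter fun S : Finset (Fin (i + j)) => S.card = i).card : ℝ) ≤ 2 ^ (i + j) := by
      have h := Finset.card_filter_le (Finset.univ : Finset (Finset (Fin (i + j)))) fun S => S.card = i
      rw [Finset.card_univ, Fintype.card_finset, Fintype.card_fin] at h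
      exact_mod_cast h
    calc _ ≤ (2 : ℝ) ^ (i + j) * (C * r ^ (i + j)) := by gcongr
      _ = _ := by rw [mul_pow]; ring
  refine ⟨_, hgeom, ?_⟩
  filter_upwards [hgeom.eventually_hasSum, hP.eventually_hasSum] with ζ h1 h2
  have h3 := h1.sum_fiber (fun x => x.1 + x.2) Finset.HasAntidiagonal.antidiagonal (fun x n => by
    rw [Finset.HasAntidiagonal.mem_antidiagonal])
  have h4 (n : ℕ) : P n (fun _ => ζ) = ∑ a ∈ Finset.HasAntidiagonal.antidiagonal n,
      term (ofCf fun i j => cc i (i + j)) ζ a := ?_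
  · simp only [h4] at h2
    exact h2.unique h3
  rw [map_diag_eq_sum, ← Finset.sum_fiberwise_of_maps_to (g := fun S => (S.card, n - S.card))
    (t := Finset.HasAntidiagonal.antidiagonal n)]
  · refine Finset.sum_congr rfl fun x hx => ?_
    rw [Finset.HasAntidiagonal.mem_antidiagonal] at hx
    rw [term, cf_ofCf, hcc, hx, Finset.sum_mul, Finset.sum_mul]
    refine Finset.sum_congr ?_ fun S hS => ?_
    · ext S
      simp only [Finset.mem_filter, Finset.mem_univ, true_and, Prod.ext_iff]
      omega
    · rw [Finset.mem_filter] at hS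
      rw [hS.2, show n - x.1 = x.2 by omega]
  · intro S _
    rw [Finset.HasAntidiagonal.mem_antidiagonal]
    have := Finset.card_le_univ S
    rw [Fintype.card_fin] at this
    simp only
    omega

end BiSeries

/-- The Wirtinger derivative `∂f/∂z`. -/
noncomputable def wirtZ (f : ℂ → ℂ) (p : ℂ) : ℂ :=
  (fderiv ℝ f p 1 - Complex.I * fderiv ℝ f p Complex.I) / 2

/-- The Wirtinger derivative `∂f/∂z̄`. -/
noncomputable def wirtW (f : ℂ → ℂ) (p : ℂ) : ℂ :=
  (fderiv ℝ f p 1 + Complex.I * fderiv ℝ f p Complex.I) / 2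

theorem fderiv_eq_wirt (f : ℂ → ℂ) (p v : ℂ) :
    fderiv ℝ f p v = wirtZ f p * v + wirtW f p * conj v := by
  have h : fderiv ℝ f p v = v.re * fderiv ℝ f p 1 + v.im * fderiv ℝ f p Complex.I := by
    conv_lhs => rw [show v = v.re • (1 : ℂ) + v.im • Complex.I by simp]
    rw [map_add, map_smul, map_smul, Complex.real_smul, Complex.real_smul]
  rw [h, wirtZ, wirtW]
  conv_rhs => rw [← Complex.re_add_im v]
  simp only [map_add, map_mul, Complex.conj_ofReal, Complex.conj_I]
  linear_combination (v.im * fderiv ℝ f p Complex.I) * Complex.I_sq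

theorem wirt_eq_of_fderiv {f : ℂ → ℂ} {p a b : ℂ}
    (h : HasFDerivAt f (a • ContinuousLinearMap.id ℝ ℂ + b • (Complex.conjCLE : ℂ →L[ℝ] ℂ)) p) :
    wirtZ f p = a ∧ wirtW f p = b := by
  rw [wirtZ, wirtW, h.fderiv]
  simp only [_root_.add_apply, _root_.smul_apply, ContinuousLinearMap.id_apply,
    ContinuousLinearEquiv.coe_coe, Complex.conjCLE_apply, map_one, Complex.conj_I, smul_eq_mul]
  constructor
  · linear_combination ((-a + b) / 2) * Complex.I_sq
  · linear_combination ((a - b) / 2) * Complex.I_sq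

theorem AnalyticOnNhd.wirtZ {f : ℂ → ℂ} {V : Set ℂ} (hf : AnalyticOnNhd ℝ f V) :
    AnalyticOnNhd ℝ (wirtZ f) V := by
  have h (v : ℂ) : AnalyticOnNhd ℝ (fun p => fderiv ℝ f p v) V := fun p hp =>
    (ContinuousLinearMap.apply ℝ ℂ v).analyticAt _ |>.comp (hf.fderiv p hp)
  intro p hp
  exact ((h 1 p hp).sub (analyticAt_const.mul (h Complex.I p hp))).div_const

theorem AnalyticOnNhd.wirtW {f : ℂ → ℂ} {V : Set ℂ} (hf : AnalyticOnNhd ℝ f V) :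
    AnalyticOnNhd ℝ (wirtW f) V := by
  have h (v : ℂ) : AnalyticOnNhd ℝ (fun p => fderiv ℝ f p v) V := fun p hp =>
    (ContinuousLinearMap.apply ℝ ℂ v).analyticAt _ |>.comp (hf.fderiv p hp)
  intro p hp
  exact ((h 1 p hp).add (analyticAt_const.mul (h Complex.I p hp))).div_const

namespace BiSeries

theorem eventually_nhds_iff_add {p : ℂ} {P : ℂ → Prop} :
    (∀ᶠ ζ in 𝓝 (0 : ℂ), P (p + ζ)) ↔ ∀ᶠ q in 𝓝 p, P q := by
  rw [← Filter.eventually_map (m := fun ζ => p + ζ), map_add_left_nhds_zero]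

theorem HasExp.unique {c c' : BiSeries} {f g : ℂ → ℂ} {p : ℂ} (h : HasExp c f p)
    (h' : HasExp c' g p) (hfg : f =ᶠ[𝓝 p] g) : c = c' := by
  refine eq_of_ev_eventuallyEq h.1 h'.1 ?_
  filter_upwards [h.2, h'.2, eventually_nhds_iff_add.2 hfg] with ζ h1 h2 h3
  rw [← h1, h3, h2]

theorem HasExp.add {c d : BiSeries} {f g : ℂ → ℂ} {p : ℂ} (h : HasExp c f p) (h' : HasExp d g p) :
    HasExp (c + d) (fun q => f q + g q) p := by
  refine ⟨h.1.add h'.1, ?_⟩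
  filter_upwards [h.2, h'.2, ev_add h.1 h'.1] with ζ h1 h2 h3
  rw [h1, h2, h3]

theorem HasExp.sub {c d : BiSeries} {f g : ℂ → ℂ} {p : ℂ} (h : HasExp c f p) (h' : HasExp d g p) :
    HasExp (c - d) (fun q => f q - g q) p := by
  refine ⟨h.1.sub h'.1, ?_⟩
  filter_upwards [h.2, h'.2, ev_sub h.1 h'.1] with ζ h1 h2 h3
  rw [h1, h2, h3]

theorem HasExp.mul {c d : BiSeries} {f g : ℂ → ℂ} {p : ℂ} (h : HasExp c f p) (h' : HasExp d g p) :
    HasExp (c * d) (fun q => f q * g q) p := by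
  refine ⟨h.1.mul h'.1, ?_⟩
  filter_upwards [h.2, h'.2, ev_mul h.1 h'.1] with ζ h1 h2 h3
  rw [h1, h2, h3]

theorem Geom.monomial (a b : ℕ) : Geom (z ^ a * w ^ b) := by
  refine ⟨1, le_rfl, fun i j => ?_⟩
  rw [cf_monomial]
  split_ifs <;> simp

theorem ev_monomial (a b : ℕ) (ζ : ℂ) : ev (z ^ a * w ^ b) ζ = ζ ^ a * conj ζ ^ b := by
  rw [ev, tsum_eq_single (a, b)]
  · simp [term, cf_monomial]
  · rintro ⟨i, j⟩ h
    rw [term, cf_monomial, if_neg (by simpa [Prod.ext_iff] using h)]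
    simp

theorem hasExp_const (s p : ℂ) : HasExp (const s) (fun _ => s) p := by
  have h : const s = const s * (z ^ 0 * w ^ 0) := by simp
  rw [h]
  refine ⟨(Geom.monomial 0 0).const_mul s, .of_forall fun ζ => ?_⟩
  rw [ev_const_mul, ev_monomial]; simp

theorem hasExp_z (p : ℂ) : HasExp z (fun q => q - p) p := by
  have h : z = z ^ 1 * w ^ 0 := by simp
  rw [h]
  refine ⟨Geom.monomial 1 0, .of_forall fun ζ => ?_⟩
  rw [ev_monomial]; simp

theorem hasExp_w (p : ℂ) : HasExp w (fun q => conj (q - p)) p := by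
  have h : w = z ^ 0 * w ^ 1 := by simp
  rw [h]
  refine ⟨Geom.monomial 0 1, .of_forall fun ζ => ?_⟩
  rw [ev_monomial]; simp

theorem HasExp.pow {c : BiSeries} {f : ℂ → ℂ} {p : ℂ} (h : HasExp c f p) (k : ℕ) :
    HasExp (c ^ k) (fun q => f q ^ k) p := by
  induction k with
  | zero => simpa using hasExp_const 1 p
  | succ k ih => simpa only [pow_succ] using ih.mul h

theorem HasExp.hasFDerivAt {c : BiSeries} {f : ℂ → ℂ} {p : ℂ} (h : HasExp c f p) :
    ∀ᶠ ζ in 𝓝 (0 : ℂ), HasFDerivAt f (ev (dz c) ζ • (ContinuousLinearMap.id ℝ ℂ) +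
      ev (dw c) ζ • (Complex.conjCLE : ℂ →L[ℝ] ℂ)) (p + ζ) := by
  filter_upwards [hasFDerivAt_ev h.1, h.2.eventually_nhds] with ζ h1 h2
  have h3 : HasFDerivAt (fun q => ev c (q - p)) (ev (dz c) ζ • (ContinuousLinearMap.id ℝ ℂ) +
      ev (dw c) ζ • (Complex.conjCLE : ℂ →L[ℝ] ℂ)) (p + ζ) := by
    have h4 := HasFDerivAt.comp (p + ζ) (f := fun q => q - p) (by simpa using h1)
      ((hasFDerivAt_id (𝕜 := ℝ) (p + ζ)).sub_const p)
    simpa [Function.comp_def] using h4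
  refine h3.congr_of_eventuallyEq ?_
  have h5 : Filter.Tendsto (fun q => q - p) (𝓝 (p + ζ)) (𝓝 ζ) := by
    have : Continuous fun q : ℂ => q - p := by fun_prop
    simpa using this.tendsto (p + ζ)
  filter_upwards [h5.eventually h2] with q hq
  simpa using hq

theorem HasExp.wirtZ {c : BiSeries} {f : ℂ → ℂ} {p : ℂ} (h : HasExp c f p) :
    HasExp (dz c) (wirtZ f) p :=
  ⟨h.1.dz, h.hasFDerivAt.mono fun _ h => (wirt_eq_of_fderiv h).1⟩

theorem HasExp.wirtW {c : BiSeries} {f : ℂ → ℂ} {p : ℂ} (h : HasExp c f p) :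
    HasExp (dw c) (wirtW f) p :=
  ⟨h.1.dw, h.hasFDerivAt.mono fun _ h => (wirt_eq_of_fderiv h).2⟩

theorem HasExp.continuousAt {c : BiSeries} {f : ℂ → ℂ} {p : ℂ} (h : HasExp c f p) :
    ∀ᶠ q in 𝓝 p, ContinuousAt f q :=
  eventually_nhds_iff_add.1 (h.hasFDerivAt.mono fun _ h => h.continuousAt)

/-- The series of the complex conjugate function. -/
noncomputable def swapConj (c : BiSeries) : BiSeries := ofCf fun i j => conj (cf c j i)

theorem HasExp.conj {c : BiSeries} {f : ℂ → ℂ} {p : ℂ} (h : HasExp c f p) :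
    HasExp (swapConj c) (fun q => conj (f q)) p := by
  refine ⟨?_, ?_⟩
  · obtain ⟨K, hK, h⟩ := h.1
    refine ⟨K, hK, fun i j => ?_⟩
    rw [swapConj, cf_ofCf, RCLike.norm_conj, add_comm i j]
    exact h j i
  · filter_upwards [h.2, h.1.eventually_hasSum] with ζ h1 h2
    rw [h1]
    have h3 := (Equiv.prodComm ℕ ℕ).hasSum_iff.2 (Complex.hasSum_conj'.2 h2)
    rw [← h3.tsum_eq, ev]
    refine tsum_congr fun x => ?_
    simp [term, swapConj, cf_ofCf]
    ring

theorem HasExp.cf_conj {c : BiSeries} {f : ℂ → ℂ} {p : ℂ} (h : HasExp c f p)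
    (hf : ∀ᶠ q in 𝓝 p, (starRingEnd ℂ) (f q) = f q) (i j : ℕ) :
    cf c j i = (starRingEnd ℂ) (cf c i j) := by
  have h1 := h.conj.unique h hf
  conv_lhs => rw [← h1, swapConj, cf_ofCf]

theorem HasExp.cf_zero {c : BiSeries} {f : ℂ → ℂ} {p : ℂ} (h : HasExp c f p) :
    cf c 0 0 = f p := by
  rw [← ev_zero]
  simpa using h.2.self_of_nhds.symm

theorem HasExp.eq_zero_iff {c : BiSeries} {f : ℂ → ℂ} {p : ℂ} (h : HasExp c f p) :
    c = 0 ↔ f =ᶠ[𝓝 p] 0 := by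
  constructor
  · rintro rfl
    refine eventually_nhds_iff_add.1 (h.2.mono fun ζ h => ?_)
    rw [h, ev]
    simp [term]
  · intro h0
    have := h.unique (hasExp_const 0 p) h0
    simpa using this

theorem cf_linear_pow (e : ℂ) (k i j : ℕ) :
    cf ((z + const e * w) ^ k) i j = if i + j = k then k.choose j * e ^ j else 0 := by
  have h1 : (z + const e * w) ^ k =
      ∑ m ∈ Finset.range (k + 1), const (e ^ m * k.choose m) * (z ^ (k - m) * w ^ m) := by
    rw [add_comm, add_pow]
    refine Finset.sum_congr rfl fun m _ => ?_
    rw [map_mul, map_pow, map_natCast, mul_pow]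
    ring
  have h2 : cf ((z + const e * w) ^ k) i j =
      ∑ m ∈ Finset.range (k + 1), cf (const (e ^ m * k.choose m) * (z ^ (k - m) * w ^ m)) i j := by
    rw [h1]
    simp only [cf, map_sum]
  rw [h2]
  simp only [cf_const_mul, cf_monomial]
  split_ifs with h
  · rw [Finset.sum_eq_single j]
    · rw [if_pos ⟨by omega, rfl⟩]; ring
    · rintro m - hm
      rw [if_neg (by omega), mul_zero]
    · intro hm
      rw [Finset.mem_range] at hm
      omega
  · refine Finset.sum_eq_zero fun m hm => ?_
    rw [Finset.mem_range] at hm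
    rw [if_neg (by omega), mul_zero]

theorem hasLocalForm_of_dvd {Q A E : BiSeries} {q a : ℂ → ℂ} {p : ℂ} (hQ : HasExp Q q p)
    (hA : HasExp A a p) (hQ0 : Q ≠ 0) (hQA : dw Q = dz A) (hAE : A = Q * E)
    (ha : ∀ᶠ z in 𝓝 p, (starRingEnd ℂ) (a z) = a z) : HasLocalForm q p := by
  obtain ⟨k, hk, hne⟩ := exists_ordGE hQ0
  have ha0 := cf_leading_ne_zero_of_dvd hk hne hQA hAE
  have hE : Geom E := geom_of_mul_eq hQ.1 hA.1 hAE.symm hk ha0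
  refine ⟨k, cf Q k 0, cf E 0 0, ha0, ?_, ?_⟩
  · have h1 := hQ.sub ((hasExp_const (cf Q k 0) p).mul
      (((hasExp_z p).add ((hasExp_const (cf E 0 0) p).mul (hasExp_w p))).pow k))
    have h2 := ev_isBigO h1.1 (k := k + 1) (fun i j hij => by
      rw [cf_sub, cf_const_mul, cf_linear_pow]
      split_ifs with h
      · rw [cf_leading_of_dvd hk hQA hAE j i h]; ring
      · rw [hk i j (by omega)]; ring)
    refine h2.congr' (h1.2.mono fun ζ h => ?_) .rfl
    rw [← h]
    simp
  · by_cases he : cf E 0 0 = 0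
    · exact .inl he
    · have hEe : HasExp E (fun z => ev E (z - p)) p := ⟨hE, .of_forall fun ζ => by simp⟩
      refine .inr ⟨he, fun z => ev E (z - p), by simp [ev_zero], hEe.continuousAt, ?_⟩
      have h1 := hQ.mul hEe
      rw [← hAE] at h1
      filter_upwards [ha, eventually_nhds_iff_add (P := fun z => q z * ev E (z - p) = a z) |>.1
        (h1.2.and hA.2 |>.mono fun ζ h => h.1.trans h.2.symm)] with z hz1 hz2
      rw [hz2, hz1]

end BiSeries

/-- The Jacobian determinant in the coordinates `z`, `z̄`. -/
noncomputable def wirtJac (f g : ℂ → ℂ) (p : ℂ) : ℂ :=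
  wirtZ f p * wirtW g p - wirtW f p * wirtZ g p

namespace BiSeries

theorem HasExp.wirtJac {c d : BiSeries} {f g : ℂ → ℂ} {p : ℂ} (h : HasExp c f p)
    (h' : HasExp d g p) : HasExp (jac c d) (wirtJac f g) p :=
  (h.wirtZ.mul h'.wirtW).sub (h.wirtW.mul h'.wirtZ)

theorem HasExp.eventuallyEq {c : BiSeries} {f g : ℂ → ℂ} {p : ℂ} (h : HasExp c f p)
    (h' : HasExp c g p) : f =ᶠ[𝓝 p] g :=
  eventually_nhds_iff_add.1 (h.2.and h'.2 |>.mono fun _ h => h.1.trans h.2.symm)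

theorem HasExp.conj_eq {c : BiSeries} {f : ℂ → ℂ} {p : ℂ} (h : HasExp c f p)
    (hc : ∀ i j, cf c j i = (starRingEnd ℂ) (cf c i j)) :
    ∀ᶠ q in 𝓝 p, (starRingEnd ℂ) (f q) = f q := by
  have h1 : swapConj c = c := ext_cf fun i j => by rw [swapConj, cf_ofCf, hc]; simp
  have h2 := h.conj
  rw [h1] at h2
  exact h2.eventuallyEq h

theorem dz_const (s : ℂ) : dz (const s) = 0 := by
  refine ext_cf fun i j => ?_
  rw [cf_dz, cf_const, cf_zero, if_neg (by omega), mul_zero]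

theorem dw_const (s : ℂ) : dw (const s) = 0 := by
  refine ext_cf fun i j => ?_
  rw [cf_dw, cf_const, cf_zero, if_neg (by omega), mul_zero]

theorem dz_sub_const (a : BiSeries) (s : ℂ) : dz (a - const s) = dz a := by
  rw [sub_eq_add_neg, ← map_neg, dz_add, dz_const, add_zero]

theorem dw_sub_const (a : BiSeries) (s : ℂ) : dw (a - const s) = dw a := by
  rw [sub_eq_add_neg, ← map_neg, dw_add, dw_const, add_zero]

/-- Where the trace and determinant of the Hessian of `U` are dependent and the trace-free part is
not identically zero, either the trace-free part has a leading form which is a power of a linear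
form, or `U` is radial up to an affine function. -/
theorem hasLocalForm_or_radial {U : ℂ → ℂ} {p : ℂ} (hU : AnalyticAt ℝ U p)
    (hreal : ∀ᶠ q in 𝓝 p, (starRingEnd ℂ) (U q) = U q)
    (hJ : ∀ᶠ q in 𝓝 p, wirtJac (wirtZ (wirtW U))
      (fun q => wirtZ (wirtZ U) q * wirtW (wirtW U) q) q = 0)
    (hQ : ¬ wirtZ (wirtZ U) =ᶠ[𝓝 p] 0) :
    HasLocalForm (wirtZ (wirtZ U)) p ∨
      ∃ c, HasExp c U p ∧ ∀ i j, 2 ≤ i + j → i ≠ j → cf c i j = 0 := by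
  obtain ⟨c, hc⟩ := exists_hasExp hU
  have hcr := hc.cf_conj hreal
  have hQ0 : dz (dz c) ≠ 0 := fun h => hQ (hc.wirtZ.wirtZ.eq_zero_iff.1 h)
  have hconj (i j : ℕ) : cf (dw (dw c)) i j = conj (cf (dz (dz c)) j i) := by
    simp only [cf_dw, cf_dz, map_mul, map_add, map_one, Complex.conj_natCast, ← hcr]
  have hQ0' : dw (dw c) ≠ 0 := by
    intro h
    refine hQ0 (ext_cf fun i j => ?_)
    have := hconj j i
    rw [h, cf_zero] at this
    rw [cf_zero, ← Complex.conj_conj (cf _ i j), ← this, map_zero]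
  have hJ1 : jac (dz (dw c)) (dz (dz c) * dw (dw c)) = 0 :=
    (hc.wirtW.wirtZ.wirtJac (hc.wirtZ.wirtZ.mul hc.wirtW.wirtW)).eq_zero_iff.2 hJ
  obtain ⟨k, hk⟩ : ∃ k, k = cf (dz (dw c)) 0 0 := ⟨_, rfl⟩
  have hmr (i j : ℕ) : cf (dz (dw c)) j i = conj (cf (dz (dw c)) i j) := by
    simp only [cf_dw, cf_dz, map_mul, map_add, map_one, Complex.conj_natCast, ← hcr]
    ring
  have hkr : conj k = k := by rw [hk, ← hmr]
  have hJ2 : jac (dz (dw c) - const k) (dz (dz c) * dw (dw c)) = 0 := by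
    rw [jac, dz_sub_const, dw_sub_const]; exact hJ1
  have hA0 : cf (dz (dw c) - const k) 0 0 = 0 := by
    rw [cf_sub, cf_const, if_pos ⟨rfl, rfl⟩, hk, sub_self]
  have hAr (i j : ℕ) : cf (dz (dw c) - const k) j i = conj (cf (dz (dw c) - const k) i j) := by
    rw [cf_sub, cf_sub, map_sub, ← hmr, cf_const, cf_const]
    split_ifs with h1 h2 h2
    · rw [hkr]
    · exact absurd h1.symm h2
    · exact absurd h2.symm h1
    · rw [map_zero]
  have hQA : dw (dz (dz c)) = dz (dz (dw c) - const k) := by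
    rw [dz_sub_const]
    simp only [dz_dw_comm]
  by_cases hw : w ∣ dz (dz c)
  · obtain ⟨n, s, h⟩ := exists_isRadialType hw hQ0 hQ0' hA0 hQA hJ2 hAr
    exact .inr ⟨c, hc, cf_eq_zero_of_isRadialType hcr hJ2 h⟩
  · obtain ⟨E, hE⟩ := dvd_of_jac_eq_zero hA0 hQA hQ0 hQ0' hJ2 dvd_rfl hw
    have hA := hc.wirtW.wirtZ.sub (hasExp_const k p)
    exact .inl (hasLocalForm_of_dvd hc.wirtZ.wirtZ hA hQ0 hQA hE (hA.conj_eq hAr))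

end BiSeries

theorem IsPreconnected.subset_of_disjoint_frontier {X : Type*} [TopologicalSpace X] {s t : Set X}
    (ht : IsPreconnected t) (hs : IsOpen s) (hne : (t ∩ s).Nonempty)
    (hd : ∀ x ∈ t, x ∉ frontier s) : t ⊆ s := by
  refine ht.subset_of_closure_inter_subset hs hne fun x hx => ?_
  by_contra h
  exact hd x hx.2 ⟨hx.1, by rwa [hs.interior_eq]⟩

/-- Every line through a point of a bounded open set meets the frontier on either side. -/
theorem exists_ray_mem_frontier {Ω : Set ℂ} (hΩ : IsOpen Ω) (hb : Bornology.IsBounded Ω) {x v : ℂ}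
    (hx : x ∈ Ω) (hv : v ≠ 0) : ∃ t : ℝ, 0 ≤ t ∧ x + t * v ∈ frontier Ω := by
  by_contra! h
  have hsub : (fun t : ℝ => x + t * v) '' Ici 0 ⊆ Ω := by
    refine (isPreconnected_Ici.image _ (by fun_prop)).subset_of_disjoint_frontier hΩ
      ⟨x, ⟨0, by simp, by simp⟩, hx⟩ ?_
    rintro _ ⟨t, ht, rfl⟩
    exact h t ht
  obtain ⟨R, hR⟩ := hb.exists_norm_le
  have h0 : 0 < ‖v‖ := norm_pos_iff.2 hv
  have hR0 : 0 ≤ R := (norm_nonneg x).trans (hR x hx)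
  have h1 := hR _ (hsub ⟨(2 * R + 1) / ‖v‖, by simp; positivity, rfl⟩)
  have h2 : ‖(((2 * R + 1) / ‖v‖ : ℝ) : ℂ) * v‖ = 2 * R + 1 := by
    rw [norm_mul, Complex.norm_real, Real.norm_of_nonneg (by positivity)]
    field_simp
  have h3 := norm_sub_le (x + (((2 * R + 1) / ‖v‖ : ℝ) : ℂ) * v) x
  rw [add_sub_cancel_left, h2] at h3
  have h4 := hR x hx
  simp only at h1
  linarith

/-- A bounded domain whose frontier lies on a circle is a disk. -/
theorem eq_ball_of_frontier_subset_sphere {Ω : Set ℂ} (hΩ : IsOpen Ω) (hne : Ω.Nonempty)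
    (hb : Bornology.IsBounded Ω) {p : ℂ} {r : ℝ} (hr : 0 ≤ r)
    (hf : ∀ z ∈ frontier Ω, ‖z - p‖ = r) : 0 < r ∧ Ω = ball p r := by
  have h1 : Ω ⊆ closedBall p r := by
    intro x hx
    rw [mem_closedBall, dist_eq_norm]
    by_contra! hlt
    obtain ⟨t, ht, hmem⟩ := exists_ray_mem_frontier hΩ hb hx (v := x - p)
      (norm_pos_iff.1 (hr.trans_lt hlt))
    have h2 := hf _ hmem
    rw [show x + t * (x - p) - p = ((1 + t : ℝ) : ℂ) * (x - p) by push_cast; ring, norm_mul,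
      Complex.norm_real, Real.norm_of_nonneg (by positivity)] at h2
    nlinarith
  have h2 : Ω ⊆ interior (closedBall p r) := interior_maximal h1 hΩ
  obtain ⟨x, hx⟩ := hne
  have hr0 : 0 < r := by
    refine lt_of_le_of_ne hr fun h0 => ?_
    have := h2 hx
    rw [← h0, closedBall_zero, interior_singleton] at this
    exact this
  rw [interior_closedBall _ hr0.ne'] at h2
  refine ⟨hr0, h2.antisymm ?_⟩
  refine (convex_ball p r).isPreconnected.subset_of_disjoint_frontier hΩ ⟨x, h2 hx, hx⟩ ?_
  intro z hz hzf
  rw [mem_ball, dist_eq_norm, hf z hzf] at hz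
  exact lt_irrefl _ hz

theorem hasDerivAt_comp_wirt {f : ℂ → ℂ} {γ : ℝ → ℂ} {γ' : ℂ} {s : ℝ}
    (hf : DifferentiableAt ℝ f (γ s)) (hγ : HasDerivAt γ γ' s) :
    HasDerivAt (fun s => f (γ s)) (wirtZ f (γ s) * γ' + wirtW f (γ s) * conj γ') s := by
  rw [← fderiv_eq_wirt]
  exact hf.hasFDerivAt.comp_hasDerivAt s hγ

theorem wirt_real {U : ℂ → ℂ} {p : ℂ} (hU : AnalyticAt ℝ U p)
    (hreal : ∀ᶠ q in 𝓝 p, conj (U q) = U q) :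
    wirtW U p = conj (wirtZ U p) ∧ wirtW (wirtW U) p = conj (wirtZ (wirtZ U) p) ∧
      conj (wirtW (wirtZ U) p) = wirtW (wirtZ U) p := by
  obtain ⟨c, hc⟩ := BiSeries.exists_hasExp hU
  have hcr := hc.cf_conj hreal
  rw [← hc.wirtW.cf_zero, ← hc.wirtZ.cf_zero, ← hc.wirtW.wirtW.cf_zero, ← hc.wirtZ.wirtZ.cf_zero,
    ← hc.wirtZ.wirtW.cf_zero]
  simp only [BiSeries.cf_dw, BiSeries.cf_dz, map_mul, map_add, map_one, Complex.conj_natCast, ← hcr,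
    and_self]

/-- The overdetermined boundary conditions force the trace-free Hessian to be diagonal in the frame
of the curve. -/
theorem conj_mul_deriv_sq_of_overdetermined {U : ℂ → ℂ} {γ : ℝ → ℂ} {c : ℝ}
    (hγ : Differentiable ℝ γ) (hγ0 : ∀ s, deriv γ s ≠ 0) (hU : ∀ s, AnalyticAt ℝ U (γ s))
    (hreal : ∀ q, conj (U q) = U q) (h0 : ∀ s, U (γ s) = 0) (h1 : ∀ s, ‖wirtZ U (γ s)‖ = c) (s : ℝ) :
    conj (wirtZ (wirtZ U) (γ s) * deriv γ s ^ 2) = wirtZ (wirtZ U) (γ s) * deriv γ s ^ 2 := by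
  obtain ⟨e1, -, e3⟩ := wirt_real (hU s) (.of_forall hreal)
  have hd := (hγ s).hasDerivAt
  have d1 := hasDerivAt_comp_wirt (hU s).differentiableAt hd
  have hZ : AnalyticAt ℝ (wirtZ U) (γ s) := by
    obtain ⟨O, hO, hsO⟩ := (hU s).exists_mem_nhds_analyticOnNhd
    exact hsO.wirtZ _ (mem_of_mem_nhds hO)
  have d2 := hasDerivAt_comp_wirt hZ.differentiableAt hd
  simp only [h0] at d1
  have f1 := d1.unique (hasDerivAt_const s (0 : ℂ))
  rw [e1] at f1
  obtain ⟨P, hP⟩ : ∃ P, P = wirtZ U (γ s) := ⟨_, rfl⟩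
  obtain ⟨Q, hQ⟩ : ∃ Q, Q = wirtZ (wirtZ U) (γ s) := ⟨_, rfl⟩
  obtain ⟨A, hA⟩ : ∃ A, A = wirtW (wirtZ U) (γ s) := ⟨_, rfl⟩
  obtain ⟨τ, hτ⟩ : ∃ τ, τ = deriv γ s := ⟨_, rfl⟩
  have hτ0 : τ ≠ 0 := hτ ▸ hγ0 s
  rw [← hQ, ← hτ]
  rw [← hP, ← hτ] at f1
  rw [← hQ, ← hA, ← hτ] at d2
  rw [← hA] at e3
  by_cases hP0 : P = 0
  · have hc0 : c = 0 := by rw [← h1 s, ← hP, hP0, norm_zero]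
    have hz (s : ℝ) : wirtZ U (γ s) = 0 := norm_eq_zero.1 ((h1 s).trans hc0)
    simp only [hz] at d2
    have f2 := d2.unique (hasDerivAt_const s (0 : ℂ))
    have f3 : Q * τ ^ 2 = -(A * (τ * conj τ)) := by linear_combination τ * f2
    rw [f3]
    simp only [map_neg, map_mul, Complex.conj_conj, e3]
    ring
  · have d3 := d2.mul (d2.star)
    have hz (s : ℝ) : wirtZ U (γ s) * star (wirtZ U (γ s)) = (c : ℂ) ^ 2 := by
      rw [← h1 s]; exact Complex.mul_conj' _
    have d4 := d3.congr_of_eventuallyEq (f₁ := fun _ : ℝ => (c : ℂ) ^ 2)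
      (.of_forall fun t => (hz t).symm)
    have f2 := d4.unique (hasDerivAt_const s _)
    rw [← hP] at f2
    simp only [Complex.star_def, map_add, map_mul, Complex.conj_conj, e3] at f2
    have hP0' : conj P ≠ 0 := (map_ne_zero _).2 hP0
    have hτ0' : conj τ ≠ 0 := (map_ne_zero _).2 hτ0
    refine mul_left_cancel₀ (mul_ne_zero hP0' hτ0') ?_
    simp only [map_mul, map_pow]
    linear_combination -(τ * conj τ) * f2 + (A * τ * conj τ + conj Q * conj τ ^ 2) * f1

/-- A function annihilated by the angular derivative about `p` is constant on arcs about `p`. -/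
theorem eq_of_angular_deriv_eq_zero {V : Set ℂ} {f : ℂ → ℂ} {p ζ : ℂ}
    (hf : ∀ z ∈ V, DifferentiableAt ℝ f z)
    (hrot : ∀ z ∈ V, (z - p) * wirtZ f z = conj (z - p) * wirtW f z) {S : Set ℝ} (hS : IsOpen S)
    (hS' : IsPreconnected S) (hSV : ∀ θ ∈ S, p + Complex.exp (θ * Complex.I) * ζ ∈ V) {a b : ℝ}
    (ha : a ∈ S) (hb : b ∈ S) :
    f (p + Complex.exp (a * Complex.I) * ζ) = f (p + Complex.exp (b * Complex.I) * ζ) := by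
  have hd (θ : ℝ) (hθ : θ ∈ S) :
      HasDerivAt (fun θ : ℝ => f (p + Complex.exp (θ * Complex.I) * ζ)) 0 θ := by
    have h1 : HasDerivAt (fun θ : ℝ => p + Complex.exp (θ * Complex.I) * ζ)
        (Complex.exp (θ * Complex.I) * Complex.I * ζ) θ := by
      have h2 := (((Complex.ofRealCLM.hasDerivAt (x := θ)).mul_const Complex.I).cexp.mul_const
        ζ).const_add p
      simpa using h2
    have h3 := hasDerivAt_comp_wirt (γ := fun θ : ℝ => p + Complex.exp (θ * Complex.I) * ζ)
      (hf _ (hSV θ hθ)) h1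
    convert h3 using 1
    have h4 := hrot _ (hSV θ hθ)
    rw [add_sub_cancel_left] at h4
    rw [map_mul, map_mul, Complex.conj_I]
    rw [map_mul] at h4
    linear_combination -Complex.I * h4
  exact hS.is_const_of_deriv_eq_zero hS' (fun θ hθ => (hd θ hθ).differentiableAt.differentiableWithinAt)
    (fun θ hθ => (hd θ hθ).deriv) ha hb

/-- A rotationally invariant function vanishing on an arc transverse to the circles vanishes near
that arc. -/
theorem eventually_eq_zero_of_transverse {V : Set ℂ} (hV : IsOpen V) {f : ℂ → ℂ} {p : ℂ}
    (hf : ∀ z ∈ V, DifferentiableAt ℝ f z)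
    (hrot : ∀ z ∈ V, (z - p) * wirtZ f z = conj (z - p) * wirtW f z) {γ : ℝ → ℂ}
    (hγ : ContDiff ℝ 1 γ) {s : ℝ} (hs : γ s ∈ V) (h0 : ∀ᶠ t in 𝓝 s, f (γ t) = 0)
    (htr : (conj (γ s - p) * deriv γ s).re ≠ 0) : f =ᶠ[𝓝 (γ s)] 0 := by
  obtain ⟨Φ, hΦ⟩ : ∃ Φ : ℝ × ℝ → ℂ, Φ = fun x => p + Complex.exp (x.2 * Complex.I) * (γ x.1 - p) :=
    ⟨_, rfl⟩
  have hΦc : ContDiff ℝ 1 Φ := by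
    rw [hΦ]
    have e1 : ContDiff ℝ 1 fun x : ℝ × ℝ => (x.2 : ℂ) := Complex.ofRealCLM.contDiff.comp contDiff_snd
    have e2 : ContDiff ℝ 1 fun x : ℝ × ℝ => γ x.1 := hγ.comp contDiff_fst
    exact contDiff_const.add ((e1.mul contDiff_const).cexp.mul (e2.sub contDiff_const))
  have hΦs : Φ (s, 0) = γ s := by simp [hΦ]
  have hst := hΦc.contDiffAt.hasStrictFDerivAt (x := (s, (0 : ℝ))) (by norm_num)
  have d1 : fderiv ℝ Φ (s, 0) (1, 0) = deriv γ s := by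
    have h1 : HasDerivAt (fun t : ℝ => (t, (0 : ℝ))) ((1 : ℝ), (0 : ℝ)) s :=
      (hasDerivAt_id s).prodMk (hasDerivAt_const s 0)
    have h2 := hst.hasFDerivAt.comp_hasDerivAt s h1
    refine h2.unique ?_
    have h3 : Φ ∘ (fun t : ℝ => (t, (0 : ℝ))) = γ := by ext t; simp [hΦ]
    rw [h3]
    exact ((hγ.differentiable (by norm_num)) s).hasDerivAt
  have d2 : fderiv ℝ Φ (s, 0) (0, 1) = Complex.I * (γ s - p) := by
    have h1 : HasDerivAt (fun t : ℝ => (s, t)) ((0 : ℝ), (1 : ℝ)) 0 :=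
      (hasDerivAt_const 0 s).prodMk (hasDerivAt_id 0)
    have h2 := HasFDerivAt.comp_hasDerivAt (0 : ℝ) (f := fun t : ℝ => (s, t)) hst.hasFDerivAt h1
    refine h2.unique ?_
    have h3 : HasDerivAt (fun θ : ℝ => p + Complex.exp (θ * Complex.I) * (γ s - p))
        (Complex.exp ((0 : ℝ) * Complex.I) * Complex.I * (γ s - p)) 0 := by
      have h2 := (((Complex.ofRealCLM.hasDerivAt (x := (0 : ℝ))).mul_const Complex.I).cexp.mul_const
        (γ s - p)).const_add p
      simpa using h2
    simpa [hΦ, Function.comp_def] using h3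
  have hζ : γ s - p ≠ 0 := by
    intro h
    rw [h] at htr
    simp at htr
  have hζ' : conj (γ s - p) ≠ 0 := (map_ne_zero _).2 hζ
  have hsurj : (fderiv ℝ Φ (s, 0)).range = ⊤ := by
    rw [LinearMap.range_eq_top]
    intro η
    obtain ⟨a, ha⟩ : ∃ a : ℝ, a * (conj (γ s - p) * deriv γ s).re = (conj (γ s - p) * η).re :=
      ⟨_, div_mul_cancel₀ _ htr⟩
    have hn : Complex.normSq (γ s - p) ≠ 0 := by simpa [Complex.normSq_eq_zero] using hζ
    obtain ⟨b, hb⟩ : ∃ b : ℝ, b * Complex.normSq (γ s - p) =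
        (conj (γ s - p) * η).im - a * (conj (γ s - p) * deriv γ s).im := ⟨_, div_mul_cancel₀ _ hn⟩
    refine ⟨(a, b), ?_⟩
    have h1 : ((a, b) : ℝ × ℝ) = a • ((1 : ℝ), (0 : ℝ)) + b • ((0 : ℝ), (1 : ℝ)) := by simp
    rw [h1, ContinuousLinearMap.coe_coe, map_add, map_smul, map_smul, d1, d2]
    refine mul_left_cancel₀ hζ' ?_
    rw [Complex.real_smul, Complex.real_smul, mul_add,
      show conj (γ s - p) * (b * (Complex.I * (γ s - p))) =
        ((b * Complex.normSq (γ s - p) : ℝ) : ℂ) * Complex.I by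
          push_cast
          rw [Complex.normSq_eq_conj_mul_self]; ring, hb, mul_left_comm]
    apply Complex.ext
    · simp only [Complex.add_re, Complex.re_ofReal_mul, Complex.I_re, mul_zero, add_zero]
      exact ha
    · simp only [Complex.add_im, Complex.im_ofReal_mul, Complex.I_im, mul_one]
      ring
  have hmap := hst.map_nhds_eq_of_surj hsurj
  rw [hΦs] at hmap
  rw [Filter.EventuallyEq, ← hmap, Filter.eventually_map]
  have hev : ∀ᶠ x in 𝓝 (s, (0 : ℝ)), Φ x ∈ V ∧ f (γ x.1) = 0 :=
    (hΦc.continuous.continuousAt.eventually (by rw [hΦs]; exact hV.mem_nhds hs)).and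
      ((continuous_fst.tendsto (s, (0 : ℝ))).eventually h0)
  obtain ⟨ε, hε, hball⟩ := Metric.eventually_nhds_iff_ball.1 hev
  refine Metric.eventually_nhds_iff_ball.2 ⟨ε, hε, ?_⟩
  rintro ⟨t, θ⟩ hx
  rw [← ball_prod_same, mem_prod] at hx
  have key := eq_of_angular_deriv_eq_zero hf hrot (ζ := γ t - p) isOpen_ball
    (convex_ball (0 : ℝ) ε).isPreconnected (fun θ hθ => by
      have := (hball (t, θ) (by rw [← ball_prod_same]; exact ⟨hx.1, hθ⟩)).1
      rwa [hΦ] at this) hx.2 (mem_ball_self hε)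
  have h1 := (hball (t, θ) (by rw [← ball_prod_same]; exact hx)).2
  simp only [Complex.ofReal_zero, zero_mul, Complex.exp_zero, one_mul, add_sub_cancel] at key
  rw [hΦ]
  simpa [h1] using key

/-- A closed curve whose tangent is everywhere radial or angular about `p` is a circle. -/
theorem IsRegularLoop.norm_sub_eq_of_re_mul_im {γ : ℝ → ℂ} (h : IsRegularLoop γ) {p : ℂ}
    (hp : ∀ s, (conj (γ s - p) * deriv γ s).re = 0 ∨ (conj (γ s - p) * deriv γ s).im = 0) :
    ∃ r, 0 ≤ r ∧ ∀ s, ‖γ s - p‖ = r := by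
  obtain ⟨a, ha⟩ : ∃ a, ∀ s ∈ Ioo a (a + 1), γ s ≠ p := by
    by_cases hr : ∃ a, γ a = p
    · obtain ⟨a, rfl⟩ := hr
      refine ⟨a, fun s hs hsa => ?_⟩
      obtain ⟨n, rfl⟩ := h.eq_iff.1 hsa
      have h1 : (0 : ℝ) < n := by linarith [hs.1]
      have h2 : (n : ℝ) < 1 := by linarith [hs.2]
      norm_cast at h1 h2
      omega
    · exact ⟨0, fun s _ hs => hr ⟨s, hs⟩⟩
  obtain ⟨g, hg⟩ : ∃ g : ℝ → ℝ, g = fun s => Complex.normSq (γ s - p) := ⟨_, rfl⟩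
  have hgd (s : ℝ) : HasDerivAt g (2 * (conj (γ s - p) * deriv γ s).re) s := by
    have h1 := ((h.differentiable s).hasDerivAt.sub_const p)
    have h2 := (Complex.reCLM.hasFDerivAt.comp_hasDerivAt s h1)
    have h3 := (Complex.imCLM.hasFDerivAt.comp_hasDerivAt s h1)
    have h4 := (h2.mul h2).add (h3.mul h3)
    rw [hg]
    refine HasDerivAt.congr_deriv (f := fun s => Complex.normSq (γ s - p)) h4 ?_
    simp only [Function.comp, Complex.reCLM_apply, Complex.imCLM_apply, Complex.mul_re,
      Complex.conj_re, Complex.conj_im]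
    ring
  have hgc : Continuous g := continuous_iff_continuousAt.2 fun s => (hgd s).continuousAt
  have hper (s : ℝ) : g (s + 1) = g s := by rw [hg]; simp only [h.periodic]
  obtain ⟨b, hb, hb0⟩ := exists_hasDerivAt_eq_zero (lt_add_one a) hgc.continuousOn (hper a).symm
    fun s _ => hgd s
  have hre : ∀ s ∈ Ioo a (a + 1), (conj (γ s - p) * deriv γ s).re = 0 := by
    obtain ⟨φ, hφ⟩ : ∃ φ : ℝ → ℂ, φ = fun s => conj (γ s - p) * deriv γ s := ⟨_, rfl⟩
    have hφc : Continuous φ := by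
      have := h.continuous
      have := h.continuous_deriv
      rw [hφ]
      fun_prop
    have hφ0 : ∀ s ∈ Ioo a (a + 1), φ s ≠ 0 := fun s hs => by
      rw [hφ]
      exact mul_ne_zero ((map_ne_zero _).2 (sub_ne_zero.2 (ha s hs))) (h.deriv_ne s)
    intro s hs
    by_contra hne
    have him : (φ s).im = 0 := by
      have := (hp s).resolve_left hne
      rwa [hφ]
    have hreb : (φ b).re = 0 := by rw [hφ]; linarith
    have himb : (φ b).im ≠ 0 := fun h0 => hφ0 b hb (Complex.ext hreb h0)
    have hcont : ContinuousOn (fun s => (φ s).re ^ 2 - (φ s).im ^ 2) (Ioo a (a + 1)) := by fun_prop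
    obtain ⟨t, ht, ht0⟩ := isPreconnected_Ioo.intermediate_value hb hs hcont
      (show (0 : ℝ) ∈ Icc _ _ by
        rw [hreb, him]
        exact ⟨by nlinarith [sq_nonneg (φ b).im], by nlinarith [sq_nonneg (φ s).re]⟩)
    refine hφ0 t ht ?_
    have h2 := hp t
    simp only [hφ] at ht0
    rw [hφ]
    rcases h2 with h2 | h2
    · rw [h2] at ht0
      exact Complex.ext h2 (by simpa using ht0)
    · rw [h2] at ht0
      exact Complex.ext (by simpa using ht0) h2
  have hre' : Icc a (a + 1) ⊆ {s | (conj (γ s - p) * deriv γ s).re = 0} := by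
    rw [← closure_Ioo (lt_add_one a).ne]
    have := h.continuous
    have := h.continuous_deriv
    exact closure_minimal hre (isClosed_eq (by fun_prop) continuous_const)
  have hconst : ∀ s ∈ Icc a (a + 1), g s = g a :=
    constant_of_has_deriv_right_zero hgc.continuousOn fun s hs => by
      have := hgd s
      rw [hre' (Ico_subset_Icc_self hs), mul_zero] at this
      exact this.hasDerivWithinAt
  refine ⟨√(g a), Real.sqrt_nonneg _, fun s => ?_⟩
  obtain ⟨t, ht, hts⟩ : ∃ t ∈ Ico a (a + 1), γ s = γ t :=
    (show Function.Periodic γ 1 from h.periodic).exists_mem_Ico one_pos s a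
  rw [hts, ← hconst t (Ico_subset_Icc_self ht), hg]
  simp [Complex.normSq_eq_norm_sq]

theorem BiSeries.HasExp.eqOn {c : BiSeries} {f g : ℂ → ℂ} {p : ℂ} {V : Set ℂ}
    (hV : IsPreconnected V)
    (hp : p ∈ V) (hf : AnalyticOnNhd ℝ f V) (hg : AnalyticOnNhd ℝ g V) (h : HasExp c f p)
    (h' : HasExp c g p) : EqOn f g V :=
  hf.eqOn_of_preconnected_of_eventuallyEq hg hV hp (h.eventuallyEq h')

theorem analyticOnNhd_sub_const (p : ℂ) (V : Set ℂ) : AnalyticOnNhd ℝ (fun z : ℂ => z - p) V :=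
  fun _ _ => analyticAt_id.sub analyticAt_const

theorem analyticOnNhd_conj_sub_const (p : ℂ) (V : Set ℂ) :
    AnalyticOnNhd ℝ (fun z : ℂ => conj (z - p)) V := fun z hz =>
  ((Complex.conjCLE : ℂ →L[ℝ] ℂ).analyticAt _).comp (analyticOnNhd_sub_const p V z hz)

/-- The overdetermined problem when `U` is radial about `p` up to an affine function. -/
theorem ball_of_radial {Ω V : Set ℂ} (hΩ : IsOpen Ω) (hne : Ω.Nonempty)
    (hb : Bornology.IsBounded Ω) {γ : ℝ → ℂ} (hγ : IsRegularLoop γ) (hfr : frontier Ω = range γ)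
    (hV : IsOpen V) (hVc : IsPreconnected V) (hΩV : closure Ω ⊆ V) {U : ℂ → ℂ}
    (hU : AnalyticOnNhd ℝ U V) (hreal : ∀ q, conj (U q) = U q) (h0 : ∀ s, U (γ s) = 0)
    (htan : ∀ s, conj (wirtZ (wirtZ U) (γ s) * deriv γ s ^ 2) =
      wirtZ (wirtZ U) (γ s) * deriv γ s ^ 2)
    (hQ : ∀ p ∈ V, ¬ wirtZ (wirtZ U) =ᶠ[𝓝 p] 0) {p : ℂ} (hp : p ∈ V) {c : BiSeries}
    (hc : BiSeries.HasExp c U p)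
    (hvan : ∀ i j, 2 ≤ i + j → i ≠ j → BiSeries.cf c i j = 0) :
    ∃ r, 0 < r ∧ Ω = ball p r ∧
      ∀ q₁ ∈ closure Ω, ∀ q₂ ∈ closure Ω, ‖q₁ - p‖ = ‖q₂ - p‖ → U q₁ = U q₂ := by
  have hγV (s : ℝ) : γ s ∈ V := hΩV (frontier_subset_closure (hfr ▸ mem_range_self s))
  have aZ := analyticOnNhd_sub_const p V
  have aW := analyticOnNhd_conj_sub_const p V
  obtain ⟨h, hh⟩ : ∃ h : ℂ → ℂ, h = fun z => (z - p) ^ 2 * wirtZ (wirtZ U) z := ⟨_, rfl⟩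
  have hha : AnalyticOnNhd ℝ h V := by rw [hh]; exact (aZ.pow 2).mul hU.wirtZ.wirtZ
  have hhe : BiSeries.HasExp (BiSeries.z ^ 2 * BiSeries.dz (BiSeries.dz c)) h p := by
    rw [hh]; exact ((BiSeries.hasExp_z p).pow 2).mul hc.wirtZ.wirtZ
  have hhr : ∀ z ∈ V, (z - p) * wirtZ h z = conj (z - p) * wirtW h z := by
    refine BiSeries.HasExp.eqOn hVc hp (aZ.mul hha.wirtZ) (aW.mul hha.wirtW)
      ((BiSeries.hasExp_z p).mul hhe.wirtZ) ?_
    have e : BiSeries.rot (BiSeries.z ^ 2 * BiSeries.dz (BiSeries.dz c)) = 0 := by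
      refine BiSeries.ext_cf fun i j => ?_
      rw [BiSeries.cf_rot, BiSeries.cf_zero]
      rcases eq_or_ne i j with rfl | hij
      · simp
      rcases i with _ | _ | i
      · simp [pow_two, mul_assoc]
      · simp [pow_two, mul_assoc]
      · simp [pow_two, mul_assoc, hvan (i + 2) j (by omega) hij]
    rw [BiSeries.rot, sub_eq_zero] at e
    rw [e]
    exact (BiSeries.hasExp_w p).mul hhe.wirtW
  have hhc : ∀ z ∈ V, conj (h z) = h z := by
    have e1 : ∀ z ∈ V, h z = conj (z - p) ^ 2 * wirtW (wirtW U) z := by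
      refine BiSeries.HasExp.eqOn hVc hp hha ((aW.pow 2).mul hU.wirtW.wirtW) hhe ?_
      have e : BiSeries.z ^ 2 * BiSeries.dz (BiSeries.dz c) =
          BiSeries.w ^ 2 * BiSeries.dw (BiSeries.dw c) := by
        refine BiSeries.ext_cf fun i j => ?_
        rcases i with _ | _ | i <;> rcases j with _ | _ | j <;> simp [pow_two, mul_assoc]
        · exact .inr (.inr (hvan _ _ (by omega) (by omega)))
        · exact .inr (.inr (hvan _ _ (by omega) (by omega)))
        · exact .inr (.inr (hvan _ _ (by omega) (by omega)))
        · exact .inr (.inr (hvan _ _ (by omega) (by omega)))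
        · rcases eq_or_ne i j with rfl | hij
          · ring
          · rw [hvan (i + 1 + 1) (j + 1 + 1) (by omega) (by omega)]; ring
      rw [e]
      exact ((BiSeries.hasExp_w p).pow 2).mul hc.wirtW.wirtW
    intro z hz
    have e2 := e1 z hz
    rw [(wirt_real (hU z hz) (.of_forall hreal)).2.1] at e2
    conv_rhs => rw [e2]
    rw [hh]
    simp
  have hdir (s : ℝ) :
      (conj (γ s - p) * deriv γ s).re = 0 ∨ (conj (γ s - p) * deriv γ s).im = 0 := by
    by_contra! hcon
    have hcγ := hγ.continuous
    have hcγ' := hγ.continuous_deriv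
    have hφ : Continuous fun s => conj (γ s - p) * deriv γ s := by fun_prop
    have hz : ∀ᶠ t in 𝓝 s, h (γ t) = 0 := by
      filter_upwards [(Complex.continuous_re.comp hφ).continuousAt.eventually_ne hcon.1,
        (Complex.continuous_im.comp hφ).continuousAt.eventually_ne hcon.2] with t h1 h2
      obtain ⟨M, hM⟩ : ∃ M, M = conj (γ t - p) * deriv γ t := ⟨_, rfl⟩
      simp only [Function.comp, ← hM] at h1 h2
      have e1 : h (γ t) * M ^ 2 = ((γ t - p) * conj (γ t - p)) ^ 2 *
          (wirtZ (wirtZ U) (γ t) * deriv γ t ^ 2) := by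
        rw [hh, hM]; ring
      have e2 := congrArg conj e1
      rw [map_mul, map_mul, htan, hhc _ (hγV t), map_pow, map_pow, map_mul, Complex.conj_conj,
        mul_comm (conj (γ t - p)), ← e1] at e2
      refine (mul_left_cancel₀ · e2).mt ?_ |> not_not.1
      intro e3
      have e4 := congrArg Complex.im e3
      simp only [pow_two, Complex.mul_im, Complex.conj_re, Complex.conj_im] at e4
      exact mul_ne_zero h1 h2 (by linarith)
    have h1 := eventually_eq_zero_of_transverse hV (fun z hz => (hha z hz).differentiableAt) hhr
      (hγ.contDiff.of_le (by norm_num)) (hγV s) hz hcon.1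
    have hne : γ s ≠ p := by
      intro h
      rw [h] at hcon
      simp at hcon
    refine hQ _ (hγV s) ?_
    filter_upwards [h1, eventually_ne_nhds hne] with z hz1 hz2
    rw [hh] at hz1
    exact (mul_eq_zero.1 hz1).resolve_left (pow_ne_zero 2 (sub_ne_zero.2 hz2))
  obtain ⟨r, hr, hrγ⟩ := hγ.norm_sub_eq_of_re_mul_im hdir
  obtain ⟨hr0, hball⟩ := eq_ball_of_frontier_subset_sphere hΩ hne hb hr (p := p) (by
    rw [hfr]
    rintro _ ⟨s, rfl⟩
    exact hrγ s)
  have hcl : closure Ω = closedBall p r := by rw [hball, closure_ball _ hr0.ne']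
  have hsph : ∀ z, ‖z - p‖ = r → U z = 0 := by
    intro z hz
    have : z ∈ range γ := by
      rw [← hfr, hball, frontier_ball _ hr0.ne', mem_sphere, dist_eq_norm, hz]
    obtain ⟨s, rfl⟩ := this
    exact h0 s
  obtain ⟨b, hb⟩ : ∃ b, b = BiSeries.cf c 1 0 := ⟨_, rfl⟩
  have hb' : BiSeries.cf c 0 1 = conj b := by rw [hb, hc.cf_conj (.of_forall hreal)]
  have hT : ∀ z ∈ V, (z - p) * wirtZ U z - conj (z - p) * wirtW U z =
      b * (z - p) - conj b * conj (z - p) := by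
    refine BiSeries.HasExp.eqOn hVc hp ((aZ.mul hU.wirtZ).sub (aW.mul hU.wirtW))
      ((analyticOnNhd_const.mul aZ).sub (analyticOnNhd_const.mul aW))
      (((BiSeries.hasExp_z p).mul hc.wirtZ).sub ((BiSeries.hasExp_w p).mul hc.wirtW)) ?_
    have e : BiSeries.rot c = BiSeries.const b * BiSeries.z - BiSeries.const (conj b) * BiSeries.w := by
      refine BiSeries.ext_cf fun i j => ?_
      rw [BiSeries.cf_rot, BiSeries.cf_sub, BiSeries.cf_const_mul, BiSeries.cf_const_mul,
        BiSeries.cf_z, BiSeries.cf_w]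
      by_cases h1 : i = 1 ∧ j = 0
      · obtain ⟨rfl, rfl⟩ := h1
        simp [hb]
      by_cases h2 : i = 0 ∧ j = 1
      · obtain ⟨rfl, rfl⟩ := h2
        simp [hb']
      rw [if_neg h1, if_neg h2]
      rcases eq_or_ne i j with rfl | hij
      · simp
      · rw [hvan i j (by omega) hij]; simp
    rw [BiSeries.rot] at e
    rw [e]
    exact ((BiSeries.hasExp_const b p).mul (BiSeries.hasExp_z p)).sub
      ((BiSeries.hasExp_const (conj b) p).mul (BiSeries.hasExp_w p))
  have hb0 : b = 0 := by
    have key (ζ : ℂ) (hζ : ‖ζ‖ = r) : b * ζ = conj b * conj ζ := by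
      have hV' : p + ζ ∈ V := hΩV (by rw [hcl, mem_closedBall, dist_eq_norm]; simp [hζ])
      have h1 : HasDerivAt (fun θ : ℝ => p + Complex.exp (θ * Complex.I) * ζ)
          (Complex.exp ((0 : ℝ) * Complex.I) * Complex.I * ζ) 0 := by
        have h2 := (((Complex.ofRealCLM.hasDerivAt (x := (0 : ℝ))).mul_const Complex.I).cexp.mul_const
          ζ).const_add p
        simpa using h2
      have h3 := hasDerivAt_comp_wirt (f := U) (by simpa using (hU _ hV').differentiableAt) h1
      have h4 (θ : ℝ) : U (p + Complex.exp (θ * Complex.I) * ζ) = 0 := hsph _ (by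
        rw [add_sub_cancel_left, norm_mul, Complex.norm_exp_ofReal_mul_I, one_mul, hζ])
      simp only [h4] at h3
      have h5 := h3.unique (hasDerivAt_const _ _)
      simp only [Complex.ofReal_zero, zero_mul, Complex.exp_zero, one_mul, map_mul,
        Complex.conj_I] at h5
      have h6 := hT _ hV'
      rw [add_sub_cancel_left] at h6
      refine mul_left_cancel₀ Complex.I_ne_zero ?_
      linear_combination h5 - Complex.I * h6
    have hrc : (r : ℂ) ≠ 0 := by exact_mod_cast hr0.ne'
    have k1 := key r (by simp [hr])
    have k2 := key (r * Complex.I) (by simp [hr])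
    rw [map_mul, Complex.conj_ofReal, Complex.conj_I] at k2
    rw [Complex.conj_ofReal] at k1
    have : b * (2 * r * Complex.I) = 0 := by linear_combination k2 + Complex.I * k1
    simpa [hrc] using this
  refine ⟨r, hr0, hball, fun q₁ hq₁ q₂ hq₂ hq => ?_⟩
  rcases eq_or_ne q₁ p with rfl | hne₁
  · rw [sub_self, norm_zero, eq_comm, norm_eq_zero, sub_eq_zero] at hq
    rw [hq]
  have hne₁' : q₁ - p ≠ 0 := sub_ne_zero.2 hne₁
  obtain ⟨θ, hθ⟩ := (Complex.norm_eq_one_iff ((q₂ - p) / (q₁ - p))).1 (by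
    rw [norm_div, hq, div_self]
    rw [← hq]; exact norm_ne_zero_iff.2 hne₁')
  have key := eq_of_angular_deriv_eq_zero (V := V) (f := U) (p := p) (ζ := q₁ - p)
    (fun z hz => (hU z hz).differentiableAt)
    (fun z hz => by have := hT z hz; rw [hb0] at this; simpa [sub_eq_zero] using this) isOpen_univ
    isPreconnected_univ (fun θ _ => hΩV (by
      rw [hcl, mem_closedBall, dist_eq_norm, add_sub_cancel_left, norm_mul,
        Complex.norm_exp_ofReal_mul_I, one_mul, ← dist_eq_norm, ← mem_closedBall, ← hcl]
      exact hq₁)) (mem_univ 0) (mem_univ θ)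
  rw [hθ, div_mul_cancel₀ _ hne₁'] at key
  simpa using key

/-- The overdetermined problem when the Hessian of `U` is everywhere a multiple of the identity. -/
theorem ball_of_umbilic {Ω V : Set ℂ} (hΩ : IsOpen Ω) (hne : Ω.Nonempty)
    (hb : Bornology.IsBounded Ω) {γ : ℝ → ℂ} (hfr : frontier Ω = range γ)
    (hVc : IsPreconnected V) (hΩV : closure Ω ⊆ V) {U : ℂ → ℂ}
    (hU : AnalyticOnNhd ℝ U V) (hreal : ∀ q, conj (U q) = U q) (h0 : ∀ s, U (γ s) = 0)
    (hnz : ∃ q ∈ closure Ω, U q ≠ 0) {p : ℂ} (hp : p ∈ V) (hQ : wirtZ (wirtZ U) =ᶠ[𝓝 p] 0) :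
    ∃ z r, 0 < r ∧ Ω = ball z r ∧
      ∀ q₁ ∈ closure Ω, ∀ q₂ ∈ closure Ω, ‖q₁ - z‖ = ‖q₂ - z‖ → U q₁ = U q₂ := by
  obtain ⟨c, hc⟩ := BiSeries.exists_hasExp (hU p hp)
  have hcr := hc.cf_conj (.of_forall hreal)
  have hQ0 := hc.wirtZ.wirtZ.eq_zero_iff.2 hQ
  have hi (i j : ℕ) : BiSeries.cf c (i + 2) j = 0 := by
    have h1 := congrArg (fun a => BiSeries.cf a i j) hQ0
    simp only [BiSeries.cf_dz, BiSeries.cf_zero, mul_eq_zero] at h1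
    have h2 (n : ℕ) : (n : ℂ) + 1 ≠ 0 := by exact_mod_cast n.succ_ne_zero
    exact (h1.resolve_left (h2 i)).resolve_left (by simpa using h2 (i + 1))
  have hj (i j : ℕ) : BiSeries.cf c i (j + 2) = 0 := by rw [hcr, hi, map_zero]
  obtain ⟨b, hbdef⟩ : ∃ b, b = BiSeries.cf c 1 0 := ⟨_, rfl⟩
  obtain ⟨l, hl⟩ : ∃ l, l = BiSeries.cf c 1 1 := ⟨_, rfl⟩
  obtain ⟨a, ha⟩ : ∃ a, a = BiSeries.cf c 0 0 := ⟨_, rfl⟩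
  have hlr : conj l = l := by rw [hl, ← hcr]
  have hform : ∀ z ∈ V, U z = a + (b * (z - p) + conj b * conj (z - p)) +
      l * ((z - p) * conj (z - p)) := by
    have aZ := analyticOnNhd_sub_const p V
    have aW := analyticOnNhd_conj_sub_const p V
    refine BiSeries.HasExp.eqOn hVc hp hU ((analyticOnNhd_const.add ((analyticOnNhd_const.mul aZ).add
      (analyticOnNhd_const.mul aW))).add (analyticOnNhd_const.mul (aZ.mul aW))) hc ?_
    have e : c = BiSeries.const a + (BiSeries.const b * BiSeries.z +
        BiSeries.const (conj b) * BiSeries.w) + BiSeries.const l * (BiSeries.z * BiSeries.w) := by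
      refine BiSeries.ext_cf fun i j => ?_
      have hzw := BiSeries.cf_monomial 1 1 i j
      rw [pow_one, pow_one] at hzw
      simp only [BiSeries.cf_add, BiSeries.cf_const_mul, hzw, BiSeries.cf_const, BiSeries.cf_z,
        BiSeries.cf_w]
      rcases i with _ | _ | i <;> rcases j with _ | _ | j <;> simp [hi, hj, ha, hbdef, hl, ← hcr]
    conv in BiSeries.HasExp _ _ _ => rw [e]
    exact ((BiSeries.hasExp_const a p).add (((BiSeries.hasExp_const b p).mul (BiSeries.hasExp_z p)).add
      ((BiSeries.hasExp_const (conj b) p).mul (BiSeries.hasExp_w p)))).add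
      ((BiSeries.hasExp_const l p).mul ((BiSeries.hasExp_z p).mul (BiSeries.hasExp_w p)))
  have hfV : frontier Ω ⊆ V := frontier_subset_closure.trans hΩV
  have hf0 : ∀ z ∈ frontier Ω, U z = 0 := by
    rw [hfr]
    rintro _ ⟨s, rfl⟩
    exact h0 s
  by_cases hl0 : l = 0
  · exfalso
    obtain ⟨v, hv0, hv⟩ : ∃ v : ℂ, v ≠ 0 ∧ b * v + conj b * conj v = 0 := by
      by_cases hb0 : b = 0
      · exact ⟨1, one_ne_zero, by simp [hb0]⟩
      · refine ⟨Complex.I * conj b, by simpa using hb0, ?_⟩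
        simp only [map_mul, Complex.conj_I, Complex.conj_conj]
        ring
    have hΩ0 : ∀ z ∈ Ω, U z = 0 := by
      intro z hz
      obtain ⟨t, -, ht⟩ := exists_ray_mem_frontier hΩ hb hz hv0
      rw [← hf0 _ ht, hform _ (hfV ht), hform z (hΩV (subset_closure hz)), hl0]
      simp only [map_sub, map_add, map_mul, Complex.conj_ofReal]
      linear_combination -t * hv
    obtain ⟨q, hq, hq0⟩ := hnz
    rw [closure_eq_self_union_frontier] at hq
    exact hq0 (hq.elim (hΩ0 q) (hf0 q))
  obtain ⟨o, ho⟩ : ∃ o, o = p - conj b / l := ⟨_, rfl⟩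
  have hform' : ∀ z ∈ V, U z = l * (‖z - o‖ : ℂ) ^ 2 + (a - b * conj b / l) := by
    intro z hz
    rw [hform z hz, ← Complex.mul_conj', ho]
    simp only [map_sub, map_div₀, Complex.conj_conj, hlr]
    field_simp
    ring
  obtain ⟨r, hr⟩ : ∃ r, r = ‖γ 0 - o‖ := ⟨_, rfl⟩
  obtain ⟨hr0, hball⟩ := eq_ball_of_frontier_subset_sphere hΩ hne hb (hr ▸ norm_nonneg _) (p := o)
    (r := r) (fun z hz => by
      have hz0 : γ 0 ∈ frontier Ω := hfr ▸ mem_range_self 0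
      have h1 := hf0 z hz
      rw [← hf0 _ hz0, hform' _ (hfV hz), hform' _ (hfV hz0), add_left_inj] at h1
      have h2 := mul_left_cancel₀ hl0 h1
      rw [hr]
      norm_cast at h2
      exact (sq_eq_sq₀ (norm_nonneg _) (norm_nonneg _)).1 h2)
  refine ⟨o, r, hr0, hball, fun q₁ hq₁ q₂ hq₂ hq => ?_⟩
  rw [hform' _ (hΩV hq₁), hform' _ (hΩV hq₂), hq]

/-- The overdetermined problem for a real analytic function whose Hessian has functionally dependent
trace and determinant. -/
theorem ball_of_overdetermined {Ω V : Set ℂ} (hΩ : IsOpen Ω) (hne : Ω.Nonempty)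
    (hb : Bornology.IsBounded Ω) (hsc : IsSimplyConnected Ω) {γ : ℝ → ℂ} (hγ : IsRegularLoop γ)
    (hfr : frontier Ω = range γ)
    (hV : IsOpen V) (hVc : IsPreconnected V) (hΩV : closure Ω ⊆ V) {U : ℂ → ℂ}
    (hU : AnalyticOnNhd ℝ U V) (hreal : ∀ q, conj (U q) = U q) (h0 : ∀ s, U (γ s) = 0)
    {c : ℝ} (h1 : ∀ s, ‖wirtZ U (γ s)‖ = c) (hnz : ∃ q ∈ closure Ω, U q ≠ 0)
    (hJ : ∀ q ∈ Ω, wirtJac (wirtZ (wirtW U))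
      (fun q => wirtZ (wirtZ U) q * wirtW (wirtW U) q) q = 0) :
    ∃ z r, 0 < r ∧ Ω = ball z r ∧
      ∀ q₁ ∈ closure Ω, ∀ q₂ ∈ closure Ω, ‖q₁ - z‖ = ‖q₂ - z‖ → U q₁ = U q₂ := by
  have hγV (s : ℝ) : γ s ∈ V := hΩV (frontier_subset_closure (hfr ▸ mem_range_self s))
  by_cases hQ : ∃ p ∈ V, wirtZ (wirtZ U) =ᶠ[𝓝 p] 0
  · obtain ⟨p, hp, hQ⟩ := hQ
    exact ball_of_umbilic hΩ hne hb hfr hVc hΩV hU hreal h0 hnz hp hQ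
  push Not at hQ
  have htan := conj_mul_deriv_sq_of_overdetermined hγ.differentiable hγ.deriv_ne
    (fun s => hU _ (hγV s)) hreal h0 h1
  have hJV : ∀ q ∈ V, wirtJac (wirtZ (wirtW U))
      (fun q => wirtZ (wirtZ U) q * wirtW (wirtW U) q) q = 0 := by
    obtain ⟨p, hp⟩ := hne
    have aQ := hU.wirtZ.wirtZ.mul hU.wirtW.wirtW
    exact AnalyticOnNhd.eqOn_zero_of_preconnected_of_eventuallyEq_zero
      ((hU.wirtW.wirtZ.wirtZ.mul aQ.wirtW).sub (hU.wirtW.wirtZ.wirtW.mul aQ.wirtZ)) hVc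
      (hΩV (subset_closure hp)) (Filter.mem_of_superset (hΩ.mem_nhds hp) hJ)
  have hdich (p : ℂ) (hp : p ∈ V) := BiSeries.hasLocalForm_or_radial (hU p hp) (.of_forall hreal)
    (Filter.mem_of_superset (hV.mem_nhds hp) hJV) (hQ p hp)
  by_cases hall : ∀ p ∈ closure Ω, HasLocalForm (wirtZ (wirtZ U)) p
  · exact (hγ.not_hasLocalForm hΩ hsc hb hfr (Filter.mem_of_superset (hV.mem_nhdsSet.2 hΩV)
      fun z hz => (hU.wirtZ.wirtZ z hz).continuousAt) hall htan).elim
  push Not at hall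
  obtain ⟨p, hp, hp'⟩ := hall
  obtain ⟨c, hc, hvan⟩ := (hdich p (hΩV hp)).resolve_left hp'
  exact ⟨p, ball_of_radial hΩ hne hb hγ hfr hV hVc hΩV hU hreal h0 htan hQ (hΩV hp) hc hvan⟩

theorem pdx_eq_fderiv {f : ℝ × ℝ → ℝ} {p : ℝ × ℝ} (hf : DifferentiableAt ℝ f p) :
    pdx f p = fderiv ℝ f p (1, 0) := by
  have h : HasDerivAt (fun x : ℝ => (x, p.2)) ((1 : ℝ), (0 : ℝ)) p.1 :=
    (hasDerivAt_id _).prodMk (hasDerivAt_const _ _)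
  exact (hf.hasFDerivAt.comp_hasDerivAt p.1 h).deriv

theorem pdy_eq_fderiv {f : ℝ × ℝ → ℝ} {p : ℝ × ℝ} (hf : DifferentiableAt ℝ f p) :
    pdy f p = fderiv ℝ f p (0, 1) := by
  have h : HasDerivAt (fun y : ℝ => (p.1, y)) ((0 : ℝ), (1 : ℝ)) p.2 :=
    (hasDerivAt_const _ _).prodMk (hasDerivAt_id _)
  exact (hf.hasFDerivAt.comp_hasDerivAt p.2 h).deriv

theorem AnalyticOnNhd.fderiv_apply_const {f : ℝ × ℝ → ℝ} {V : Set (ℝ × ℝ)}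
    (hf : AnalyticOnNhd ℝ f V) (v : ℝ × ℝ) : AnalyticOnNhd ℝ (fun p => fderiv ℝ f p v) V :=
  fun p hp => (ContinuousLinearMap.apply ℝ ℝ v).analyticAt _ |>.comp (hf.fderiv p hp)

theorem AnalyticOnNhd.pdx {f : ℝ × ℝ → ℝ} {V : Set (ℝ × ℝ)} (hV : IsOpen V)
    (hf : AnalyticOnNhd ℝ f V) : AnalyticOnNhd ℝ (pdx f) V :=
  (hf.fderiv_apply_const (1, 0)).congr hV fun p hp =>
    (pdx_eq_fderiv (hf p hp).differentiableAt).symm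

theorem AnalyticOnNhd.pdy {f : ℝ × ℝ → ℝ} {V : Set (ℝ × ℝ)} (hV : IsOpen V)
    (hf : AnalyticOnNhd ℝ f V) : AnalyticOnNhd ℝ (pdy f) V :=
  (hf.fderiv_apply_const (0, 1)).congr hV fun p hp =>
    (pdy_eq_fderiv (hf p hp).differentiableAt).symm

theorem pdy_pdx_eq_pdx_pdy {f : ℝ × ℝ → ℝ} {V : Set (ℝ × ℝ)} (hV : IsOpen V)
    (hf : AnalyticOnNhd ℝ f V) {p : ℝ × ℝ} (hp : p ∈ V) : pdy (pdx f) p = pdx (pdy f) p := by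
  have hd : DifferentiableAt ℝ (fderiv ℝ f) p := (hf.fderiv p hp).differentiableAt
  have hx : pdx f =ᶠ[𝓝 p] fun q => fderiv ℝ f q (1, 0) := by
    filter_upwards [hV.mem_nhds hp] with q hq using pdx_eq_fderiv (hf q hq).differentiableAt
  have hy : pdy f =ᶠ[𝓝 p] fun q => fderiv ℝ f q (0, 1) := by
    filter_upwards [hV.mem_nhds hp] with q hq using pdy_eq_fderiv (hf q hq).differentiableAt
  have hv (v : ℝ × ℝ) : HasFDerivAt (fun q => fderiv ℝ f q v) ((fderiv ℝ (fderiv ℝ f) p).flip v) p :=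
    hd.hasFDerivAt.clm_apply (hasFDerivAt_const v p) |>.congr_fderiv (by ext <;> simp)
  rw [pdy_eq_fderiv (hf.pdx hV p hp).differentiableAt,
    pdx_eq_fderiv (hf.pdy hV p hp).differentiableAt, hx.fderiv_eq, hy.fderiv_eq, (hv _).fderiv,
    (hv _).fderiv, ContinuousLinearMap.flip_apply, ContinuousLinearMap.flip_apply]
  have hc : ContDiffAt ℝ 2 f p := (hf p hp).contDiffAt
  exact (hc.isSymmSndFDerivAt (by simp)).eq _ _

theorem exists_orthogonal_conj_eq {a b d a' b' d' : ℝ} (htr : a + d = a' + d')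
    (hdisc : (a - d) ^ 2 + 4 * b ^ 2 = (a' - d') ^ 2 + 4 * b' ^ 2) :
    ∃ Q : Matrix (Fin 2) (Fin 2) ℝ, Qᵀ * Q = 1 ∧ Qᵀ * !![a, b; b, d] * Q = !![a', b'; b', d'] := by
  obtain ⟨e, hn, he⟩ : ∃ e : ℂ, e.re ^ 2 + e.im ^ 2 = 1 ∧
      (⟨a - d, 2 * b⟩ : ℂ) * conj e ^ 2 = ⟨a' - d', 2 * b'⟩ := by
    by_cases hw : (⟨a - d, 2 * b⟩ : ℂ) = 0
    · refine ⟨1, by simp, ?_⟩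
      obtain ⟨h1, h2⟩ := Complex.ext_iff.1 hw
      simp only [Complex.zero_re, Complex.zero_im] at h1 h2
      have h3 : b = 0 := by linarith
      rw [h1, h3] at hdisc
      have h4 : a' - d' = 0 := by nlinarith [sq_nonneg (a' - d'), sq_nonneg b']
      have h5 : b' = 0 := by nlinarith [sq_nonneg (a' - d'), sq_nonneg b']
      rw [hw, h4, h5]
      simp [Complex.ext_iff]
    · obtain ⟨e, he⟩ := IsAlgClosed.exists_pow_nat_eq
        ((⟨a' - d', 2 * b'⟩ : ℂ) / ⟨a - d, 2 * b⟩) (n := 2) two_pos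
      have hnorm : ‖(⟨a' - d', 2 * b'⟩ : ℂ)‖ = ‖(⟨a - d, 2 * b⟩ : ℂ)‖ := by
        rw [← sq_eq_sq₀ (norm_nonneg _) (norm_nonneg _), Complex.sq_norm, Complex.sq_norm,
          Complex.normSq_mk, Complex.normSq_mk]
        linarith
      have he1 : ‖e‖ ^ 2 = 1 := by
        rw [← norm_pow, he, norm_div, hnorm, div_self (norm_ne_zero_iff.2 hw)]
      refine ⟨conj e, ?_, ?_⟩
      · rw [Complex.sq_norm, Complex.normSq_apply] at he1
        rw [Complex.conj_re, Complex.conj_im]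
        linarith
      · rw [Complex.conj_conj, he, mul_div_cancel₀ _ hw]
  refine ⟨!![e.re, -e.im; e.im, e.re], ?_, ?_⟩
  · ext i j
    fin_cases i <;> fin_cases j <;>
      simp [Matrix.mul_apply, Fin.sum_univ_two] <;> linarith
  · obtain ⟨h1, h2⟩ := Complex.ext_iff.1 he
    simp only [sq, Complex.mul_re, Complex.mul_im, Complex.conj_re, Complex.conj_im] at h1 h2
    ext i j
    fin_cases i <;> fin_cases j <;>
      simp [Matrix.mul_apply, Fin.sum_univ_two]
    · linear_combination h1 / 2 + (a + d) / 2 * hn + htr / 2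
    · linear_combination h2 / 2
    · linear_combination h2 / 2
    · linear_combination -h1 / 2 + (a + d) / 2 * hn + htr / 2

/-- Two analytic functions with nonvanishing Jacobian at `p` take, near `p`, all values near
their value at `p`. -/
theorem image_mem_nhds_of_jacobian_ne_zero {f g : ℝ × ℝ → ℝ} {p : ℝ × ℝ} (hf : AnalyticAt ℝ f p)
    (hg : AnalyticAt ℝ g p) (hJ : pdx f p * pdy g p - pdy f p * pdx g p ≠ 0)
    {s : Set (ℝ × ℝ)} (hs : s ∈ 𝓝 p) : (fun q => (f q, g q)) '' s ∈ 𝓝 (f p, g p) := by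
  have hst := hf.hasStrictFDerivAt.prodMk hg.hasStrictFDerivAt
  rw [pdx_eq_fderiv hf.differentiableAt, pdy_eq_fderiv hf.differentiableAt,
    pdx_eq_fderiv hg.differentiableAt, pdy_eq_fderiv hg.differentiableAt] at hJ
  have key : ((fderiv ℝ f p).prod (fderiv ℝ g p)).range = ⊤ := by
    rw [LinearMap.range_eq_top]
    rintro ⟨α, β⟩
    have hlin (L : ℝ × ℝ →L[ℝ] ℝ) (x y : ℝ) : L (x, y) = x * L (1, 0) + y * L (0, 1) := by
      rw [← smul_eq_mul, ← smul_eq_mul, ← map_smul, ← map_smul, ← map_add]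
      simp
    obtain ⟨t, ht⟩ : ∃ t, t * (fderiv ℝ f p (1, 0) * fderiv ℝ g p (0, 1) -
      fderiv ℝ f p (0, 1) * fderiv ℝ g p (1, 0)) = 1 := ⟨_, inv_mul_cancel₀ hJ⟩
    refine ⟨(t * (α * fderiv ℝ g p (0, 1) - β * fderiv ℝ f p (0, 1)),
      t * (β * fderiv ℝ f p (1, 0) - α * fderiv ℝ g p (1, 0))), ?_⟩
    rw [ContinuousLinearMap.coe_coe, ContinuousLinearMap.prod_apply, hlin (fderiv ℝ f p) (_ * _),
      hlin (fderiv ℝ g p) (_ * _), Prod.mk.injEq]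
    exact ⟨by linear_combination α * ht, by linear_combination β * ht⟩
  rw [← hst.map_nhds_eq_of_surj key]
  exact Filter.image_mem_map hs

/-- If `F (D²u) = 0` for a rotationally invariant `F` that vanishes identically on no open set of
symmetric matrices, then the trace and the discriminant of `D²u` are functionally dependent. -/
theorem jacobian_eq_zero_of_rotInvariant {Ω : Set (ℝ × ℝ)} (hΩ : IsOpen Ω)
    {F : Matrix (Fin 2) (Fin 2) ℝ → ℝ}
    (hFrot : ∀ M Q : Matrix (Fin 2) (Fin 2) ℝ, M.IsSymm → Qᵀ * Q = 1 → F (Qᵀ * M * Q) = F M)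
    (hFnz : ∀ U : Set (Matrix (Fin 2) (Fin 2) ℝ), IsOpen U →
      (U ∩ {M | M.IsSymm}).Nonempty → ∃ M ∈ U, M.IsSymm ∧ F M ≠ 0)
    {α β δ f g : ℝ × ℝ → ℝ} (hα : AnalyticOnNhd ℝ α Ω) (hβ : AnalyticOnNhd ℝ β Ω)
    (hδ : AnalyticOnNhd ℝ δ Ω) (hFeq : ∀ p ∈ Ω, F !![α p, β p; β p, δ p] = 0)
    (hf : f = fun p => (α p + δ p) / 4)
    (hg : g = fun p => ((α p - δ p) ^ 2 + 4 * β p ^ 2) / 16)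
    {p : ℝ × ℝ} (hp : p ∈ Ω) : pdx f p * pdy g p - pdy f p * pdx g p = 0 := by
  by_contra hJ
  have hfa : AnalyticAt ℝ f p := hf ▸ ((hα p hp).add (hδ p hp)).div_const
  have hga : AnalyticAt ℝ g p := hg ▸ ((((hα p hp).sub (hδ p hp)).pow 2).add
    (analyticAt_const.mul ((hβ p hp).pow 2))).div_const
  obtain ⟨O, hOs, hO, hpO⟩ := _root_.mem_nhds_iff.1
    (image_mem_nhds_of_jacobian_ne_zero hfa hga hJ (hΩ.mem_nhds hp))
  have hcont : Continuous fun M : Matrix (Fin 2) (Fin 2) ℝ =>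
      ((M 0 0 + M 1 1) / 4, ((M 0 0 - M 1 1) ^ 2 + 4 * M 0 1 ^ 2) / 16) := by fun_prop
  obtain ⟨M, hMO, hMs, hM⟩ := hFnz _ (hO.preimage hcont) ⟨!![α p, β p; β p, δ p], by
      simpa [hf, hg] using hpO, by
      ext i j; fin_cases i <;> fin_cases j <;> rfl⟩
  obtain ⟨q, hq, hqM⟩ := hOs hMO
  simp only [hf, hg, Prod.mk.injEq] at hqM
  have h01 : M 1 0 = M 0 1 := hMs.apply 0 1
  obtain ⟨Q, hQ, hQM⟩ := exists_orthogonal_conj_eq (a := α q) (b := β q) (d := δ q) (a' := M 0 0)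
    (b' := M 0 1) (d' := M 1 1) (by linarith [hqM.1]) (by linarith [hqM.2])
  apply hM
  have hMe : M = !![M 0 0, M 0 1; M 0 1, M 1 1] := by
    rw [← h01]
    conv_lhs => rw [Matrix.eta_fin_two M]
    rw [h01]
  rw [hMe, ← hQM, hFrot _ _ (by ext i j; fin_cases i <;> fin_cases j <;> rfl) hQ, hFeq q hq]

theorem fderiv_toComplex {f : ℂ → ℂ} {a b : ℝ × ℝ → ℝ} {ζ : ℂ}
    (ha : DifferentiableAt ℝ a (ζ.re, ζ.im)) (hb : DifferentiableAt ℝ b (ζ.re, ζ.im))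
    (hf : ∀ᶠ q in 𝓝 ζ, f q = a (q.re, q.im) + Complex.I * b (q.re, q.im)) :
    fderiv ℝ f ζ 1 = pdx a (ζ.re, ζ.im) + Complex.I * pdx b (ζ.re, ζ.im) ∧
      fderiv ℝ f ζ Complex.I = pdy a (ζ.re, ζ.im) + Complex.I * pdy b (ζ.re, ζ.im) := by
  have hlift {c : ℝ × ℝ → ℝ} (hc : DifferentiableAt ℝ c (ζ.re, ζ.im)) :
      HasFDerivAt (fun q : ℂ => ((c (q.re, q.im) : ℝ) : ℂ)) (Complex.ofRealCLM.comp
        ((fderiv ℝ c (ζ.re, ζ.im)).comp (Complex.equivRealProdCLM : ℂ →L[ℝ] ℝ × ℝ))) ζ :=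
    Complex.ofRealCLM.hasFDerivAt.comp ζ (HasFDerivAt.comp ζ (g := c) hc.hasFDerivAt
      Complex.equivRealProdCLM.hasFDerivAt)
  have h := ((hlift ha).add ((hlift hb).const_mul Complex.I)).congr_of_eventuallyEq hf
  rw [h.fderiv, pdx_eq_fderiv ha, pdx_eq_fderiv hb, pdy_eq_fderiv ha, pdy_eq_fderiv hb]
  constructor <;> simp

theorem wirt_toComplex {f : ℂ → ℂ} {a b : ℝ × ℝ → ℝ} {ζ : ℂ}
    (ha : DifferentiableAt ℝ a (ζ.re, ζ.im)) (hb : DifferentiableAt ℝ b (ζ.re, ζ.im))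
    (hf : ∀ᶠ q in 𝓝 ζ, f q = a (q.re, q.im) + Complex.I * b (q.re, q.im)) :
    wirtZ f ζ = ((pdx a (ζ.re, ζ.im) + pdy b (ζ.re, ζ.im) : ℝ) +
        Complex.I * (pdx b (ζ.re, ζ.im) - pdy a (ζ.re, ζ.im) : ℝ)) / 2 ∧
      wirtW f ζ = ((pdx a (ζ.re, ζ.im) - pdy b (ζ.re, ζ.im) : ℝ) +
        Complex.I * (pdx b (ζ.re, ζ.im) + pdy a (ζ.re, ζ.im) : ℝ)) / 2 := by
  obtain ⟨h1, h2⟩ := fderiv_toComplex ha hb hf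
  rw [wirtZ, wirtW, h1, h2]
  push_cast
  constructor
  · linear_combination (-(pdy b (ζ.re, ζ.im) : ℂ) / 2) * Complex.I_sq
  · linear_combination ((pdy b (ζ.re, ζ.im) : ℂ) / 2) * Complex.I_sq

theorem pd_const_mul {f : ℝ × ℝ → ℝ} (k : ℝ) (p : ℝ × ℝ) :
    pdx (fun q => k * f q) p = k * pdx f p ∧ pdy (fun q => k * f q) p = k * pdy f p :=
  ⟨deriv_const_mul_field _, deriv_const_mul_field _⟩

theorem pd_zero (p : ℝ × ℝ) : pdx (fun _ => 0) p = 0 ∧ pdy (fun _ => 0) p = 0 := by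
  simp [pdx, pdy]

/-- The second Wirtinger derivatives of a real analytic function of two real variables. -/
theorem wirt_hessian {u : ℝ × ℝ → ℝ} {V : Set (ℝ × ℝ)} (hV : IsOpen V) (hu : AnalyticOnNhd ℝ u V)
    {U : ℂ → ℂ} (hU : ∀ q, U q = u (q.re, q.im)) {ζ : ℂ} (hζ : (ζ.re, ζ.im) ∈ V) :
    wirtZ U ζ = (pdx u (ζ.re, ζ.im) - Complex.I * pdy u (ζ.re, ζ.im)) / 2 ∧
    wirtZ (wirtW U) ζ =
      ((pdx (pdx u) (ζ.re, ζ.im) + pdy (pdy u) (ζ.re, ζ.im)) / 4 : ℝ) ∧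
    wirtZ (wirtZ U) ζ * wirtW (wirtW U) ζ =
      (((pdx (pdx u) (ζ.re, ζ.im) - pdy (pdy u) (ζ.re, ζ.im)) ^ 2 +
        4 * pdy (pdx u) (ζ.re, ζ.im) ^ 2) / 16 : ℝ) := by
  have hVo : IsOpen {q : ℂ | (q.re, q.im) ∈ V} :=
    hV.preimage (Complex.continuous_re.prodMk Complex.continuous_im)
  have first {q : ℂ} (hq : (q.re, q.im) ∈ V) :
      wirtZ U q = (pdx u (q.re, q.im) - Complex.I * pdy u (q.re, q.im)) / 2 ∧
      wirtW U q = (pdx u (q.re, q.im) + Complex.I * pdy u (q.re, q.im)) / 2 := by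
    obtain ⟨h1, h2⟩ := wirt_toComplex (b := fun _ => 0) (hu _ hq).differentiableAt
      (differentiableAt_const _) (Filter.Eventually.of_forall fun q => by simpa using hU q)
    rw [h1, h2, (pd_zero _).1, (pd_zero _).2]
    push_cast
    constructor <;> ring
  have hx := (hu.pdx hV _ hζ).differentiableAt
  have hy := (hu.pdy hV _ hζ).differentiableAt
  obtain ⟨z1, z2⟩ := wirt_toComplex (f := wirtZ U) (a := fun q => 1 / 2 * pdx u q)
    (b := fun q => (-1 / 2) * pdy u q) (hx.const_mul _) (hy.const_mul _) (by
      filter_upwards [hVo.mem_nhds hζ] with q hq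
      rw [(first hq).1]
      push_cast
      ring)
  obtain ⟨w1, w2⟩ := wirt_toComplex (f := wirtW U) (a := fun q => 1 / 2 * pdx u q)
    (b := fun q => 1 / 2 * pdy u q) (hx.const_mul _) (hy.const_mul _) (by
      filter_upwards [hVo.mem_nhds hζ] with q hq
      rw [(first hq).2]
      push_cast
      ring)
  refine ⟨(first hζ).1, ?_, ?_⟩
  · rw [w1]
    simp only [(pd_const_mul _ _).1, (pd_const_mul _ _).2, pdy_pdx_eq_pdx_pdy hV hu hζ]
    push_cast
    ring
  · rw [z1, w2]
    simp only [(pd_const_mul _ _).1, (pd_const_mul _ _).2, pdy_pdx_eq_pdx_pdy hV hu hζ]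
    push_cast
    linear_combination (-(pdx (pdy u) (ζ.re, ζ.im) : ℂ) ^ 2 / 4) * Complex.I_sq

theorem wirtJac_toComplex {f g : ℂ → ℂ} {a b : ℝ × ℝ → ℝ} {ζ : ℂ}
    (ha : DifferentiableAt ℝ a (ζ.re, ζ.im)) (hb : DifferentiableAt ℝ b (ζ.re, ζ.im))
    (hf : ∀ᶠ q in 𝓝 ζ, f q = a (q.re, q.im)) (hg : ∀ᶠ q in 𝓝 ζ, g q = b (q.re, q.im))
    (hJ : pdx a (ζ.re, ζ.im) * pdy b (ζ.re, ζ.im) - pdy a (ζ.re, ζ.im) * pdx b (ζ.re, ζ.im) = 0) :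
    wirtJac f g ζ = 0 := by
  obtain ⟨f1, f2⟩ := wirt_toComplex (b := fun _ => 0) ha (differentiableAt_const _)
    (hf.mono fun q hq => by simpa using hq)
  obtain ⟨g1, g2⟩ := wirt_toComplex (b := fun _ => 0) hb (differentiableAt_const _)
    (hg.mono fun q hq => by simpa using hq)
  have hJ' : (pdx a (ζ.re, ζ.im) * pdy b (ζ.re, ζ.im) -
      pdy a (ζ.re, ζ.im) * pdx b (ζ.re, ζ.im) : ℂ) = 0 := by exact_mod_cast hJ
  rw [wirtJac, f1, f2, g1, g2, (pd_zero _).1, (pd_zero _).2]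
  push_cast
  linear_combination (Complex.I / 2) * hJ'

/-- **Serrin's overdetermined problem for fully nonlinear non-elliptic equations.**
If `Ω ⊂ ℝ²` is a bounded, simply connected domain with smooth boundary, `F` is a
rotationally invariant function on symmetric 2×2 matrices that is not identically zero on
any nonempty open subset of the space of symmetric matrices, and `u` is real analytic on a
neighborhood of `closure Ω`, not identically zero, with `F(D²u) = 0` in `Ω`, `u = 0` and
`|Du| = c` on `∂Ω`, then `Ω` is a disk and `u` is radial about its center. -/
theorem serrin_fully_nonlinear_non_elliptic
    (Ω : Set (ℝ × ℝ)) (hΩopen : IsOpen Ω) (hΩconn : IsConnected Ω)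
    (hΩbdd : Bornology.IsBounded Ω) (hΩsc : SimplyConnectedSpace Ω)
    -- smooth boundary: `∂Ω` is the image of a smooth regular periodic Jordan curve
    (γ : ℝ → ℝ × ℝ) (hγsmooth : ContDiff ℝ (⊤ : ℕ∞) γ)
    (hγper : ∀ s, γ (s + 1) = γ s) (hγinj : InjOn γ (Ico (0 : ℝ) 1))
    (hγreg : ∀ s, deriv γ s ≠ 0) (hγbd : frontier Ω = range γ)
    -- `F` is rotationally invariant on symmetric matrices
    (F : Matrix (Fin 2) (Fin 2) ℝ → ℝ)
    (hFrot : ∀ M Q : Matrix (Fin 2) (Fin 2) ℝ, M.IsSymm → Qᵀ * Q = 1 →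
      F (Qᵀ * M * Q) = F M)
    -- `F` is not identically zero on any nonempty open subset of the space of
    -- symmetric matrices
    (hFnz : ∀ U : Set (Matrix (Fin 2) (Fin 2) ℝ), IsOpen U →
      (U ∩ {M | M.IsSymm}).Nonempty → ∃ M ∈ U, M.IsSymm ∧ F M ≠ 0)
    -- `u` is real analytic on an open neighborhood of `closure Ω`
    (u : ℝ × ℝ → ℝ) (V : Set (ℝ × ℝ)) (hV : IsOpen V) (hVΩ : closure Ω ⊆ V)
    (hu : AnalyticOnNhd ℝ u V)
    -- `u` is not identically zero
    (hunz : ∃ p ∈ closure Ω, u p ≠ 0)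
    -- `F (D²u) = 0` in `Ω`
    (hFeq : ∀ p ∈ Ω,
      F !![pdx (pdx u) p, pdy (pdx u) p; pdx (pdy u) p, pdy (pdy u) p] = 0)
    -- `u = 0` on `∂Ω`
    (hDir : ∀ p ∈ frontier Ω, u p = 0)
    -- `|Du| = c` on `∂Ω` for some constant `c`
    (c : ℝ) (hNeu : ∀ p ∈ frontier Ω, Real.sqrt ((pdx u p) ^ 2 + (pdy u p) ^ 2) = c) :
    ∃ (z : ℝ × ℝ) (r : ℝ), 0 < r ∧
      Ω = {q : ℝ × ℝ | (q.1 - z.1) ^ 2 + (q.2 - z.2) ^ 2 < r ^ 2} ∧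
      ∀ q₁ ∈ closure Ω, ∀ q₂ ∈ closure Ω,
        (q₁.1 - z.1) ^ 2 + (q₁.2 - z.2) ^ 2 = (q₂.1 - z.1) ^ 2 + (q₂.2 - z.2) ^ 2 →
        u q₁ = u q₂ := by
  obtain ⟨e, he⟩ : ∃ e : ℂ ≃L[ℝ] ℝ × ℝ, e = Complex.equivRealProdCLM := ⟨_, rfl⟩
  have hee (q : ℂ) : e q = (q.re, q.im) := by rw [he]; rfl
  have hes (p : ℝ × ℝ) : e.symm p = ⟨p.1, p.2⟩ := by
    rw [he]
    exact Complex.equivRealProdCLM_symm_apply p |>.trans (by apply Complex.ext <;> simp)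
  have hcl : closure (e ⁻¹' Ω) = e ⁻¹' closure Ω := (e.toHomeomorph.preimage_closure Ω).symm
  have hfr : frontier (e ⁻¹' Ω) = e ⁻¹' frontier Ω := (e.toHomeomorph.preimage_frontier Ω).symm
  obtain ⟨p₀, hp₀⟩ := hΩconn.nonempty
  have hΩV : Ω ⊆ V := subset_closure.trans hVΩ
  have hVc : closure Ω ⊆ connectedComponentIn V p₀ :=
    hΩconn.isPreconnected.closure.subset_connectedComponentIn (subset_closure hp₀) hVΩ
  obtain ⟨U, hU⟩ : ∃ U : ℂ → ℂ, ∀ q, U q = u (q.re, q.im) := ⟨fun q => u (q.re, q.im), fun _ => rfl⟩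
  have hUa : AnalyticOnNhd ℝ U (e ⁻¹' connectedComponentIn V p₀) := by
    intro q hq
    have h1 : AnalyticAt ℝ u (e q) := hu _ (connectedComponentIn_subset _ _ hq)
    have h2 := (Complex.ofRealCLM.analyticAt _).comp (h1.comp (e.toContinuousLinearMap.analyticAt q))
    refine h2.congr (Filter.Eventually.of_forall fun q => ?_)
    rw [hU, ← hee]
    rfl
  have hγd (s : ℝ) : deriv (fun s => e.symm (γ s)) s = e.symm (deriv γ s) :=
    (e.symm.toContinuousLinearMap.hasFDerivAt.comp_hasDerivAt s
      ((hγsmooth.differentiable (by simp)) s).hasDerivAt).deriv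
  have hγloop : IsRegularLoop fun s => e.symm (γ s) :=
    { contDiff := e.symm.contDiff.comp (contDiff_infty.1 hγsmooth 2)
      periodic := fun s => by rw [hγper]
      injOn := fun s hs t ht hst => hγinj hs ht (e.symm.injective hst)
      deriv_ne := fun s => by rw [hγd]; simpa using hγreg s }
  have hγfr : frontier (e ⁻¹' Ω) = range fun s => e.symm (γ s) := by
    rw [hfr, hγbd, ← e.image_symm_eq_preimage, ← range_comp]
    rfl
  have hγmem (s : ℝ) : γ s ∈ frontier Ω := hγbd ▸ mem_range_self s
  have hγU (s : ℝ) : ((e.symm (γ s)).re, (e.symm (γ s)).im) = γ s := by rw [hes]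
  have hαa := (hu.pdx hV).pdx hV
  have hβa := (hu.pdx hV).pdy hV
  have hδa := (hu.pdy hV).pdy hV
  obtain ⟨z, r, hr, hball, hrad⟩ := ball_of_overdetermined (U := U) (c := c / 2)
    (hΩopen.preimage e.continuous) ⟨e.symm p₀, by simpa using hp₀⟩
    (by
      rw [← e.image_symm_eq_preimage]
      exact e.symm.lipschitz.isBounded_image hΩbdd)
    (e.toHomeomorph.isSimplyConnected_preimage.2 hΩsc) hγloop hγfr
    (hV.connectedComponentIn.preimage e.continuous)
    (e.toHomeomorph.isPreconnected_preimage.2 isPreconnected_connectedComponentIn)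
    (hcl ▸ preimage_mono hVc) hUa (fun q => by rw [hU, Complex.conj_ofReal])
    (fun s => by rw [hU, hγU, hDir _ (hγmem s), Complex.ofReal_zero])
    (fun s => by
      have h := (wirt_hessian hV hu hU (ζ := e.symm (γ s))
        (by rw [hγU]; exact hVΩ (frontier_subset_closure (hγmem s)))).1
      rw [hγU] at h
      rw [h, ← hNeu _ (hγmem s), norm_div, Complex.norm_ofNat, Complex.norm_def,
        Complex.normSq_apply]
      simp [sq])
    (by
      obtain ⟨p, hp, hup⟩ := hunz
      refine ⟨e.symm p, by rw [hcl]; simpa using hp, ?_⟩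
      rw [hU, hes]
      exact_mod_cast hup)
    (fun q hq => by
      have hq' : (q.re, q.im) ∈ Ω := hee q ▸ hq
      have hev : ∀ᶠ q in 𝓝 q, (q.re, q.im) ∈ V := by
        filter_upwards [(hΩopen.preimage e.continuous).mem_nhds hq] with q hq
        exact hΩV (hee q ▸ hq)
      have hα := hαa _ (hΩV hq')
      have hβ := hβa _ (hΩV hq')
      have hδ := hδa _ (hΩV hq')
      refine wirtJac_toComplex (hα.add hδ).div_const.differentiableAt
        (((hα.sub hδ).pow 2).add (analyticAt_const.mul (hβ.pow 2))).div_const.differentiableAt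
        (hev.mono fun q hq => (wirt_hessian hV hu hU hq).2.1)
        (hev.mono fun q hq => (wirt_hessian hV hu hU hq).2.2)
        (jacobian_eq_zero_of_rotInvariant hΩopen hFrot hFnz (hαa.mono hΩV) (hβa.mono hΩV)
          (hδa.mono hΩV) (fun p hp => ?_) rfl rfl hq')
      have h := hFeq p hp
      rwa [← pdy_pdx_eq_pdx_pdy hV hu (hΩV hp)] at h)
  have hdist (p : ℝ × ℝ) : ‖e.symm p - z‖ ^ 2 = (p.1 - z.re) ^ 2 + (p.2 - z.im) ^ 2 := by
    rw [hes, Complex.sq_norm, Complex.normSq_apply]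
    simp [sq]
  refine ⟨(z.re, z.im), r, hr, ?_, fun q₁ h₁ q₂ h₂ h => ?_⟩
  · ext p
    have : p ∈ Ω ↔ e.symm p ∈ e ⁻¹' Ω := by simp
    rw [this, hball, mem_ball_iff_norm, ← sq_lt_sq₀ (norm_nonneg _) hr.le, hdist]
    rfl
  · have h' := hrad (e.symm q₁) (by rw [hcl]; simpa using h₁) (e.symm q₂)
      (by rw [hcl]; simpa using h₂)
      (by rw [← sq_eq_sq₀ (norm_nonneg _) (norm_nonneg _), hdist, hdist]; exact h)
    rw [hU, hU, hes, hes] at h'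
    exact_mod_cast h'
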